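/- Let d ≥ 1 and let μ be a compactly supported finite Borel measure on ℝ^d whose Fourier transform satisfies |μ̂(ξ)| ≤ C|ξ|^{−a} for all ξ ≠ 0, for some constant C and some a > 1/2. Then there is a constant C' such that the restricted weak-type endpoint estimate ‖M_μ f‖_{L^{p_a,∞}(ℝ^d)} ≤ C' ‖f‖_{L^{p_a,1}(ℝ^d)} holds for every Schwartz function f on ℝ^d, where p_a = (2a+1)/(2a). -/

import Mathlib

open MeasureTheory Real Set Metric FourierTransform
open scoped ENNReal NNReal RealInnerProductSpace

noncomputable section

variable {d : ℕ}

/-- Fourier transform of a finite Borel measure on ℝ^d:  μ̂(ξ) = ∫ e^{−2πi x·ξ} dμ(x). -/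
def mFT (μ : Measure (EuclideanSpace ℝ (Fin d))) (ξ : EuclideanSpace ℝ (Fin d)) : ℂ :=
  ∫ x, Complex.exp (-(2 * (π : ℂ) * Complex.I * ((⟪x, ξ⟫ : ℝ) : ℂ))) ∂μ

/-- Convolution with the dilated measure: (f ∗ μ_t)(x) = ∫ f(x − t y) dμ(y). -/
def convM (f : EuclideanSpace ℝ (Fin d) → ℂ) (μ : Measure (EuclideanSpace ℝ (Fin d)))
    (t : ℝ) (x : EuclideanSpace ℝ (Fin d)) : ℂ :=
  ∫ y, f (x - t • y) ∂μ

/-- Global maximal function M_μ f(x) = sup_{t>0} |(f ∗ μ_t)(x)|. -/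
def Mmax (μ : Measure (EuclideanSpace ℝ (Fin d))) (f : EuclideanSpace ℝ (Fin d) → ℂ)
    (x : EuclideanSpace ℝ (Fin d)) : ℝ≥0∞ :=
  ⨆ t : {t : ℝ // 0 < t}, (‖convM f μ t x‖₊ : ℝ≥0∞)

/-- Local maximal function M_μ^{loc} f(x) = sup_{t∈[1,2]} |(f ∗ μ_t)(x)|. -/
def MmaxLoc (μ : Measure (EuclideanSpace ℝ (Fin d))) (f : EuclideanSpace ℝ (Fin d) → ℂ)
    (x : EuclideanSpace ℝ (Fin d)) : ℝ≥0∞ :=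
  ⨆ t : (Icc (1:ℝ) 2), (‖convM f μ t x‖₊ : ℝ≥0∞)

/-- L^p norm (in lintegral form) of an ℝ≥0∞-valued function on ℝ^d. -/
def lpE (g : EuclideanSpace ℝ (Fin d) → ℝ≥0∞) (p : ℝ) : ℝ≥0∞ :=
  (∫⁻ x, g x ^ p) ^ (1 / p)

/-- Weak L^q quasinorm of an ℝ≥0∞-valued function on ℝ^d. -/
def wlpE (g : EuclideanSpace ℝ (Fin d) → ℝ≥0∞) (q : ℝ) : ℝ≥0∞ :=
  ⨆ l : ℝ≥0, (l : ℝ≥0∞) * (volume {x | (l : ℝ≥0∞) < g x}) ^ (1 / q)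

/-- Lorentz L^{p,1} norm (up to a constant factor p) of a complex-valued function. -/
def lorentz1 (f : EuclideanSpace ℝ (Fin d) → ℂ) (p : ℝ) : ℝ≥0∞ :=
  ∫⁻ l in Ioi (0:ℝ), (volume {x | l < ‖f x‖}) ^ (1 / p)

/-- Lorentz L^{p,r} quasinorm of a real-valued function,
‖f‖_{p,r} = ( ∫_0^∞ (λ · d_f(λ)^{1/p})^r dλ/λ )^{1/r}. -/
def lorentzR (f : EuclideanSpace ℝ (Fin d) → ℝ) (p r : ℝ) : ℝ≥0∞ :=
  (∫⁻ l in Ioi (0:ℝ),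
      (ENNReal.ofReal l * (volume {x | l < |f x|}) ^ (1 / p)) ^ r / ENNReal.ofReal l) ^ (1 / r)

/-- Littlewood–Paley projection P_k for k ∈ ℤ: (P_k f)^(ξ) = β(2^{−k}|ξ|) f̂(ξ). -/
def Pproj (β : ℝ → ℝ) (k : ℤ) (f : EuclideanSpace ℝ (Fin d) → ℂ)
    (x : EuclideanSpace ℝ (Fin d)) : ℂ :=
  ∫ ξ, Complex.exp (2 * (π : ℂ) * Complex.I * ((⟪x, ξ⟫ : ℝ) : ℂ)) *
    ((β ((2:ℝ) ^ (-k) * ‖ξ‖) : ℝ) : ℂ) * 𝓕 f ξ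

/-- The multiplier operator T_j^t, with multiplier m_j(tξ) = μ̂(tξ) β(2^{−j}|tξ|). -/
def Tj (μ : Measure (EuclideanSpace ℝ (Fin d))) (β : ℝ → ℝ) (j : ℕ) (t : ℝ)
    (f : EuclideanSpace ℝ (Fin d) → ℂ) (x : EuclideanSpace ℝ (Fin d)) : ℂ :=
  ∫ ξ, Complex.exp (2 * (π : ℂ) * Complex.I * ((⟪x, ξ⟫ : ℝ) : ℂ)) *
    (((β ((2:ℝ) ^ (-(j:ℤ)) * ‖t • ξ‖) : ℝ) : ℂ) * mFT μ (t • ξ)) * 𝓕 f ξ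

/-- The maximal multiplier operator T_j^* f(x) = sup_{t>0} |T_j^t f(x)|. -/
def TjStar (μ : Measure (EuclideanSpace ℝ (Fin d))) (β : ℝ → ℝ) (j : ℕ)
    (f : EuclideanSpace ℝ (Fin d) → ℂ) (x : EuclideanSpace ℝ (Fin d)) : ℝ≥0∞ :=
  ⨆ t : {t : ℝ // 0 < t}, (‖Tj μ β j t f x‖₊ : ℝ≥0∞)

/-- M_j f(x) = sup_{k∈ℤ} sup_{2^{−k} ≤ t < 2^{−k+1}} |(P_{k+j} f ∗ μ_t)(x)|. -/
def Mj (μ : Measure (EuclideanSpace ℝ (Fin d))) (β : ℝ → ℝ) (j : ℕ)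
    (f : EuclideanSpace ℝ (Fin d) → ℂ) (x : EuclideanSpace ℝ (Fin d)) : ℝ≥0∞ :=
  ⨆ k : ℤ, ⨆ t : (Ico ((2:ℝ) ^ (-k)) ((2:ℝ) ^ (-k+1))),
    (‖convM (Pproj β (k + j) f) μ t x‖₊ : ℝ≥0∞)

/-- P_j(μ_t ∗ μ̄_s)(x) = ∫ e^{2πi x·ξ} β(2^{−j}|ξ|) μ̂(tξ) conj(μ̂(sξ)) dξ. -/
def Kdisp (μ : Measure (EuclideanSpace ℝ (Fin d))) (β : ℝ → ℝ) (j : ℕ) (t s : ℝ)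
    (x : EuclideanSpace ℝ (Fin d)) : ℂ :=
  ∫ ξ, Complex.exp (2 * (π : ℂ) * Complex.I * ((⟪x, ξ⟫ : ℝ) : ℂ)) *
    ((β ((2:ℝ) ^ (-(j:ℤ)) * ‖ξ‖) : ℝ) : ℂ) * (mFT μ (t • ξ) * (starRingEnd ℂ) (mFT μ (s • ξ)))

/-- Convolution of a nonnegative function with a dilated measure, valued in [0,∞]. -/
def convNN (g : EuclideanSpace ℝ (Fin d) → ℝ) (σ : Measure (EuclideanSpace ℝ (Fin d)))
    (t : ℝ) (x : EuclideanSpace ℝ (Fin d)) : ℝ≥0∞ :=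
  ∫⁻ y, ENNReal.ofReal (g (x - t • y)) ∂σ

set_option linter.unusedSectionVars false
set_option linter.unusedVariables false
section Planch
variable {V : Type*} [NormedAddCommGroup V] [InnerProductSpace ℝ V] [FiniteDimensional ℝ V]
  [MeasurableSpace V] [BorelSpace V]

lemma planch_ae (u : V → ℂ) (h1 : Integrable u) (h2 : MemLp u 2) :
    (𝓕 u) =ᵐ[volume] ((𝓕 (h2.toLp u) : Lp (α := V) ℂ 2 volume) : V → ℂ) := by
  have hcont : Continuous (𝓕 u) := by
    exact VectorFourier.fourierIntegral_continuous Real.continuous_fourierChar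
      (by exact continuous_inner) h1
  apply ae_eq_of_integral_contDiff_smul_eq
  · exact hcont.locallyIntegrable
  · exact (Lp.memLp _).locallyIntegrable (by norm_num)
  · intro g g_smooth g_cpt
    have hg₁ : HasCompactSupport (Complex.ofRealCLM ∘ g) := g_cpt.comp_left rfl
    have hg₂ : ContDiff ℝ (⊤ : ℕ∞) (Complex.ofRealCLM ∘ g) := by fun_prop
    set G := hg₁.toSchwartzMap hg₂ with hG
    have e1 : ∫ x, g x • ((𝓕 (h2.toLp u) : Lp (α := V) ℂ 2 volume) : V → ℂ) x =
        ((𝓕 (h2.toLp u) : Lp (α := V) ℂ 2 volume) : TemperedDistribution V ℂ) G := by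
      rw [Lp.toTemperedDistribution_apply (μ := volume)]
      simp [hG]
    rw [e1, ← MeasureTheory.Lp.fourier_toTemperedDistribution_eq, TemperedDistribution.fourier_apply,
      Lp.toTemperedDistribution_apply (μ := volume)]
    have e2 : ∫ x, (𝓕 G) x • (h2.toLp u : V → ℂ) x = ∫ x, (𝓕 G) x • u x := by
      apply integral_congr_ae
      filter_upwards [h2.coeFn_toLp] with x hx
      rw [hx]
    rw [e2]
    have := VectorFourier.integral_fourierIntegral_smul_eq_flip (L := innerₗ V) (μ := volume) (ν := volume)
      Real.continuous_fourierChar (by exact continuous_inner) (G.integrable (μ := volume)) h1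
    have e3 : (innerₗ V).flip = innerₗ V := by
      ext x y; simp
    rw [e3] at this
    have e4 : ∫ x, g x • 𝓕 u x = ∫ x, G x • 𝓕 u x := by simp [hG]
    rw [e4]
    exact this.symm

lemma planch (u : V → ℂ) (h1 : Integrable u) (h2 : MemLp u 2) :
    ∫⁻ ξ, ‖𝓕 u ξ‖ₑ ^ 2 = ∫⁻ x, ‖u x‖ₑ ^ 2 := by
  have k : eLpNorm (𝓕 u) 2 volume = eLpNorm u 2 volume := by
    rw [eLpNorm_congr_ae (planch_ae u h1 h2)]
    have := Lp.norm_fourier_eq (h2.toLp u)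
    rw [Lp.norm_def, Lp.norm_def, ENNReal.toReal_eq_toReal_iff' (Lp.eLpNorm_ne_top _)
      (Lp.eLpNorm_ne_top _)] at this
    rw [this]
    exact eLpNorm_congr_ae h2.coeFn_toLp
  have h := congrArg (fun z => z ^ (2:ℝ)) k

  rw [eLpNorm_eq_lintegral_rpow_enorm_toReal (by norm_num) (by norm_num), eLpNorm_eq_lintegral_rpow_enorm_toReal (by norm_num) (by norm_num),
    ← ENNReal.rpow_mul, ← ENNReal.rpow_mul] at h
  simpa using h
end Planch

section FTF
variable {V : Type*} [NormedAddCommGroup V] [InnerProductSpace ℝ V] [FiniteDimensional ℝ V]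
  [MeasurableSpace V] [BorelSpace V]

lemma ftf_bound (H : V → V → ℂ) (hH : Continuous (fun p : V × V => H p.1 p.2)) (ρ R : ℝ)
    (hsupp : ∀ z y, ρ < ‖z‖ → H z y = 0) :
    ∃ B : ℝ, 0 ≤ B ∧ ∀ z y, ‖y‖ ≤ R → ‖H z y‖ ≤ B := by
  have hc : IsCompact ((closedBall (0:V) ρ) ×ˢ (closedBall (0:V) R)) :=
    (isCompact_closedBall _ _).prod (isCompact_closedBall _ _)
  obtain ⟨B, hB⟩ := hc.exists_bound_of_continuousOn hH.continuousOn
  refine ⟨max B 0, le_max_right _ _, fun z y hy => ?_⟩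
  by_cases hz : ρ < ‖z‖
  · rw [hsupp z y hz]; simp
  · exact (hB (z, y) ⟨by simpa using hz, by simpa using hy⟩).trans (le_max_left _ _)

lemma ftf_cont (H : V → V → ℂ) (hH : Continuous (fun p : V × V => H p.1 p.2)) (ρ R : ℝ)
    (hsupp : ∀ z y, ρ < ‖z‖ → H z y = 0) (μ : Measure V) [IsFiniteMeasure μ]
    (hμ : ∀ᵐ y ∂μ, ‖y‖ ≤ R) :
    Continuous (fun p : ℝ × V => ∫ y, H (p.2 - p.1 • y) y ∂μ) := by
  obtain ⟨B, hB0, hB⟩ := ftf_bound H hH ρ R hsupp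
  refine continuous_of_dominated (bound := fun _ => B) ?_ ?_ ?_ ?_
  · intro p
    refine Continuous.aestronglyMeasurable ?_
    exact hH.comp (f := fun y : V => (p.2 - p.1 • y, y)) (by fun_prop)
  · intro p
    filter_upwards [hμ] with y hy
    exact hB _ _ hy
  · exact integrable_const _
  · refine Filter.Eventually.of_forall fun y => ?_
    exact hH.comp (f := fun p : ℝ × V => (p.2 - p.1 • y, y)) (by fun_prop)

lemma ftf_supp (H : V → V → ℂ) (ρ R : ℝ)
    (hsupp : ∀ z y, ρ < ‖z‖ → H z y = 0) (μ : Measure V)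
    (hμ : ∀ᵐ y ∂μ, ‖y‖ ≤ R) (t : ℝ) (x : V) (hx : ρ + |t| * R < ‖x‖) :
    ∫ y, H (x - t • y) y ∂μ = 0 := by
  apply integral_eq_zero_of_ae
  filter_upwards [hμ] with y hy
  apply hsupp
  have h1 : ‖x‖ ≤ ‖x - t • y‖ + ‖t • y‖ := by simpa using norm_add_le (x - t • y) (t • y)
  have h2 : ‖t • y‖ ≤ |t| * R := by
    rw [norm_smul, Real.norm_eq_abs]; gcongr
  linarith

lemma ftf_hcs (F : V → ℂ) (r : ℝ) (h : ∀ x, r < ‖x‖ → F x = 0) : HasCompactSupport F := by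
  apply HasCompactSupport.intro (isCompact_closedBall (0:V) r)
  intro x hx
  apply h
  simpa using hx

lemma ftf_fourier (H : V → V → ℂ) (hH : Continuous (fun p : V × V => H p.1 p.2)) (ρ R : ℝ)
    (hsupp : ∀ z y, ρ < ‖z‖ → H z y = 0) (μ : Measure V) [IsFiniteMeasure μ]
    (hμ : ∀ᵐ y ∂μ, ‖y‖ ≤ R) (t : ℝ) (ξ : V) :
    𝓕 (fun x => ∫ y, H (x - t • y) y ∂μ) ξ =
      ∫ y, Complex.exp (↑(-2 * π * (t * ⟪y, ξ⟫)) * Complex.I) * 𝓕 (fun z => H z y) ξ ∂μ := by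
  obtain ⟨B, hB0, hB⟩ := ftf_bound H hH ρ R hsupp
  rw [Real.fourier_eq']
  have e1 : ∀ x : V, Complex.exp (↑(-2 * π * ⟪x, ξ⟫) * Complex.I) • ∫ y, H (x - t • y) y ∂μ
      = ∫ y, Complex.exp (↑(-2 * π * ⟪x, ξ⟫) * Complex.I) * H (x - t • y) y ∂μ := by
    intro x; rw [smul_eq_mul, ← integral_const_mul]
  simp_rw [e1]
  rw [integral_integral_swap]
  · congr 1
    ext y
    rw [Real.fourier_eq', ← integral_const_mul]
    rw [← integral_add_right_eq_self (fun x => Complex.exp (↑(-2 * π * ⟪x, ξ⟫) * Complex.I) * H (x - t • y) y) (t • y)]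
    congr 1
    ext x
    rw [inner_add_left, inner_smul_left, smul_eq_mul, ← mul_assoc, ← Complex.exp_add]
    simp only [add_sub_cancel_right]
    congr 2
    push_cast
    simp
    ring
  · have hcont : Continuous (fun p : V × V => Complex.exp (↑(-2 * π * ⟪p.1, ξ⟫) * Complex.I) * H (p.1 - t • p.2) p.2) := by
      apply Continuous.mul
      · fun_prop
      · exact hH.comp (f := fun p : V × V => (p.1 - t • p.2, p.2)) (by fun_prop)
    have hIntg : Integrable (fun p : V × V => (closedBall (0:V) (ρ + |t| * R)).indicator (fun _ => B) p.1)
        (volume.prod μ) := by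
      have : Integrable ((closedBall (0:V) (ρ + |t| * R)).indicator (fun _ => B)) (volume : Measure V) := by
        rw [integrable_indicator_iff measurableSet_closedBall]
        exact integrableOn_const (measure_closedBall_lt_top.ne) 
      exact this.comp_fst μ
    refine hIntg.mono' hcont.aestronglyMeasurable ?_
    filter_upwards [(Measure.quasiMeasurePreserving_snd (μ := (volume : Measure V)) (ν := μ)).ae hμ] with p hp
    simp only [Function.uncurry]
    rw [norm_mul, Complex.norm_exp_ofReal_mul_I, one_mul]
    by_cases hx : p.1 ∈ closedBall (0:V) (ρ + |t| * R)
    · rw [indicator_of_mem hx]; exact hB _ _ hp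
    · rw [indicator_of_notMem hx]
      rw [hsupp, norm_zero]
      have h1 : ‖p.1‖ ≤ ‖p.1 - t • p.2‖ + ‖t • p.2‖ := by simpa using norm_add_le (p.1 - t • p.2) (t • p.2)
      have h2 : ‖t • p.2‖ ≤ |t| * R := by
        rw [norm_smul, Real.norm_eq_abs]; gcongr
      simp at hx
      linarith

lemma planch_cc (u : V → ℂ) (h1 : Continuous u) (h2 : HasCompactSupport u) :
    ∫⁻ ξ, ‖𝓕 u ξ‖ₑ ^ 2 = ∫⁻ x, ‖u x‖ₑ ^ 2 :=
  planch u (h1.integrable_of_hasCompactSupport h2) (h1.memLp_of_hasCompactSupport h2)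
end FTF

section Grad
variable {V : Type*} [NormedAddCommGroup V] [InnerProductSpace ℝ V] [FiniteDimensional ℝ V]
  [MeasurableSpace V] [BorelSpace V]

/-- Fourier transform of a measure, general inner product space form. -/
def mV (μ : Measure V) (ξ : V) : ℂ := ∫ y, Complex.exp (↑(-2 * π * ⟪y, ξ⟫) * Complex.I) ∂μ

lemma mV_bound (μ : Measure V) [IsFiniteMeasure μ] (ξ : V) : ‖mV μ ξ‖ ≤ μ.real univ := by
  unfold mV
  refine (norm_integral_le_integral_norm _).trans ?_
  simp only [Complex.norm_exp_ofReal_mul_I]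
  simp

lemma mV_cont (μ : Measure V) [IsFiniteMeasure μ] : Continuous (mV μ) := by
  unfold mV
  refine continuous_of_dominated (bound := fun _ => 1) ?_ ?_ (integrable_const _) ?_
  · intro p; exact Continuous.aestronglyMeasurable (by fun_prop)
  · intro p; refine Filter.Eventually.of_forall fun y => ?_
    rw [Complex.norm_exp_ofReal_mul_I]
  · refine Filter.Eventually.of_forall fun y => ?_
    fun_prop

lemma mV_decay' (μ : Measure V) [IsFiniteMeasure μ] (a C : ℝ) (ha : 0 ≤ a)
    (h : ∀ ξ : V, ξ ≠ 0 → ‖mV μ ξ‖ ≤ C * ‖ξ‖ ^ (-a)) :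
    ∃ C1 : ℝ, 0 ≤ C1 ∧ ∀ ξ : V, ‖mV μ ξ‖ ≤ C1 * (1 + ‖ξ‖) ^ (-a) := by
  refine ⟨2 ^ a * (|C| + μ.real univ), by positivity, fun ξ => ?_⟩
  have key : ∀ s : ℝ, 0 < s → s ≤ 2 → (1 + ‖ξ‖) ≤ 2 * ‖ξ‖ → ‖ξ‖ ^ (-a) ≤ 2 ^ a * (1 + ‖ξ‖) ^ (-a) := by
    intro s _ _ h2
    have hξ : 0 < ‖ξ‖ := by linarith [norm_nonneg ξ]
    rw [rpow_neg hξ.le, rpow_neg (by positivity), ← div_eq_mul_inv, le_div_iff₀ (by positivity), inv_mul_le_iff₀ (by positivity),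
      ← mul_rpow (by positivity) (by positivity)]
    apply rpow_le_rpow (by positivity) _ ha
    linarith
  by_cases h1 : 1 ≤ ‖ξ‖
  · have hne : ξ ≠ 0 := by rintro rfl; simp at h1; linarith
    have k1 := key 1 one_pos one_le_two (by linarith)
    calc ‖mV μ ξ‖ ≤ C * ‖ξ‖ ^ (-a) := h ξ hne
      _ ≤ (|C| + μ.real univ) * ‖ξ‖ ^ (-a) := by
        gcongr; linarith [le_abs_self C, measureReal_nonneg (μ := μ) (s := univ)]
      _ ≤ (|C| + μ.real univ) * (2 ^ a * (1 + ‖ξ‖) ^ (-a)) := by gcongr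
      _ = _ := by ring
  · push Not at h1
    have k : 1 ≤ 2 ^ a * (1 + ‖ξ‖) ^ (-a) := by
      rw [rpow_neg (by positivity), ← div_eq_mul_inv, le_div_iff₀ (by positivity), one_mul]
      apply rpow_le_rpow (by positivity) _ ha
      linarith
    calc ‖mV μ ξ‖ ≤ μ.real univ := mV_bound μ ξ
      _ ≤ (|C| + μ.real univ) * 1 := by linarith [abs_nonneg C]
      _ ≤ (|C| + μ.real univ) * (2 ^ a * (1 + ‖ξ‖) ^ (-a)) := by gcongr
      _ = _ := by ring

lemma schw_weight (c : SchwartzMap V ℂ) (a : ℝ) :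
    Integrable (fun η => ‖c η‖ * (1 + ‖η‖) ^ a) := by
  obtain ⟨N, hN⟩ := exists_nat_ge a
  have h0 : Integrable (fun η => 2 ^ (N-1) * (‖c η‖ + ‖η‖ ^ N * ‖c η‖)) := by
    apply Integrable.const_mul
    exact c.integrable.norm.add (c.integrable_pow_mul volume N)
  refine h0.mono' ?_ ?_
  · refine Continuous.aestronglyMeasurable ?_
    refine c.continuous.norm.mul ?_
    refine Continuous.rpow_const (by fun_prop) ?_
    intro x; left; positivity
  · refine Filter.Eventually.of_forall fun η => ?_
    rw [Real.norm_of_nonneg (by positivity)]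
    have : (1 + ‖η‖) ^ a ≤ 2 ^ (N-1) * (1 + ‖η‖ ^ N) := by
      calc (1 + ‖η‖) ^ a ≤ (1 + ‖η‖) ^ (N:ℝ) := rpow_le_rpow_of_exponent_le (by linarith [norm_nonneg η]) hN
        _ = (1 + ‖η‖) ^ N := rpow_natCast _ _
        _ ≤ 2 ^ (N-1) * (1 ^ N + ‖η‖ ^ N) := add_pow_le (by norm_num) (norm_nonneg _) N
        _ = _ := by simp
    calc ‖c η‖ * (1 + ‖η‖) ^ a ≤ ‖c η‖ * (2 ^ (N-1) * (1 + ‖η‖ ^ N)) := by gcongr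
      _ = _ := by ring

lemma schw_decay (μ : Measure V) [IsFiniteMeasure μ] (a C1 : ℝ) (ha : 0 ≤ a) (hC1 : 0 ≤ C1)
    (h : ∀ ξ : V, ‖mV μ ξ‖ ≤ C1 * (1 + ‖ξ‖) ^ (-a)) (c : SchwartzMap V ℂ) :
    ∃ C2 : ℝ, 0 ≤ C2 ∧ ∀ ξ : V,
      ‖∫ y, c y * Complex.exp (↑(-2 * π * ⟪y, ξ⟫) * Complex.I) ∂μ‖ ≤ C2 * (1 + ‖ξ‖) ^ (-a) := by
  refine ⟨C1 * ∫ η, ‖(𝓕 c) η‖ * (1 + ‖η‖) ^ a, ?_, fun ξ => ?_⟩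
  · refine mul_nonneg hC1 (integral_nonneg fun η => by positivity)
  have inv : ∀ y : V, c y = ∫ η, Complex.exp (↑(2 * π * ⟪η, y⟫) * Complex.I) * (𝓕 c) η := by
    intro y
    have := congrFun (c.continuous.fourierInv_fourier_eq c.integrable (𝓕 c).integrable) y
    rw [Real.fourierInv_eq'] at this
    rw [← this]; rfl
  have e : ∫ y, c y * Complex.exp (↑(-2 * π * ⟪y, ξ⟫) * Complex.I) ∂μ
      = ∫ η, (𝓕 c) η * mV μ (ξ - η) := by
    have e1 : ∀ y : V, c y * Complex.exp (↑(-2 * π * ⟪y, ξ⟫) * Complex.I)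
        = ∫ η, (𝓕 c) η * Complex.exp (↑(-2 * π * ⟪y, ξ - η⟫) * Complex.I) := by
      intro y
      rw [inv y, ← integral_mul_const]
      congr 1; ext η
      rw [mul_comm (Complex.exp _), mul_assoc, ← Complex.exp_add]
      congr 2
      rw [inner_sub_right, real_inner_comm y η]
      push_cast; ring
    simp_rw [e1]
    rw [integral_integral_swap]
    · congr 1; ext η
      rw [integral_const_mul]; rfl
    · have hi : Integrable (fun p : V × V => ‖(𝓕 c) p.2‖) (μ.prod volume) := by
        exact ((𝓕 c).integrable.norm).comp_snd μ
      refine hi.mono' ?_ ?_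
      · refine Continuous.aestronglyMeasurable ?_
        have := (𝓕 c).continuous
        simp only [Function.uncurry_def]
        fun_prop
      · refine Filter.Eventually.of_forall fun p => ?_
        simp only [Function.uncurry]
        rw [norm_mul, Complex.norm_exp_ofReal_mul_I, mul_one]
  rw [e]
  have hw := schw_weight (𝓕 c) a
  calc ‖∫ η, (𝓕 c) η * mV μ (ξ - η)‖ ≤ ∫ η, (C1 * (1 + ‖ξ‖) ^ (-a)) * (‖(𝓕 c) η‖ * (1 + ‖η‖) ^ a) := by
        refine norm_integral_le_of_norm_le (hw.const_mul _) (Filter.Eventually.of_forall fun η => ?_)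
        rw [norm_mul]
        have h1 := h (ξ - η)
        have h2 : (1 + ‖ξ - η‖) ^ (-a) ≤ (1 + ‖ξ‖) ^ (-a) * (1 + ‖η‖) ^ a := by
          rw [rpow_neg (by positivity), rpow_neg (by positivity), inv_mul_eq_div,
            le_div_iff₀ (by positivity), inv_mul_le_iff₀ (by positivity), ← mul_rpow (by positivity) (by positivity)]
          apply rpow_le_rpow (by positivity) _ ha
          have : ‖ξ‖ ≤ ‖ξ - η‖ + ‖η‖ := by simpa using norm_add_le (ξ - η) η
          nlinarith [norm_nonneg (ξ - η), norm_nonneg η]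
        calc ‖(𝓕 c) η‖ * ‖mV μ (ξ - η)‖ ≤ ‖(𝓕 c) η‖ * (C1 * ((1 + ‖ξ‖) ^ (-a) * (1 + ‖η‖) ^ a)) := by
              gcongr; exact h1.trans (by gcongr)
          _ = _ := by ring
    _ = _ := by rw [integral_const_mul]; ring

lemma grad_decay (μ : Measure V) [IsFiniteMeasure μ] (R : ℝ) (hμ : ∀ᵐ y ∂μ, ‖y‖ ≤ R)
    (a C : ℝ) (ha : 0 ≤ a) (h : ∀ ξ : V, ξ ≠ 0 → ‖mV μ ξ‖ ≤ C * ‖ξ‖ ^ (-a)) :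
    ∃ C2 : ℝ, 0 ≤ C2 ∧ ∀ ξ v : V, ξ ≠ 0 →
      ‖∫ y, (⟪y, v⟫ : ℂ) * Complex.exp (↑(-2 * π * ⟪y, ξ⟫) * Complex.I) ∂μ‖ ≤
        C2 * ‖v‖ * ‖ξ‖ ^ (-a) := by
  obtain ⟨C1, hC1, h1⟩ := mV_decay' μ a C ha h
  let χ : ContDiffBump (0:V) := ⟨|R| + 1, |R| + 2, by positivity, by linarith⟩
  let b := stdOrthonormalBasis ℝ V
  have hcs : ∀ i, HasCompactSupport (fun y : V => (((⟪y, b i⟫ * χ y : ℝ)) : ℂ)) := by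
    intro i
    have : HasCompactSupport (fun y : V => (⟪y, b i⟫ * χ y : ℝ)) := χ.hasCompactSupport.mul_left
    exact this.comp_left (g := fun r : ℝ => (r : ℂ)) Complex.ofReal_zero
  have hsm : ∀ i, ContDiff ℝ (⊤ : ℕ∞) (fun y : V => (((⟪y, b i⟫ * χ y : ℝ)) : ℂ)) := by
    intro i
    refine Complex.ofRealCLM.contDiff.comp (ContDiff.mul ?_ χ.contDiff)
    exact contDiff_id.inner ℝ contDiff_const
  choose D hD0 hD using fun i => schw_decay μ a C1 ha hC1 h1 ((hcs i).toSchwartzMap (hsm i))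
  refine ⟨∑ i, D i, Finset.sum_nonneg fun i _ => hD0 i, fun ξ v hξ => ?_⟩
  have hIntg : ∀ i, Integrable (fun y => ((hcs i).toSchwartzMap (hsm i)) y * Complex.exp (↑(-2 * π * ⟪y, ξ⟫) * Complex.I)) μ := by
    intro i
    refine Integrable.mono' (g := fun y => ‖((hcs i).toSchwartzMap (hsm i)) y‖) ?_ ?_ ?_
    · refine Integrable.norm ?_
      exact Continuous.integrable_of_hasCompactSupport (SchwartzMap.continuous _) (hcs i)
    · refine Continuous.aestronglyMeasurable ?_
      have := ((hcs i).toSchwartzMap (hsm i)).continuous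
      fun_prop
    · refine Filter.Eventually.of_forall fun y => ?_
      rw [norm_mul, Complex.norm_exp_ofReal_mul_I, mul_one]
  have e : ∫ y, (⟪y, v⟫ : ℂ) * Complex.exp (↑(-2 * π * ⟪y, ξ⟫) * Complex.I) ∂μ =
      ∑ i, (⟪b i, v⟫ : ℂ) * ∫ y, ((hcs i).toSchwartzMap (hsm i)) y * Complex.exp (↑(-2 * π * ⟪y, ξ⟫) * Complex.I) ∂μ := by
    simp_rw [← integral_const_mul]
    rw [← integral_finsetSum _ (fun i _ => (hIntg i).const_mul _)]
    apply integral_congr_ae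
    filter_upwards [hμ] with y hy
    have hχ : χ y = 1 := by
      apply χ.one_of_mem_closedBall
      simp only [mem_closedBall, dist_zero_right]
      show ‖y‖ ≤ |R| + 1
      linarith [le_abs_self R]
    have : (⟪y, v⟫ : ℝ) = ∑ i, ⟪y, b i⟫ * ⟪b i, v⟫ := (b.sum_inner_mul_inner y v).symm
    rw [this]
    push_cast
    rw [Finset.sum_mul]
    refine Finset.sum_congr rfl fun i _ => ?_
    simp [hχ]
    ring
  rw [e]
  refine (norm_sum_le _ _).trans ?_
  rw [Finset.sum_mul, Finset.sum_mul]
  refine Finset.sum_le_sum fun i _ => ?_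
  rw [norm_mul]
  have h3 : ‖(⟪b i, v⟫ : ℂ)‖ ≤ ‖v‖ := by
    rw [Complex.norm_real]
    have := norm_inner_le_norm (𝕜 := ℝ) (b i) v
    simpa [b.norm_eq_one] using this
  have h4 : (1 + ‖ξ‖) ^ (-a) ≤ ‖ξ‖ ^ (-a) := by
    apply rpow_le_rpow_of_nonpos (norm_pos_iff.2 hξ) (by linarith) (by linarith)
  calc _ ≤ ‖v‖ * (D i * (1 + ‖ξ‖) ^ (-a)) := mul_le_mul h3 (hD i ξ) (norm_nonneg _) (norm_nonneg _)
    _ ≤ ‖v‖ * (D i * ‖ξ‖ ^ (-a)) := by have := hD0 i; gcongr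
    _ = _ := by ring
end Grad

section Kern
variable {V : Type*} [NormedAddCommGroup V] [InnerProductSpace ℝ V] [FiniteDimensional ℝ V]
  [MeasurableSpace V] [BorelSpace V]

/-- L¹-normalised dilate of a kernel. -/
def scl (K : V → ℂ) (r : ℝ) (x : V) : ℂ := (((r ^ (Module.finrank ℝ V))⁻¹ : ℝ) : ℂ) * K (r⁻¹ • x)

lemma scl_contDiff (K : V → ℂ) (hK : ContDiff ℝ (⊤ : ℕ∞) K) (r : ℝ) : ContDiff ℝ (⊤ : ℕ∞) (scl K r) := by
  unfold scl
  exact contDiff_const.mul (hK.comp (contDiff_const_smul _))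

lemma scl_supp (K : V → ℂ) (c : ℝ) (h : ∀ x, c < ‖x‖ → K x = 0) (r : ℝ) (hr : 0 < r) (x : V)
    (hx : c * r < ‖x‖) : scl K r x = 0 := by
  unfold scl
  rw [h, mul_zero]
  rw [norm_smul, norm_inv, Real.norm_of_nonneg hr.le, inv_mul_eq_div, lt_div_iff₀ hr]
  exact hx

lemma scl_fourier (K : V → ℂ) (r : ℝ) (hr : 0 < r) (ξ : V) : 𝓕 (scl K r) ξ = 𝓕 K (r • ξ) := by
  rw [Real.fourier_eq', Real.fourier_eq']
  have e : ∀ x : V, Complex.exp (↑(-2 * π * ⟪x, ξ⟫) * Complex.I) • scl K r x =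
      (((r ^ (Module.finrank ℝ V))⁻¹ : ℝ) : ℂ) *
      (fun x => Complex.exp (↑(-2 * π * ⟪x, r • ξ⟫) * Complex.I) • K x) (r⁻¹ • x) := by
    intro x
    simp only [inner_smul_left, inner_smul_right, scl, smul_eq_mul]
    have : r * ((starRingEnd ℝ) r⁻¹ * ⟪x, ξ⟫) = ⟪x, ξ⟫ := by
      simp only [conj_trivial]; field_simp
    rw [this]; ring
  simp_rw [e]
  rw [integral_const_mul, Measure.integral_comp_inv_smul_of_nonneg volume
    (fun x => Complex.exp (↑(-2 * π * ⟪x, r • ξ⟫) * Complex.I) • K x) hr.le]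
  rw [Complex.real_smul, ← mul_assoc, ← Complex.ofReal_mul, inv_mul_cancel₀ (by positivity)]
  simp

lemma kern_exists (N : ℕ) : ∃ φ : V → ℂ, ContDiff ℝ (⊤ : ℕ∞) φ ∧ HasCompactSupport φ ∧
    ∃ C : ℝ, 0 ≤ C ∧ ∀ η : V, ‖1 - 𝓕 φ η‖ ≤ C * ‖η‖ ^ N := by
  let χ : ContDiffBump (0:V) := ⟨1, 2, by positivity, by norm_num⟩
  let g : V → ℂ := fun x => ((χ.normed volume x : ℝ) : ℂ)
  have hgs : ContDiff ℝ (⊤ : ℕ∞) g := Complex.ofRealCLM.contDiff.comp χ.contDiff_normed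
  have hgc : HasCompactSupport g := by
    have : HasCompactSupport (χ.normed volume) := χ.hasCompactSupport_normed
    exact this.comp_left (g := fun r : ℝ => (r : ℂ)) Complex.ofReal_zero
  have hgi : Integrable g := hgs.continuous.integrable_of_hasCompactSupport hgc
  have hg1 : ∫ x, g x = 1 := by
    simp only [g]
    rw [integral_complex_ofReal, χ.integral_normed]; simp
  have hgw : Integrable (fun x => ‖g x‖ * ‖x‖) := by
    refine Continuous.integrable_of_hasCompactSupport ?_ ?_
    · have := hgs.continuous; fun_prop
    · exact hgc.norm.mul_right
  have hĝ : ∀ η : V, ‖1 - 𝓕 g η‖ ≤ (2 * π * ∫ x, ‖g x‖ * ‖x‖) * ‖η‖ := by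
    intro η
    rw [Real.fourier_eq', ← hg1]
    rw [← integral_sub hgi]
    · calc _ ≤ ∫ x, (2 * π * ‖η‖) * (‖g x‖ * ‖x‖) := by
            refine norm_integral_le_of_norm_le (hgw.const_mul _) (Filter.Eventually.of_forall fun x => ?_)
            have h1 : g x - Complex.exp (↑(-2 * π * ⟪x, η⟫) * Complex.I) • g x =
              -((Complex.exp (Complex.I * ↑(-2 * π * ⟪x, η⟫)) - 1) * g x) := by
              rw [smul_eq_mul, mul_comm Complex.I]; ring
            rw [h1, norm_neg, norm_mul]
            have h2 := Real.norm_exp_I_mul_ofReal_sub_one_le (x := -2 * π * ⟪x, η⟫)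
            have h3 : ‖-2 * π * ⟪x, η⟫‖ ≤ 2 * π * (‖x‖ * ‖η‖) := by
              rw [norm_mul]
              have := norm_inner_le_norm (𝕜 := ℝ) x η
              have h4 : ‖-2 * π‖ = 2 * π := by
                rw [neg_mul, norm_neg, Real.norm_of_nonneg (by positivity)]
              rw [h4]; gcongr
            calc _ ≤ (2 * π * (‖x‖ * ‖η‖)) * ‖g x‖ := by gcongr; exact h2.trans h3
              _ = _ := by ring
        _ = _ := by rw [integral_const_mul]; ring
    · refine hgi.norm.mono' ?_ ?_
      · refine Continuous.aestronglyMeasurable ?_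
        have := hgs.continuous
        fun_prop
      · refine Filter.Eventually.of_forall fun x => ?_
        rw [norm_smul, Complex.norm_exp_ofReal_mul_I, one_mul]
  have main : ∀ N : ℕ, ∃ φ : V → ℂ, ContDiff ℝ (⊤ : ℕ∞) φ ∧ HasCompactSupport φ ∧
      ∀ η : V, 1 - 𝓕 φ η = (1 - 𝓕 g η) ^ N := by
    intro N
    induction N with
    | zero =>
      refine ⟨fun _ => 0, contDiff_const, ?_, fun η => ?_⟩
      · exact HasCompactSupport.zero
      · rw [Real.fourier_eq']; simp
    | succ N ih =>
      obtain ⟨φ, h1, h2, h3⟩ := ih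
      let L := ContinuousLinearMap.mul ℂ ℂ
      let LR := ContinuousLinearMap.mul ℝ ℂ
      have hφi : Integrable φ := h1.continuous.integrable_of_hasCompactSupport h2
      have hcv : ContDiff ℝ (⊤ : ℕ∞) (convolution g φ LR volume) :=
        h2.contDiff_convolution_right LR hgi.locallyIntegrable h1
      have hcvc : HasCompactSupport (convolution g φ LR volume) :=
        HasCompactSupport.convolution LR hgc h2
      have hcvi : Integrable (convolution g φ LR volume) := hcv.continuous.integrable_of_hasCompactSupport hcvc
      have hF : ∀ η, 𝓕 (convolution g φ LR volume) η = 𝓕 g η * 𝓕 φ η := by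
        intro η
        rw [← Real.fourier_mul_convolution_eq hgi hφi]
        rfl
      refine ⟨fun x => g x + φ x - convolution g φ LR volume x, (hgs.add h1).sub hcv, ?_, fun η => ?_⟩
      · exact (hgc.add h2).sub hcvc
      · have e : 𝓕 (fun x => g x + φ x - convolution g φ LR volume x) η
            = 𝓕 g η + 𝓕 φ η - 𝓕 (convolution g φ LR volume) η := by
          simp only [Real.fourier_eq]
          rw [← integral_add, ← integral_sub]
          · congr 1; ext x; simp [Circle.smul_def]; ring
          · exact (((Real.fourierIntegral_convergent_iff η).2 hgi)).add ((Real.fourierIntegral_convergent_iff η).2 hφi)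
          · exact (Real.fourierIntegral_convergent_iff η).2 hcvi
          · exact (Real.fourierIntegral_convergent_iff η).2 hgi
          · exact (Real.fourierIntegral_convergent_iff η).2 hφi
        rw [e, hF, pow_succ, ← h3]; ring
  obtain ⟨φ, h1, h2, h3⟩ := main N
  refine ⟨φ, h1, h2, (2 * π * ∫ x, ‖g x‖ * ‖x‖) ^ N, ?_, fun η => ?_⟩
  · have : 0 ≤ ∫ x, ‖g x‖ * ‖x‖ := integral_nonneg fun x => by positivity
    positivity
  · rw [h3, norm_pow, ← mul_pow]
    exact pow_le_pow_left₀ (norm_nonneg _) (hĝ η) N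

/-- Differences of the scaled kernels. -/
def psiK (φ : V → ℂ) (x : V) : ℂ := φ x - scl φ 2 x

lemma psiK_contDiff (φ : V → ℂ) (h : ContDiff ℝ (⊤ : ℕ∞) φ) : ContDiff ℝ (⊤ : ℕ∞) (psiK φ) :=
  h.sub (scl_contDiff φ h 2)

lemma psiK_supp (φ : V → ℂ) (c : ℝ) (hc : 0 ≤ c) (h : ∀ x, c < ‖x‖ → φ x = 0) (x : V) (hx : 2 * c < ‖x‖) :
    psiK φ x = 0 := by
  unfold psiK
  rw [h x (by linarith), scl_supp φ c h 2 two_pos x (by linarith), sub_zero]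

lemma scl_psiK (φ : V → ℂ) (r : ℝ) (hr : 0 < r) (x : V) :
    scl (psiK φ) r x = scl φ r x - scl φ (2 * r) x := by
  simp only [scl, psiK]
  rw [mul_sub, mul_pow, mul_inv, mul_inv, mul_smul]
  push_cast
  ring

lemma psiK_fourier (φ : V → ℂ) (h1 : ContDiff ℝ (⊤ : ℕ∞) φ) (h2 : HasCompactSupport φ) (N : ℕ) (C : ℝ)
    (h : ∀ η : V, ‖1 - 𝓕 φ η‖ ≤ C * ‖η‖ ^ N) (hC : 0 ≤ C) :
    ∃ C3 : ℝ, 0 ≤ C3 ∧ ∀ η : V, ‖𝓕 (psiK φ) η‖ ≤ C3 * ‖η‖ ^ N ∧ ‖𝓕 (psiK φ) η‖ * ‖η‖ ≤ C3 := by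
  have hi : Integrable φ := h1.continuous.integrable_of_hasCompactSupport h2
  have hs : Integrable (scl φ 2) := by
    refine Continuous.integrable_of_hasCompactSupport (scl_contDiff φ h1 2).continuous ?_
    exact (h2.comp_smul (by norm_num : (2:ℝ)⁻¹ ≠ 0)).mul_left
  have e : ∀ η : V, 𝓕 (psiK φ) η = 𝓕 φ η - 𝓕 φ ((2:ℝ) • η) := by
    intro η
    rw [← scl_fourier φ 2 two_pos]
    simp only [Real.fourier_eq]
    rw [← integral_sub]
    · congr 1; ext x; simp [Circle.smul_def, psiK]; ring
    · exact (Real.fourierIntegral_convergent_iff η).2 hi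
    · exact (Real.fourierIntegral_convergent_iff η).2 hs
  obtain ⟨D, hD, hD'⟩ := (𝓕 (h2.toSchwartzMap h1)).decay 1 0
  have hdec : ∀ η : V, ‖η‖ * ‖𝓕 φ η‖ ≤ D := by
    intro η
    have := hD' η
    rw [pow_one, norm_iteratedFDeriv_zero] at this
    exact this
  refine ⟨C * (1 + 2 ^ N) + 2 * D, by positivity, fun η => ⟨?_, ?_⟩⟩
  · rw [e]
    have : 𝓕 φ η - 𝓕 φ ((2:ℝ) • η) = (1 - 𝓕 φ ((2:ℝ) • η)) - (1 - 𝓕 φ η) := by ring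
    rw [this]
    refine (norm_sub_le _ _).trans ?_
    have a1 := h η
    have a2 := h ((2:ℝ) • η)
    rw [norm_smul, Real.norm_two, mul_pow] at a2
    have : 0 ≤ 2 * D * ‖η‖ ^ N := by positivity
    nlinarith
  · rw [e]
    have a1 := hdec η
    have a2 := hdec ((2:ℝ) • η)
    rw [norm_smul, Real.norm_two] at a2
    have a3 := norm_sub_le (𝓕 φ η) (𝓕 φ ((2:ℝ) • η))
    have : 0 ≤ C * (1 + 2 ^ N) := by positivity
    nlinarith [norm_nonneg η, mul_le_mul_of_nonneg_right a3 (norm_nonneg η)]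
end Kern

section L2a
variable {V : Type*} [NormedAddCommGroup V] [InnerProductSpace ℝ V] [FiniteDimensional ℝ V]
  [MeasurableSpace V] [BorelSpace V]

lemma ode_sq (F F' : ℝ → ℂ) (hF : ∀ t, HasDerivAt F (F' t) t) (hF' : Continuous F') (T r t : ℝ) (hr : 0 < r)
    (h1 : T ≤ t) (h2 : t ≤ 2 * T) :
    ‖F t‖ ^ 2 ≤ ‖F T‖ ^ 2 + ∫ s in T..(2 * T), (r⁻¹ * ‖F s‖ ^ 2 + r * ‖F' s‖ ^ 2) := by
  have hFc : Continuous F := continuous_iff_continuousAt.2 fun t => (hF t).continuousAt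
  have hd : ∀ s, HasDerivAt (fun s => ‖F s‖ ^ 2) (2 * ⟪F s, F' s⟫) s := fun s => (hF s).norm_sq
  have hc : Continuous fun s => 2 * ⟪F s, F' s⟫ := by fun_prop
  have e : ∫ s in T..t, 2 * ⟪F s, F' s⟫ = ‖F t‖ ^ 2 - ‖F T‖ ^ 2 :=
    intervalIntegral.integral_eq_sub_of_hasDerivAt (fun s _ => hd s) (hc.intervalIntegrable _ _)
  have hg : Continuous (fun s => (r⁻¹ * ‖F s‖ ^ 2 + r * ‖F' s‖ ^ 2)) := by fun_prop
  have i1 : ∫ s in T..t, 2 * ⟪F s, F' s⟫ ≤ ∫ s in T..t, (r⁻¹ * ‖F s‖ ^ 2 + r * ‖F' s‖ ^ 2) := by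
    apply intervalIntegral.integral_mono_on h1 (hc.intervalIntegrable _ _) (hg.intervalIntegrable _ _)
    intro s _
    have := real_inner_le_norm (F s) (F' s)
    have k : r⁻¹ * ‖F s‖ ^ 2 + r * ‖F' s‖ ^ 2 - 2 * (‖F s‖ * ‖F' s‖) = r⁻¹ * (‖F s‖ - r * ‖F' s‖) ^ 2 := by
      field_simp; ring
    have k2 : 0 ≤ r⁻¹ * (‖F s‖ - r * ‖F' s‖) ^ 2 := by positivity
    linarith
  have i2 : ∫ s in T..t, (r⁻¹ * ‖F s‖ ^ 2 + r * ‖F' s‖ ^ 2) ≤ ∫ s in T..(2 * T), (r⁻¹ * ‖F s‖ ^ 2 + r * ‖F' s‖ ^ 2) := by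
    apply intervalIntegral.integral_mono_interval le_rfl h1 h2
    · refine Filter.Eventually.of_forall fun s => ?_
      simp only [Pi.zero_apply]; positivity
    · exact hg.intervalIntegrable _ _
  linarith

/-- the spherical-type average `h * μ_t`. -/
def Fav (h : V → ℂ) (μ : Measure V) (t : ℝ) (x : V) : ℂ := ∫ y, h (x - t • y) ∂μ
/-- minus the `t`-derivative of `Fav`. -/
def Fdv (h : V → ℂ) (μ : Measure V) (t : ℝ) (x : V) : ℂ := ∫ y, (fderiv ℝ h (x - t • y)) y ∂μ

variable (h : V → ℂ) (hs : ContDiff ℝ (⊤ : ℕ∞) h) (ρ : ℝ) (hρ : ∀ z, ρ < ‖z‖ → h z = 0)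
  (μ : Measure V) [IsFiniteMeasure μ] (R : ℝ) (hμ : ∀ᵐ y ∂μ, ‖y‖ ≤ R)

include hs hρ

lemma fd_supp (z : V) (hz : ρ < ‖z‖) : fderiv ℝ h z = 0 := by
  have : h =ᶠ[nhds z] fun _ => 0 := by
    filter_upwards [(isOpen_lt continuous_const continuous_norm).mem_nhds hz] with w hw
    exact hρ w hw
  rw [this.fderiv_eq]; simp

lemma fd_cont : Continuous (fun p : V × V => (fderiv ℝ h p.1) p.2) := by
  have : Continuous (fderiv ℝ h) := hs.continuous_fderiv (by simp)
  fun_prop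

include hμ

lemma Fav_cont : Continuous (fun p : ℝ × V => Fav h μ p.1 p.2) :=
  ftf_cont (fun z _ => h z) (hs.continuous.comp continuous_fst) ρ R (fun z _ hz => hρ z hz) μ hμ

lemma Fdv_cont : Continuous (fun p : ℝ × V => Fdv h μ p.1 p.2) :=
  ftf_cont (fun z y => fderiv ℝ h z y) (fd_cont h hs ρ hρ) ρ R
    (fun z _ hz => by rw [fd_supp h hs ρ hρ z hz]; rfl) μ hμ

lemma Fav_deriv (t : ℝ) (x : V) : HasDerivAt (fun t => Fav h μ t x) (-Fdv h μ t x) t := by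
  obtain ⟨B, hB0, hB⟩ := ftf_bound (fun z y => fderiv ℝ h z y) (fd_cont h hs ρ hρ) ρ R
    (fun z _ hz => by rw [fd_supp h hs ρ hρ z hz]; rfl)
  have hfc : Continuous (fderiv ℝ h) := hs.continuous_fderiv (by simp)
  unfold Fav Fdv
  rw [← integral_neg]
  obtain ⟨B', hB0', hB'⟩ := ftf_bound (fun z _ => h z) (hs.continuous.comp continuous_fst) ρ 0
    (fun z _ hz => hρ z hz)
  refine (hasDerivAt_integral_of_dominated_loc_of_deriv_le (s := univ) (bound := fun _ => B)
    (F := fun t y => h (x - t • y)) (F' := fun t y => -(fderiv ℝ h (x - t • y) y)) Filter.univ_mem ?_ ?_ ?_ ?_ (integrable_const _) ?_).2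
  · refine Filter.Eventually.of_forall fun t => Continuous.aestronglyMeasurable ?_
    have := hs.continuous
    fun_prop
  · refine Integrable.mono' (integrable_const B') (Continuous.aestronglyMeasurable ?_) (Filter.Eventually.of_forall fun y => ?_)
    · have := hs.continuous
      fun_prop
    · exact hB' _ 0 (by simp)
  · refine Continuous.aestronglyMeasurable ?_
    fun_prop
  · filter_upwards [hμ] with y hy s _
    rw [norm_neg]
    exact hB _ _ hy
  · refine Filter.Eventually.of_forall fun y s _ => ?_
    have h1 : HasFDerivAt h (fderiv ℝ h (x - s • y)) (x - s • y) :=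
      (hs.differentiable (by simp) _).hasFDerivAt
    have h2 : HasDerivAt (fun s : ℝ => x - s • y) (-((1:ℝ) • y)) s :=
      (((hasDerivAt_id s).smul_const y).const_sub x)
    have := h1.comp_hasDerivAt s h2
    have e0 := this
    simp only [one_smul, map_neg] at e0
    exact e0

lemma Fav_fourier (t : ℝ) (ξ : V) : 𝓕 (Fav h μ t) ξ = 𝓕 h ξ * mV μ (t • ξ) := by
  have := ftf_fourier (fun z _ => h z) (hs.continuous.comp continuous_fst) ρ R (fun z _ hz => hρ z hz) μ hμ t ξ
  unfold Fav
  rw [this, integral_mul_const, mul_comm]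
  unfold mV
  simp_rw [inner_smul_right]

lemma Fdv_fourier (t : ℝ) (ξ : V) : 𝓕 (Fdv h μ t) ξ =
    (2 * π * Complex.I) * 𝓕 h ξ * ∫ y, (⟪y, ξ⟫ : ℂ) * Complex.exp (↑(-2 * π * ⟪y, t • ξ⟫) * Complex.I) ∂μ := by
  have := ftf_fourier (fun z y => fderiv ℝ h z y) (fd_cont h hs ρ hρ) ρ R
    (fun z _ hz => by rw [fd_supp h hs ρ hρ z hz]; rfl) μ hμ t ξ
  unfold Fdv
  rw [this, ← integral_const_mul]
  congr 1
  ext y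
  have hc : HasCompactSupport h := ftf_hcs h ρ hρ
  have hi : Integrable (fderiv ℝ h) := (hs.continuous_fderiv (by simp)).integrable_of_hasCompactSupport (hc.fderiv ℝ)
  have e := Real.fourier_fderiv (hs.continuous.integrable_of_hasCompactSupport hc) (hs.differentiable (by simp)) hi
  have e2 : 𝓕 (fun z => fderiv ℝ h z y) ξ = (𝓕 (fderiv ℝ h) ξ) y := (Real.fourier_continuousLinearMap_apply hi).symm
  rw [e2, e, VectorFourier.fourierSMulRight_apply, inner_smul_right]
  simp only [neg_apply, smul_eq_mul, Complex.real_smul]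
  have e5 : (innerSL ℝ ξ) y = ⟪ξ, y⟫ := rfl
  rw [e5]
  rw [real_inner_comm]
  push_cast
  ring

lemma Fav_l2 (t : ℝ) : ∫⁻ x, ‖Fav h μ t x‖ₑ ^ 2 = ∫⁻ ξ, (‖𝓕 h ξ‖ₑ * ‖mV μ (t • ξ)‖ₑ) ^ 2 := by
  rw [← planch_cc]
  · simp_rw [Fav_fourier h hs ρ hρ μ R hμ, enorm_mul]
  · exact (Fav_cont h hs ρ hρ μ R hμ).comp (f := fun x => (t, x)) (by fun_prop)
  · exact ftf_hcs _ (ρ + |t| * R) fun x hx => ftf_supp (fun z _ => h z) ρ R (fun z _ hz => hρ z hz) μ hμ t x hx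

lemma Fdv_l2 (t : ℝ) : ∫⁻ x, ‖Fdv h μ t x‖ₑ ^ 2 = ∫⁻ ξ, (‖𝓕 h ξ‖ₑ * ‖(2 * π * Complex.I) * ∫ y, (⟪y, ξ⟫ : ℂ) * Complex.exp (↑(-2 * π * ⟪y, t • ξ⟫) * Complex.I) ∂μ‖ₑ) ^ 2 := by
  rw [← planch_cc]
  · simp_rw [Fdv_fourier h hs ρ hρ μ R hμ, ← enorm_mul]
    congr 1; ext ξ; congr 2; ring
  · exact (Fdv_cont h hs ρ hρ μ R hμ).comp (f := fun x => (t, x)) (by fun_prop)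
  · exact ftf_hcs _ (ρ + |t| * R) fun x hx => ftf_supp (fun z y => fderiv ℝ h z y) ρ R (fun z _ hz => by rw [fd_supp h hs ρ hρ z hz]; rfl) μ hμ t x hx

end L2a

section L2b
variable {V : Type*} [NormedAddCommGroup V] [InnerProductSpace ℝ V] [FiniteDimensional ℝ V]
  [MeasurableSpace V] [BorelSpace V]

/-- square function dominating the local maximal function. -/
def Bdk (h : V → ℂ) (μ : Measure V) (T r : ℝ) (x : V) : ℝ≥0∞ :=
  ‖Fav h μ T x‖ₑ ^ 2 + ∫⁻ s in Ioc T (2 * T),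
    (ENNReal.ofReal r⁻¹ * ‖Fav h μ s x‖ₑ ^ 2 + ENNReal.ofReal r * ‖Fdv h μ s x‖ₑ ^ 2)

lemma enorm_sq_ofReal (z : ℂ) : ‖z‖ₑ ^ 2 = ENNReal.ofReal (‖z‖ ^ 2) := by
  rw [ENNReal.ofReal_pow (norm_nonneg _), ofReal_norm]

variable (h : V → ℂ) (hs : ContDiff ℝ (⊤ : ℕ∞) h) (ρ : ℝ) (hρ : ∀ z, ρ < ‖z‖ → h z = 0)
  (μ : Measure V) [IsFiniteMeasure μ] (R : ℝ) (hμ : ∀ᵐ y ∂μ, ‖y‖ ≤ R)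

include hs hρ hμ

lemma Bdk_ptw (T r t : ℝ) (hr : 0 < r) (h1 : T ≤ t) (h2 : t ≤ 2 * T) (x : V) :
    ‖Fav h μ t x‖ₑ ^ 2 ≤ Bdk h μ T r x := by
  have c2 : Continuous (fun s => Fdv h μ s x) :=
    (Fdv_cont h hs ρ hρ μ R hμ).comp (f := fun s => (s, x)) (by fun_prop)
  have c1 : Continuous (fun s => Fav h μ s x) :=
    (Fav_cont h hs ρ hρ μ R hμ).comp (f := fun s => (s, x)) (by fun_prop)
  have key := ode_sq (fun t => Fav h μ t x) (fun t => -Fdv h μ t x)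
    (fun t => Fav_deriv h hs ρ hρ μ R hμ t x) c2.neg T r t hr h1 h2
  simp only [norm_neg] at key
  rw [enorm_sq_ofReal]
  refine (ENNReal.ofReal_le_ofReal key).trans ?_
  rw [ENNReal.ofReal_add (by positivity)
    (intervalIntegral.integral_nonneg (by linarith) fun s _ => by positivity)]
  unfold Bdk
  rw [enorm_sq_ofReal]
  refine add_le_add le_rfl ?_
  rw [intervalIntegral.integral_of_le (by linarith)]
  rw [ofReal_integral_eq_lintegral_ofReal]
  · refine lintegral_mono fun s => ?_
    rw [ENNReal.ofReal_add (by positivity) (by positivity), ENNReal.ofReal_mul (by positivity),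
      ENNReal.ofReal_mul (by positivity), enorm_sq_ofReal, enorm_sq_ofReal]
  · have : Continuous (fun s => r⁻¹ * ‖Fav h μ s x‖ ^ 2 + r * ‖Fdv h μ s x‖ ^ 2) := by fun_prop
    exact (this.integrableOn_Icc (a := T) (b := 2 * T)).mono_set Ioc_subset_Icc_self
  · exact Filter.Eventually.of_forall fun s => by simp only [Pi.zero_apply]; positivity

lemma Bdk_meas (T r : ℝ) : Measurable (Bdk h μ T r) := by
  have c2 := (Fdv_cont h hs ρ hρ μ R hμ)
  have c1 := (Fav_cont h hs ρ hρ μ R hμ)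
  unfold Bdk
  have c3 : Continuous (fun x => Fav h μ T x) := c1.comp (f := fun x => (T, x)) (by fun_prop)
  refine Measurable.add (c3.measurable.enorm.pow_const 2) ?_
  refine Measurable.lintegral_prod_left' (f := fun p : ℝ × V => (ENNReal.ofReal r⁻¹ * ‖Fav h μ p.1 p.2‖ₑ ^ 2 + ENNReal.ofReal r * ‖Fdv h μ p.1 p.2‖ₑ ^ 2)) ?_
  exact ((c1.measurable.enorm.pow_const 2).const_mul _).add ((c2.measurable.enorm.pow_const 2).const_mul _)

lemma Bdk_int (a C C2 : ℝ) (ha : 0 ≤ a) (hC : 0 ≤ C) (hC2 : 0 ≤ C2)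
    (hd : ∀ ξ : V, ξ ≠ 0 → ‖mV μ ξ‖ ≤ C * ‖ξ‖ ^ (-a))
    (hd2 : ∀ ξ v : V, ξ ≠ 0 →
      ‖∫ y, (⟪y, v⟫ : ℂ) * Complex.exp (↑(-2 * π * ⟪y, ξ⟫) * Complex.I) ∂μ‖ ≤
        C2 * ‖v‖ * ‖ξ‖ ^ (-a)) (h0 : 𝓕 h 0 = 0) (T r : ℝ) (hr : 0 < r) (hT : r ≤ T) :
    ∫⁻ x, Bdk h μ T r x ≤ 3 * ENNReal.ofReal (T / r) * ∫⁻ ξ, ‖𝓕 h ξ‖ₑ ^ 2 *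
      ENNReal.ofReal ((C + 2 * π * C2) ^ 2 * ((T * ‖ξ‖) ^ (-a)) ^ 2 * (1 + (r * ‖ξ‖) ^ 2)) := by
  have c2 := (Fdv_cont h hs ρ hρ μ R hμ)
  have c1 := (Fav_cont h hs ρ hρ μ R hμ)
  have hT0 : 0 < T := by linarith
  set A := ∫⁻ ξ, ‖𝓕 h ξ‖ₑ ^ 2 *
      ENNReal.ofReal ((C + 2 * π * C2) ^ 2 * ((T * ‖ξ‖) ^ (-a)) ^ 2 * (1 + (r * ‖ξ‖) ^ 2)) with hA
  have mono : ∀ s, T ≤ s → ∀ ξ : V, ξ ≠ 0 → ‖s • ξ‖ ^ (-a) ≤ (T * ‖ξ‖) ^ (-a) := by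
    intro s hs ξ hξ
    have : 0 < ‖ξ‖ := norm_pos_iff.2 hξ
    rw [norm_smul, Real.norm_of_nonneg (by linarith)]
    apply rpow_le_rpow_of_nonpos (by positivity) (by gcongr) (by linarith)
  have i1 : ∀ s, T ≤ s → ∫⁻ x, ‖Fav h μ s x‖ₑ ^ 2 ≤ A := by
    intro s hs'
    rw [Fav_l2 h hs ρ hρ μ R hμ, hA]
    refine lintegral_mono fun ξ => ?_
    by_cases hξ : ξ = 0
    · simp [hξ, h0]
    rw [mul_pow]
    gcongr
    rw [enorm_sq_ofReal]
    apply ENNReal.ofReal_le_ofReal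
    have hne : s • ξ ≠ 0 := smul_ne_zero (by linarith) hξ
    have q : ‖mV μ (s • ξ)‖ ≤ (C + 2 * π * C2) * (T * ‖ξ‖) ^ (-a) :=
      (hd _ hne).trans (by
        have := mono s hs' ξ hξ
        have : 0 ≤ 2 * π * C2 := by positivity
        gcongr; linarith)
    calc ‖mV μ (s • ξ)‖ ^ 2 ≤ ((C + 2 * π * C2) * (T * ‖ξ‖) ^ (-a)) ^ 2 := by gcongr
      _ = (C + 2 * π * C2) ^ 2 * ((T * ‖ξ‖) ^ (-a)) ^ 2 * 1 := by ring
      _ ≤ _ := by gcongr; nlinarith [sq_nonneg (r * ‖ξ‖)]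
  have i2 : ∀ s, T ≤ s → ENNReal.ofReal r ^ 2 * ∫⁻ x, ‖Fdv h μ s x‖ₑ ^ 2 ≤ A := by
    intro s hs'
    rw [Fdv_l2 h hs ρ hρ μ R hμ, hA, ← lintegral_const_mul' _ _ (by simp)]
    refine lintegral_mono fun ξ => ?_
    by_cases hξ : ξ = 0
    · simp [hξ, h0]
    rw [mul_pow, ← mul_assoc, mul_comm (ENNReal.ofReal r ^ 2), mul_assoc]
    gcongr
    rw [enorm_sq_ofReal, ← ENNReal.ofReal_pow hr.le, ← ENNReal.ofReal_mul (by positivity)]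
    apply ENNReal.ofReal_le_ofReal
    have hne : s • ξ ≠ 0 := smul_ne_zero (by linarith) hξ
    have q : ‖(2 * π * Complex.I) * ∫ y, (⟪y, ξ⟫ : ℂ) * Complex.exp (↑(-2 * π * ⟪y, s • ξ⟫) * Complex.I) ∂μ‖ ≤ (C + 2 * π * C2) * ‖ξ‖ * (T * ‖ξ‖) ^ (-a) := by
      rw [norm_mul]
      have e : ‖(2 * π * Complex.I : ℂ)‖ = 2 * π := by
        simp [abs_of_pos Real.pi_pos]
      rw [e]
      have k1 := hd2 (s • ξ) ξ hne
      have k2 := mono s hs' ξ hξ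
      calc _ ≤ 2 * π * (C2 * ‖ξ‖ * ‖s • ξ‖ ^ (-a)) := by gcongr
        _ ≤ 2 * π * (C2 * ‖ξ‖ * (T * ‖ξ‖) ^ (-a)) := by gcongr
        _ = (2 * π * C2) * ‖ξ‖ * (T * ‖ξ‖) ^ (-a) := by ring
        _ ≤ _ := by gcongr; linarith
    calc r ^ 2 * _ ≤ r ^ 2 * ((C + 2 * π * C2) * ‖ξ‖ * (T * ‖ξ‖) ^ (-a)) ^ 2 := by gcongr
      _ = (C + 2 * π * C2) ^ 2 * ((T * ‖ξ‖) ^ (-a)) ^ 2 * (r * ‖ξ‖) ^ 2 := by ring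
      _ ≤ _ := by gcongr; linarith
  have m1 : ∀ s, Measurable (fun x => ‖Fav h μ s x‖ₑ ^ 2) := by
    intro s
    have c3 : Continuous (fun x => Fav h μ s x) := c1.comp (f := fun x => (s, x)) (by fun_prop)
    fun_prop
  have m2 : ∀ s, Measurable (fun x => ‖Fdv h μ s x‖ₑ ^ 2) := by
    intro s
    have c3 : Continuous (fun x => Fdv h μ s x) := c2.comp (f := fun x => (s, x)) (by fun_prop)
    fun_prop
  unfold Bdk
  rw [lintegral_add_left (m1 T)]
  rw [lintegral_lintegral_swap]
  swap
  · refine Measurable.aemeasurable ?_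
    simp only [Function.uncurry_def]
    have c1' : Continuous (fun p : V × ℝ => Fav h μ p.2 p.1) := c1.comp (f := fun p : V × ℝ => (p.2, p.1)) (by fun_prop)
    have c2' : Continuous (fun p : V × ℝ => Fdv h μ p.2 p.1) := c2.comp (f := fun p : V × ℝ => (p.2, p.1)) (by fun_prop)
    exact ((c1'.measurable.enorm.pow_const 2).const_mul _).add ((c2'.measurable.enorm.pow_const 2).const_mul _)
  have i3 : ∀ s ∈ Ioc T (2 * T), ∫⁻ x, (ENNReal.ofReal r⁻¹ * ‖Fav h μ s x‖ₑ ^ 2 + ENNReal.ofReal r * ‖Fdv h μ s x‖ₑ ^ 2) ≤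
      2 * ENNReal.ofReal r⁻¹ * A := by
    intro s hs'
    rw [lintegral_add_left ((m1 s).const_mul _), lintegral_const_mul _ (m1 s), lintegral_const_mul _ (m2 s)]
    have k1 := i1 s hs'.1.le
    have k2 := i2 s hs'.1.le
    have k3 : ENNReal.ofReal r * ∫⁻ x, ‖Fdv h μ s x‖ₑ ^ 2 ≤ ENNReal.ofReal r⁻¹ * A := by
      calc _ = ENNReal.ofReal r⁻¹ * (ENNReal.ofReal r ^ 2 * ∫⁻ x, ‖Fdv h μ s x‖ₑ ^ 2) := by
            rw [← mul_assoc, ← ENNReal.ofReal_pow hr.le, ← ENNReal.ofReal_mul (by positivity)]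
            congr 2; field_simp
        _ ≤ _ := by gcongr
    calc _ ≤ ENNReal.ofReal r⁻¹ * A + ENNReal.ofReal r⁻¹ * A := by gcongr
      _ = _ := by ring
  calc _ ≤ A + ∫⁻ s in Ioc T (2 * T), 2 * ENNReal.ofReal r⁻¹ * A := by
        refine add_le_add (i1 T le_rfl) ?_
        exact setLIntegral_mono measurable_const i3
    _ = A + 2 * ENNReal.ofReal (T / r) * A := by
        rw [setLIntegral_const, Real.volume_Ioc]
        have : 2 * T - T = T := by ring
        rw [this, div_eq_mul_inv, ENNReal.ofReal_mul hT0.le]; ring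
    _ ≤ ENNReal.ofReal (T / r) * A + 2 * ENNReal.ofReal (T / r) * A := by
        gcongr
        have : 1 ≤ ENNReal.ofReal (T / r) := by
          rw [ENNReal.one_le_ofReal, le_div_iff₀ hr]; linarith
        calc A = 1 * A := by ring
          _ ≤ _ := by gcongr
    _ = _ := by ring
end L2b

section L2c
variable {V : Type*} [NormedAddCommGroup V] [InnerProductSpace ℝ V] [FiniteDimensional ℝ V]
  [MeasurableSpace V] [BorelSpace V]

lemma dyad_sum : ∃ S : ℝ≥0∞, S ≠ ⊤ ∧ ∀ s : ℝ, 0 < s →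
    ∑' k : ℤ, ENNReal.ofReal (min ((2:ℝ) ^ k * s) ((2:ℝ) ^ k * s)⁻¹) ≤ S := by
  have hsum : Summable (fun n : ℤ => 2 * ((1:ℝ) / 2) ^ n.natAbs) := by
    apply Summable.mul_left
    apply Summable.of_nat_of_neg
    · simpa using summable_geometric_two
    · simpa using summable_geometric_two
  refine ⟨_, hsum.tsum_ofReal_ne_top, fun s hs => ?_⟩
  obtain ⟨m, hm1, hm2⟩ := exists_mem_Ico_zpow hs (one_lt_two : (1:ℝ) < 2)
  rw [← (Equiv.addRight m).tsum_eq (fun n : ℤ => ENNReal.ofReal (2 * ((1:ℝ) / 2) ^ n.natAbs))]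
  refine ENNReal.tsum_le_tsum fun k => ENNReal.ofReal_le_ofReal ?_
  simp only [Equiv.coe_addRight]
  have h2 : (0:ℝ) < 2 := two_pos
  have l1 : (2:ℝ) ^ (k + m) ≤ 2 ^ k * s := by
    rw [zpow_add₀ h2.ne']; gcongr
  have l2 : 2 ^ k * s ≤ 2 * (2:ℝ) ^ (k + m) := by
    rw [zpow_add_one₀ h2.ne'] at hm2
    rw [zpow_add₀ h2.ne']
    have : (0:ℝ) < 2 ^ k := by positivity
    nlinarith
  rcases le_total 0 (k + m) with hn | hn
  · refine (min_le_right _ _).trans ?_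
    obtain ⟨n, hn'⟩ := Int.eq_ofNat_of_zero_le hn
    rw [hn'] at l1 ⊢
    simp only [Int.natAbs_natCast, one_div, inv_pow]
    rw [zpow_natCast] at l1
    have : (2 ^ k * s)⁻¹ ≤ ((2:ℝ) ^ n)⁻¹ := by gcongr
    have : 0 < ((2:ℝ) ^ n)⁻¹ := by positivity
    linarith
  · refine (min_le_left _ _).trans ?_
    obtain ⟨n, hn'⟩ := Int.eq_ofNat_of_zero_le (neg_nonneg.2 hn)
    have : k + m = -(n:ℤ) := by omega
    rw [this] at l2 ⊢
    simpa using l2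

/-- Convolution of `u` with the `r`-dilate of the kernel `K`. -/
def cvK (K : V → ℂ) (r : ℝ) (u : V → ℂ) (z : V) : ℂ := ∫ w, u w * scl K r (z - w)

lemma cvK_eq (K : V → ℂ) (r : ℝ) (u : V → ℂ) :
    cvK K r u = convolution u (scl K r) (ContinuousLinearMap.mul ℝ ℂ) volume := rfl

lemma cvK_contDiff (K : V → ℂ) (hK : ContDiff ℝ (⊤ : ℕ∞) K) (c : ℝ) (hc : ∀ x, c < ‖x‖ → K x = 0)
    (r : ℝ) (hr : 0 < r) (u : V → ℂ) (hu : Integrable u) : ContDiff ℝ (⊤ : ℕ∞) (cvK K r u) := by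
  rw [cvK_eq]
  exact (ftf_hcs _ _ (scl_supp K c hc r hr)).contDiff_convolution_right _ hu.locallyIntegrable (scl_contDiff K hK r)

lemma cvK_supp (K : V → ℂ) (c : ℝ) (hc : ∀ x, c < ‖x‖ → K x = 0)
    (r : ℝ) (hr : 0 < r) (u : V → ℂ) (ρ : ℝ) (hu : ∀ x, ρ < ‖x‖ → u x = 0) (z : V) (hz : ρ + c * r < ‖z‖) :
    cvK K r u z = 0 := by
  unfold cvK
  apply integral_eq_zero_of_ae
  refine Filter.Eventually.of_forall fun w => ?_
  simp only [Pi.zero_apply, mul_eq_zero]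
  by_cases hw : ρ < ‖w‖
  · left; exact hu w hw
  · right
    apply scl_supp K c hc r hr
    have : ‖z‖ ≤ ‖z - w‖ + ‖w‖ := by simpa using norm_add_le (z - w) w
    push Not at hw
    linarith

lemma cvK_fourier (K : V → ℂ) (hK : ContDiff ℝ (⊤ : ℕ∞) K) (c : ℝ) (hc : ∀ x, c < ‖x‖ → K x = 0)
    (r : ℝ) (hr : 0 < r) (u : V → ℂ) (hu : Integrable u) (ξ : V) :
    𝓕 (cvK K r u) ξ = 𝓕 u ξ * 𝓕 K (r • ξ) := by
  rw [← scl_fourier K r hr, ← Real.fourier_mul_convolution_eq hu]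
  · rfl
  · exact (scl_contDiff K hK r).continuous.integrable_of_hasCompactSupport (ftf_hcs _ _ (scl_supp K c hc r hr))

theorem L2max (μ : Measure V) [IsFiniteMeasure μ] (R : ℝ) (hμ : ∀ᵐ y ∂μ, ‖y‖ ≤ R)
    (a C : ℝ) (ha : 1 / 2 < a) (hC : 0 ≤ C) (hd : ∀ ξ : V, ξ ≠ 0 → ‖mV μ ξ‖ ≤ C * ‖ξ‖ ^ (-a))
    (N : ℕ) (hN : a + 1 / 2 ≤ N)
    (K : V → ℂ) (hK : ContDiff ℝ (⊤ : ℕ∞) K) (c : ℝ) (hc : ∀ x, c < ‖x‖ → K x = 0)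
    (C3 : ℝ) (hC3 : 0 ≤ C3) (hK3 : ∀ η : V, ‖𝓕 K η‖ ≤ C3 * ‖η‖ ^ N ∧ ‖𝓕 K η‖ * ‖η‖ ≤ C3) :
    ∃ Cc : ℝ≥0∞, Cc ≠ ⊤ ∧ ∀ u : V → ℂ, Integrable u → MemLp u 2 → ∀ ρ : ℝ, (∀ x, ρ < ‖x‖ → u x = 0) →
      ∀ j : ℕ, ∃ Bd : V → ℝ≥0∞, Measurable Bd ∧
        (∀ k : ℤ, ∀ t ∈ Icc ((2:ℝ) ^ k) (2 * (2:ℝ) ^ k), ∀ x,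
          ‖Fav (cvK K ((2:ℝ) ^ (k - (j:ℤ))) u) μ t x‖ₑ ^ 2 ≤ Bd x) ∧
        ∫⁻ x, Bd x ≤ Cc * ENNReal.ofReal ((2:ℝ) ^ j * (((2:ℝ) ^ j) ^ (-a)) ^ 2) * ∫⁻ x, ‖u x‖ₑ ^ 2 := by
  obtain ⟨C2, hC2, hd2⟩ := grad_decay μ R hμ a C (by linarith) hd
  obtain ⟨S, hS, hS'⟩ := dyad_sum
  have hN1 : 1 ≤ N := by
    have : (1:ℝ) ≤ N := by linarith
    exact_mod_cast this
  have hK0 : 𝓕 K 0 = 0 := by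
    have := (hK3 0).1
    rw [norm_zero, zero_pow (by omega), mul_zero] at this
    exact norm_le_zero_iff.1 this
  have hEw : ∀ η : V, η ≠ 0 → ‖𝓕 K η‖ ^ 2 * (‖η‖ ^ (-a)) ^ 2 * (1 + ‖η‖ ^ 2) ≤ 2 * C3 ^ 2 * min ‖η‖ ‖η‖⁻¹ := by
    intro η hη
    have hp : 0 < ‖η‖ := norm_pos_iff.2 hη
    obtain ⟨b1, b2⟩ := hK3 η
    have e0 : (‖η‖ ^ (-a)) ^ 2 = ‖η‖ ^ (-(2 * a)) := by
      rw [← rpow_natCast, ← rpow_mul hp.le]; congr 1; push_cast; ring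
    rcases le_total ‖η‖ 1 with h1 | h1
    · rw [min_eq_left (h1.trans ((one_le_inv₀ hp).2 h1))]
      have e1 : (‖η‖ ^ N) ^ 2 * ‖η‖ ^ (-(2 * a)) ≤ ‖η‖ := by
        rw [← pow_mul, ← rpow_natCast, ← rpow_add hp]
        calc _ ≤ ‖η‖ ^ (1:ℝ) := by
              apply rpow_le_rpow_of_exponent_ge hp h1
              push_cast; linarith
          _ = _ := rpow_one _
      calc _ ≤ (C3 * ‖η‖ ^ N) ^ 2 * ‖η‖ ^ (-(2 * a)) * (1 + 1) := by
            rw [e0]; gcongr; exact pow_le_one₀ hp.le h1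
        _ = 2 * C3 ^ 2 * ((‖η‖ ^ N) ^ 2 * ‖η‖ ^ (-(2 * a))) := by ring
        _ ≤ _ := by gcongr
    · rw [min_eq_right (((inv_le_one₀ hp).2 h1).trans h1)]
      have e1 : ‖η‖ ^ (-(2 * a)) ≤ ‖η‖⁻¹ := by
        rw [← rpow_neg_one]
        apply rpow_le_rpow_of_exponent_le h1; linarith
      calc _ ≤ ‖𝓕 K η‖ ^ 2 * ‖η‖ ^ (-(2 * a)) * (‖η‖ ^ 2 + ‖η‖ ^ 2) := by
            rw [e0]; gcongr; exact one_le_pow₀ h1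
        _ = 2 * (‖𝓕 K η‖ * ‖η‖) ^ 2 * ‖η‖ ^ (-(2 * a)) := by ring
        _ ≤ 2 * C3 ^ 2 * ‖η‖⁻¹ := by gcongr
  set D := (C + 2 * π * C2) ^ 2 with hD
  refine ⟨3 * ENNReal.ofReal (D * (2 * C3 ^ 2)) * S, ?_, fun u hu hu2 ρ hρ j => ?_⟩
  · exact ENNReal.mul_ne_top (ENNReal.mul_ne_top (by norm_num) (by simp)) hS
  let r : ℤ → ℝ := fun k => (2:ℝ) ^ (k - (j:ℤ))
  have hr : ∀ k, 0 < r k := fun k => by positivity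
  let h : ℤ → V → ℂ := fun k => cvK K (r k) u
  have hsm : ∀ k, ContDiff ℝ (⊤ : ℕ∞) (h k) := fun k => cvK_contDiff K hK c hc _ (hr k) u hu
  have hsp : ∀ k, ∀ z, ρ + c * r k < ‖z‖ → h k z = 0 := fun k => cvK_supp K c hc _ (hr k) u ρ hρ
  have hrT : ∀ k : ℤ, (2:ℝ) ^ k = 2 ^ j * r k := by
    intro k
    simp only [r]
    rw [← zpow_natCast, ← zpow_add₀ (by norm_num)]; congr 1; ring
  have hF : ∀ k ξ, 𝓕 (h k) ξ = 𝓕 u ξ * 𝓕 K (r k • ξ) := fun k ξ => cvK_fourier K hK c hc _ (hr k) u hu ξ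
  refine ⟨fun x => ∑' k : ℤ, Bdk (h k) μ ((2:ℝ) ^ k) (r k) x, ?_, ?_, ?_⟩
  · exact Measurable.tsum fun k => Bdk_meas (h k) (hsm k) _ (hsp k) μ R hμ _ _
  · intro k t ht x
    exact (Bdk_ptw (h k) (hsm k) _ (hsp k) μ R hμ _ _ t (hr k) ht.1 ht.2 x).trans (ENNReal.le_tsum k)
  · rw [lintegral_tsum fun k => (Bdk_meas (h k) (hsm k) _ (hsp k) μ R hμ _ _).aemeasurable]
    set P := (((2:ℝ) ^ j) ^ (-a)) ^ 2 with hP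
    have hcont : Continuous (𝓕 u) := by
      exact VectorFourier.fourierIntegral_continuous Real.continuous_fourierChar
        (by exact continuous_inner) hu
    have step : ∀ k : ℤ, ∫⁻ x, Bdk (h k) μ ((2:ℝ) ^ k) (r k) x ≤
        3 * ENNReal.ofReal (2 ^ j) * ∫⁻ ξ, ‖𝓕 u ξ‖ₑ ^ 2 * ENNReal.ofReal (D * P * (2 * C3 ^ 2)) *
          ENNReal.ofReal (min ((2:ℝ) ^ k * ((2:ℝ) ^ (-(j:ℤ)) * ‖ξ‖)) ((2:ℝ) ^ k * ((2:ℝ) ^ (-(j:ℤ)) * ‖ξ‖))⁻¹) := by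
      intro k
      have q := Bdk_int (h k) (hsm k) _ (hsp k) μ R hμ a C C2 (by linarith) hC hC2 hd hd2
        (by rw [hF, smul_zero, hK0, mul_zero]) ((2:ℝ) ^ k) (r k) (hr k)
        (by rw [hrT]; exact le_mul_of_one_le_left (hr k).le (one_le_pow₀ one_le_two))
      have e : (2:ℝ) ^ k / r k = 2 ^ j := by rw [hrT, mul_div_assoc, div_self (hr k).ne', mul_one]
      rw [e] at q
      refine q.trans ?_
      refine mul_le_mul le_rfl (lintegral_mono fun ξ => ?_) (zero_le) (zero_le)
      simp only
      rw [hF, enorm_mul, mul_pow, mul_assoc (‖𝓕 u ξ‖ₑ ^ 2), mul_assoc (‖𝓕 u ξ‖ₑ ^ 2)]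
      by_cases hξ : ξ = 0
      · simp [hξ, hK0]
      refine mul_le_mul le_rfl ?_ (zero_le) (zero_le)
      rw [enorm_sq_ofReal, ← ENNReal.ofReal_mul (by positivity), ← ENNReal.ofReal_mul (by positivity)]
      apply ENNReal.ofReal_le_ofReal
      have hne : r k • ξ ≠ 0 := smul_ne_zero (hr k).ne' hξ
      have w := hEw _ hne
      have nr : ‖r k • ξ‖ = r k * ‖ξ‖ := by rw [norm_smul, Real.norm_of_nonneg (hr k).le]
      have e1 : (2:ℝ) ^ k * ((2:ℝ) ^ (-(j:ℤ)) * ‖ξ‖) = r k * ‖ξ‖ := by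
        simp only [r]
        rw [sub_eq_add_neg, zpow_add₀ (by norm_num)]; ring
      rw [nr] at w
      rw [e1]
      have e2 : ((2:ℝ) ^ k * ‖ξ‖) ^ (-a) = (2 ^ j) ^ (-a) * (r k * ‖ξ‖) ^ (-a) := by
        rw [hrT, mul_assoc, mul_rpow (by positivity) (by have := hr k; positivity)]
      rw [e2]
      calc _ = D * P * (‖𝓕 K (r k • ξ)‖ ^ 2 * ((r k * ‖ξ‖) ^ (-a)) ^ 2 * (1 + (r k * ‖ξ‖) ^ 2)) := by
            rw [hP, hD]; ring
        _ ≤ D * P * (2 * C3 ^ 2 * min (r k * ‖ξ‖) (r k * ‖ξ‖)⁻¹) := by gcongr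
        _ = _ := by ring
    calc _ ≤ ∑' k : ℤ, 3 * ENNReal.ofReal (2 ^ j) * ∫⁻ ξ, ‖𝓕 u ξ‖ₑ ^ 2 * ENNReal.ofReal (D * P * (2 * C3 ^ 2)) *
          ENNReal.ofReal (min ((2:ℝ) ^ k * ((2:ℝ) ^ (-(j:ℤ)) * ‖ξ‖)) ((2:ℝ) ^ k * ((2:ℝ) ^ (-(j:ℤ)) * ‖ξ‖))⁻¹) :=
          ENNReal.tsum_le_tsum step
      _ = 3 * ENNReal.ofReal (2 ^ j) * ∫⁻ ξ, ∑' k : ℤ, ‖𝓕 u ξ‖ₑ ^ 2 * ENNReal.ofReal (D * P * (2 * C3 ^ 2)) *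
          ENNReal.ofReal (min ((2:ℝ) ^ k * ((2:ℝ) ^ (-(j:ℤ)) * ‖ξ‖)) ((2:ℝ) ^ k * ((2:ℝ) ^ (-(j:ℤ)) * ‖ξ‖))⁻¹) := by
          rw [ENNReal.tsum_mul_left, lintegral_tsum]
          intro k
          refine Measurable.aemeasurable ?_
          have := hcont.measurable
          fun_prop
      _ ≤ 3 * ENNReal.ofReal (2 ^ j) * ∫⁻ ξ, ‖𝓕 u ξ‖ₑ ^ 2 * (ENNReal.ofReal (D * P * (2 * C3 ^ 2)) * S) := by
          refine mul_le_mul le_rfl (lintegral_mono fun ξ => ?_) (zero_le) (zero_le)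
          simp only
          rw [ENNReal.tsum_mul_left, mul_assoc]
          by_cases hξ : ξ = 0
          · simp [hξ]
          gcongr
          apply hS'
          have : 0 < ‖ξ‖ := norm_pos_iff.2 hξ
          positivity
      _ = _ := by
          rw [lintegral_mul_const _ (by have := hcont.measurable; fun_prop), planch u hu hu2]
          rw [show D * P * (2 * C3 ^ 2) = D * (2 * C3 ^ 2) * P by ring, ENNReal.ofReal_mul (p := D * (2 * C3 ^ 2)) (by positivity),
            ENNReal.ofReal_mul (p := 2 ^ j) (by positivity)]
          ring
end L2c

section cells

abbrev EE (d : ℕ) := EuclideanSpace ℝ (Fin d)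

/-- Index of the dyadic cell of scale `k` containing `x`. -/
def idx (k : ℤ) (x : EE d) : Fin d → ℤ := fun i => ⌊x i / (2:ℝ) ^ k⌋

lemma idx_meas (k : ℤ) : Measurable (idx k : EE d → Fin d → ℤ) := by
  refine measurable_pi_lambda _ fun i => ?_
  refine Int.measurable_floor.comp ?_
  fun_prop

lemma idx_nest {k l : ℤ} (h : k ≤ l) {x y : EE d} (e : idx k x = idx k y) : idx l x = idx l y := by
  obtain ⟨n, rfl⟩ := Int.le.dest h
  have key : ∀ z : EE d, ∀ i, idx (k + n) z i = idx k z i / ((2 ^ n : ℕ) : ℤ) := by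
    intro z i
    unfold idx
    rw [← Int.floor_div_natCast]
    congr 1
    rw [zpow_add₀ (by norm_num), div_div]
    simp
  funext i
  rw [key, key, e]

lemma idx_dist {k : ℤ} {x y : EE d} (e : idx k x = idx k y) : ‖x - y‖ ≤ √d * (2:ℝ) ^ k := by
  have hk : (0:ℝ) < 2 ^ k := by positivity
  have h1 : ∀ i, |x i - y i| ≤ 2 ^ k := by
    intro i
    have := Int.abs_sub_lt_one_of_floor_eq_floor (congrFun e i)
    rw [← sub_div, abs_div, abs_of_pos hk, div_lt_one hk] at this
    exact this.le
  rw [EuclideanSpace.norm_eq]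
  calc _ ≤ √ (∑ i : Fin d, ((2:ℝ) ^ k) ^ 2) := by
        apply Real.sqrt_le_sqrt
        apply Finset.sum_le_sum
        intro i _
        have := h1 i
        rw [Real.norm_eq_abs]
        gcongr
        simpa using this
    _ = _ := by
        rw [Finset.sum_const, Finset.card_univ, Fintype.card_fin, nsmul_eq_mul, Real.sqrt_mul (by positivity), Real.sqrt_sq hk.le]

def cellx (k : ℤ) (x : EE d) : Set (EE d) := {w | idx k w = idx k x}

/-- volume of a cell -/
def vk (d : ℕ) (k : ℤ) : ℝ≥0∞ := ENNReal.ofReal ((2:ℝ) ^ k) ^ d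

lemma vk_ne_zero (k : ℤ) : vk d k ≠ 0 := by
  unfold vk; apply pow_ne_zero; simp; positivity
lemma vk_ne_top (k : ℤ) : vk d k ≠ ⊤ := by
  unfold vk; simp

lemma vk_succ (k : ℤ) : vk d (k + 1) = 2 ^ d * vk d k := by
  unfold vk
  rw [zpow_add_one₀ (by norm_num), mul_comm, ENNReal.ofReal_mul (by norm_num), mul_pow]
  simp

lemma cellx_meas (k : ℤ) (x : EE d) : MeasurableSet (cellx k x) :=
  idx_meas k (measurableSet_singleton _)

lemma cellx_vol (k : ℤ) (x : EE d) : volume (cellx k x) = vk d k := by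
  have hk : (0:ℝ) < 2 ^ k := by positivity
  have : cellx k x = (@WithLp.ofLp 2 (Fin d → ℝ)) ⁻¹'
      (Set.pi univ fun i => Ico ((idx k x i : ℝ) * 2 ^ k) ((idx k x i + 1 : ℝ) * 2 ^ k)) := by
    ext w
    simp only [cellx, mem_ofPred_eq, mem_preimage, Set.mem_pi, mem_univ, true_imp_iff, mem_Ico]
    rw [funext_iff]
    refine forall_congr' fun i => ?_
    rw [← le_div_iff₀ hk, ← div_lt_iff₀ hk]
    exact Int.floor_eq_iff
  rw [this, (PiLp.volume_preserving_ofLp (Fin d)).measure_preimage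
      (MeasurableSet.univ_pi fun i => measurableSet_Ico).nullMeasurableSet,
    Real.volume_pi_Ico]
  have : ∀ i : Fin d, (idx k x i + 1 : ℝ) * 2 ^ k - (idx k x i : ℝ) * 2 ^ k = 2 ^ k := fun i => by ring
  simp only [this, Finset.prod_const, Finset.card_univ, Fintype.card_fin, vk]

def cellrel (d : ℕ) (k : ℤ) : Set (EE d × EE d) := {p | idx k p.1 = idx k p.2}

lemma cellrel_meas (k : ℤ) : MeasurableSet (cellrel d k) :=
  measurableSet_eq_fun ((idx_meas k).comp measurable_fst) ((idx_meas k).comp measurable_snd)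

/-- cell average -/
def avx (k : ℤ) (F : EE d → ℝ≥0∞) (x : EE d) : ℝ≥0∞ := (vk d k)⁻¹ * ∫⁻ w in cellx k x, F w

lemma avx_eq (k : ℤ) (F : EE d → ℝ≥0∞) (x : EE d) :
    avx k F x = ∫⁻ w, (vk d k)⁻¹ * (cellrel d k).indicator (fun p => F p.2) (x, w) := by
  unfold avx
  rw [← lintegral_indicator (cellx_meas k x), ← lintegral_const_mul' _ _ (by simp [vk_ne_zero])]
  congr 1; funext w
  congr 1
  by_cases h : idx k w = idx k x
  · rw [indicator_of_mem (by exact h), indicator_of_mem (by exact h.symm)]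
  · rw [indicator_of_notMem (by exact h), indicator_of_notMem (by exact fun e => h e.symm)]

lemma avx_meas (k : ℤ) (F : EE d → ℝ≥0∞) (hF : Measurable F) : Measurable (avx k F) := by
  have : avx k F = fun x => ∫⁻ w, (vk d k)⁻¹ * (cellrel d k).indicator (fun p => F p.2) (x, w) :=
    funext fun x => avx_eq k F x
  rw [this]
  apply Measurable.lintegral_prod_right' (f := fun p : EE d × EE d => (vk d k)⁻¹ * (cellrel d k).indicator (fun p => F p.2) p)
  exact ((hF.comp measurable_snd).indicator (cellrel_meas k)).const_mul _

lemma avx_cell {k : ℤ} (F : EE d → ℝ≥0∞) {l : ℤ} (h : k ≤ l) {x y : EE d} (e : idx k x = idx k y) :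
    avx l F x = avx l F y := by
  unfold avx cellx; rw [idx_nest h e]

lemma avx_const (k : ℤ) (F : EE d → ℝ≥0∞) (x : EE d) (A : ℝ≥0∞) (h : ∀ w, idx k w = idx k x → F w = A) :
    avx k F x = A := by
  unfold avx
  rw [setLIntegral_congr_fun (cellx_meas k x) (g := fun _ => A) (fun w hw => h w hw), setLIntegral_const, cellx_vol,
    mul_comm A, ← mul_assoc, ENNReal.inv_mul_cancel (vk_ne_zero k) (vk_ne_top k), one_mul]

lemma avx_le (k : ℤ) (F : EE d → ℝ≥0∞) (x : EE d) (A : ℝ≥0∞) (h : ∀ w, idx k w = idx k x → F w ≤ A) :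
    avx k F x ≤ A := by
  rw [← avx_const k (fun _ => A) x A fun _ _ => rfl]
  unfold avx
  gcongr 1
  exact setLIntegral_mono' (cellx_meas k x) h

lemma le_avx (k : ℤ) (F : EE d → ℝ≥0∞) (x : EE d) (A : ℝ≥0∞) (h : ∀ w, idx k w = idx k x → A ≤ F w) :
    A ≤ avx k F x := by
  rw [← avx_const k (fun _ => A) x A fun _ _ => rfl]
  unfold avx
  gcongr 1
  exact setLIntegral_mono' (cellx_meas k x) h

lemma avx_adj (k : ℤ) (F H : EE d → ℝ≥0∞) (hF : Measurable F) (hH : Measurable H) :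
    ∫⁻ x, avx k F x * H x = ∫⁻ x, F x * avx k H x := by
  have e1 : ∀ F H : EE d → ℝ≥0∞, Measurable F → Measurable H → ∀ x, avx k F x * H x = ∫⁻ w, (vk d k)⁻¹ * (cellrel d k).indicator (fun p => F p.2 * H p.1) (x, w) := by
    intro F H hF hH x
    rw [avx_eq, ← lintegral_mul_const]
    · congr 1; funext w
      rw [mul_assoc]; congr 1
      by_cases h : (x, w) ∈ cellrel d k
      · rw [indicator_of_mem h, indicator_of_mem h]
      · rw [indicator_of_notMem h, indicator_of_notMem h, zero_mul]
    · refine Measurable.const_mul ?_ _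
      exact ((hF.comp measurable_snd).indicator (cellrel_meas k)).comp measurable_prodMk_left
  simp_rw [e1 F H hF hH]
  have : ∀ x, F x * avx k H x = avx k H x * F x := fun x => mul_comm _ _
  simp_rw [this, e1 H F hH hF]
  rw [lintegral_lintegral_swap]
  · congr 1; funext x; congr 1; funext w
    congr 1
    by_cases h : idx k x = idx k w
    · rw [indicator_of_mem (by exact h.symm), indicator_of_mem (by exact h)]
      simp [mul_comm]
    · rw [indicator_of_notMem (by exact fun e => h e.symm), indicator_of_notMem (by exact h)]
  · refine Measurable.aemeasurable ?_
    have := (((hF.comp measurable_snd).mul (hH.comp measurable_fst)).indicator (cellrel_meas (d := d) k)).const_mul (vk d k)⁻¹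
    exact this

lemma avx_inv (k : ℤ) (F : EE d → ℝ≥0∞) (hF : Measurable F) (A : Set (EE d)) (hA : MeasurableSet A)
    (hi : ∀ x y, idx k x = idx k y → x ∈ A → y ∈ A) : ∫⁻ x in A, avx k F x = ∫⁻ x in A, F x := by
  have h := avx_adj k F (A.indicator 1) hF (measurable_one.indicator hA)
  have e : ∀ x, avx k (A.indicator 1) x = A.indicator 1 x := by
    intro x
    apply avx_const
    intro w hw
    by_cases hx : x ∈ A
    · rw [indicator_of_mem hx, indicator_of_mem (hi _ _ hw.symm hx)]; rfl
    · rw [indicator_of_notMem hx, indicator_of_notMem fun h => hx (hi _ _ hw h)]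
  simp_rw [e] at h
  have e2 : ∀ u : EE d → ℝ≥0∞, ∀ x, u x * A.indicator 1 x = A.indicator u x := by
    intro u x
    by_cases hx : x ∈ A <;> simp [hx]
  simp_rw [e2] at h
  rwa [lintegral_indicator hA, lintegral_indicator hA] at h

lemma avx_parent (k : ℤ) (F : EE d → ℝ≥0∞) (x : EE d) : avx k F x ≤ 2 ^ d * avx (k + 1) F x := by
  unfold avx
  rw [vk_succ, ENNReal.mul_inv (by simp) (by simp), ← mul_assoc, ← mul_assoc, ENNReal.mul_inv_cancel (by simp) (by simp), one_mul]
  gcongr 1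
  exact lintegral_mono_set fun w hw => idx_nest (by omega) hw

lemma avx_total (k : ℤ) (F : EE d → ℝ≥0∞) (x : EE d) : avx k F x ≤ (vk d k)⁻¹ * ∫⁻ w, F w := by
  unfold avx
  gcongr 1
  exact setLIntegral_le_lintegral _ _

lemma ball_vol (x : EE d) (hd : 1 ≤ d) (k : ℤ) (K : ℝ) (hK : 0 ≤ K) :
    volume (closedBall x (K * (2:ℝ) ^ k)) = ENNReal.ofReal (K ^ d) * volume (ball (0 : EE d) 1) * vk d k := by
  rw [Measure.addHaar_closedBall _ _ (by positivity), mul_pow, ENNReal.ofReal_mul (by positivity), finrank_euclideanSpace,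
    Fintype.card_fin, ENNReal.ofReal_pow (p := (2:ℝ) ^ k) (by positivity)]
  unfold vk; ring
end cells

section stopping
variable (F : EE d → ℝ≥0∞) (α : ℝ≥0∞)

/-- Points whose maximal dyadic cell with average above `α` has scale `k`. -/
def stp (k : ℤ) : Set (EE d) := {x | α < avx k F x ∧ ∀ l, k < l → avx l F x ≤ α}

lemma stp_meas (hF : Measurable F) (k : ℤ) : MeasurableSet (stp F α k) := by
  have : stp F α k = {x | α < avx k F x} ∩ ⋂ l, ⋂ (_ : k < l), {x | avx l F x ≤ α} := by
    ext x; simp [stp]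
  rw [this]
  refine (measurableSet_lt measurable_const (avx_meas k F hF)).inter ?_
  exact MeasurableSet.iInter fun l => MeasurableSet.iInter fun _ => measurableSet_le (avx_meas l F hF) measurable_const

lemma stp_inv {k m : ℤ} (h : m ≤ k) {x y : EE d} (e : idx m x = idx m y) (hx : x ∈ stp F α k) : y ∈ stp F α k := by
  refine ⟨?_, fun l hl => ?_⟩
  · rw [← avx_cell F h e]; exact hx.1
  · rw [← avx_cell F (h.trans hl.le) e]; exact hx.2 l hl

lemma stp_unique {k l : ℤ} {x : EE d} (h1 : x ∈ stp F α k) (h2 : x ∈ stp F α l) : k = l := by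
  rcases lt_trichotomy k l with h | h | h
  · exact absurd (h1.2 l h) (not_le.2 h2.1)
  · exact h
  · exact absurd (h2.2 k h) (not_le.2 h1.1)

lemma stp_disj : Pairwise (Function.onFun Disjoint (stp F α)) := by
  intro k l hkl
  rw [Function.onFun, Set.disjoint_left]
  intro x h1 h2
  exact hkl (stp_unique F α h1 h2)

lemma stp_bdd (hd : 1 ≤ d) (hI : ∫⁻ x, F x ≠ ⊤) (hα : α ≠ 0) : ∃ L : ℤ, ∀ l, ∀ x, α < avx l F x → l ≤ L := by
  by_cases hα' : α = ⊤
  · exact ⟨0, fun l x h => by simp [hα'] at h⟩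
  obtain ⟨n, hn⟩ := ENNReal.exists_nat_gt (ENNReal.div_ne_top hI hα)
  refine ⟨n, fun l x h => ?_⟩
  by_contra hl
  push Not at hl
  have h2 : (∫⁻ x, F x) / α ≤ vk d l := by
    refine hn.le.trans ?_
    have : (n:ℝ≥0∞) ≤ ENNReal.ofReal ((2:ℝ) ^ l) := by
      rw [← ENNReal.ofReal_natCast]
      apply ENNReal.ofReal_le_ofReal
      have a1 : (n:ℝ) ≤ 2 ^ n := by exact_mod_cast Nat.lt_two_pow_self.le
      have a2 : (2:ℝ) ^ (n:ℤ) ≤ 2 ^ l := zpow_le_zpow_right₀ (by norm_num) hl.le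
      rw [zpow_natCast] at a2
      linarith
    refine this.trans ?_
    unfold vk
    refine le_self_pow₀ ?_ (by omega)
    rw [ENNReal.one_le_ofReal]
    exact one_le_zpow₀ (by norm_num) (by omega)
  refine absurd h (not_lt.2 ((avx_total l F x).trans ?_))
  rw [ENNReal.div_le_iff hα hα'] at h2
  calc _ ≤ (vk d l)⁻¹ * (vk d l * α) := by gcongr
    _ = α := by rw [← mul_assoc, ENNReal.inv_mul_cancel (vk_ne_zero l) (vk_ne_top l), one_mul]

lemma stp_exists (hd : 1 ≤ d) (hI : ∫⁻ x, F x ≠ ⊤) (hα : α ≠ 0) {m : ℤ} {x : EE d} (h : α < avx m F x) :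
    ∃ k, m ≤ k ∧ x ∈ stp F α k := by
  obtain ⟨L, hL⟩ := stp_bdd F α hd hI hα
  obtain ⟨k, hk1, hk2⟩ := Int.exists_greatest_of_bdd (P := fun l => α < avx l F x) ⟨L, fun l => hL l x⟩ ⟨m, h⟩
  refine ⟨k, hk2 m h, hk1, fun l hl => ?_⟩
  by_contra h'
  exact absurd (hk2 l (not_le.1 h')) (by omega)

lemma stp_sum (hF : Measurable F) : ∑' k, ∫⁻ x in stp F α k, F x ≤ ∫⁻ x, F x := by
  rw [← lintegral_iUnion (stp_meas F α hF) (stp_disj F α)]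
  exact setLIntegral_le_lintegral _ _

lemma stp_avx (hF : Measurable F) (k : ℤ) : ∫⁻ x in stp F α k, avx k F x = ∫⁻ x in stp F α k, F x :=
  avx_inv k F hF _ (stp_meas F α hF k) fun x y e hx => stp_inv F α le_rfl e hx

lemma stp_vol (hF : Measurable F) : α * ∑' k, volume (stp F α k) ≤ ∫⁻ x, F x := by
  refine le_trans ?_ (stp_sum F α hF)
  rw [← ENNReal.tsum_mul_left]
  refine ENNReal.tsum_le_tsum fun k => ?_
  rw [← stp_avx F α hF, ← setLIntegral_const]
  exact setLIntegral_mono' (stp_meas F α hF k) fun x hx => hx.1.le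

open Classical in
/-- The Calderon–Zygmund good part. -/
def gst (x : EE d) : ℝ≥0∞ := if h : ∃ k, x ∈ stp F α k then avx h.choose F x else F x

lemma gst_on {k : ℤ} {x : EE d} (h : x ∈ stp F α k) : gst F α x = avx k F x := by
  have hh : ∃ k, x ∈ stp F α k := ⟨k, h⟩
  unfold gst
  rw [dif_pos hh, stp_unique F α hh.choose_spec h]

lemma gst_off {x : EE d} (h : x ∉ ⋃ k, stp F α k) : gst F α x = F x := by
  unfold gst
  rw [dif_neg (by simpa using h)]

lemma gst_meas (hF : Measurable F) : Measurable (gst F α) := by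
  have hU : MeasurableSet (⋃ k, stp F α k) := MeasurableSet.iUnion (stp_meas F α hF)
  have : gst F α = fun x => (⋃ k, stp F α k)ᶜ.indicator F x + ∑' k, (stp F α k).indicator (avx k F) x := by
    funext x
    by_cases h : x ∈ ⋃ k, stp F α k
    · rw [indicator_of_notMem (by simpa using h), zero_add]
      obtain ⟨k, hk⟩ := mem_iUnion.1 h
      rw [gst_on F α hk, tsum_eq_single k, indicator_of_mem hk]
      intro l hl
      exact indicator_of_notMem (fun h' => hl (stp_unique F α h' hk)) _
    · rw [indicator_of_mem (by simpa using h), gst_off F α h]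
      rw [ENNReal.tsum_eq_zero.2, add_zero]
      intro l
      exact indicator_of_notMem (fun h' => h (mem_iUnion.2 ⟨l, h'⟩)) _
  rw [this]
  refine (hF.indicator hU.compl).add ?_
  exact Measurable.tsum fun k => (avx_meas k F hF).indicator (stp_meas F α hF k)

lemma gst_le (hc : ∀ x, (∀ k, avx k F x ≤ α) → F x ≤ α) (hd : 1 ≤ d) (hI : ∫⁻ x, F x ≠ ⊤) (hα : α ≠ 0) (x : EE d) :
    gst F α x ≤ 2 ^ d * α := by
  by_cases h : x ∈ ⋃ k, stp F α k
  · obtain ⟨k, hk⟩ := mem_iUnion.1 h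
    rw [gst_on F α hk]
    refine (avx_parent k F x).trans ?_
    gcongr
    exact hk.2 _ (by omega)
  · rw [gst_off F α h]
    refine (hc x fun k => ?_).trans (le_mul_of_one_le_left (zero_le) (one_le_pow₀ (by norm_num)))
    by_contra h'
    obtain ⟨l, -, hl⟩ := stp_exists F α hd hI hα (not_le.1 h')
    exact h (mem_iUnion.2 ⟨l, hl⟩)

lemma gst_on_int (hF : Measurable F) (k : ℤ) : ∫⁻ x in stp F α k, gst F α x = ∫⁻ x in stp F α k, F x := by
  rw [← stp_avx F α hF]
  exact setLIntegral_congr_fun (stp_meas F α hF k) fun x hx => gst_on F α hx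

lemma gst_int (hF : Measurable F) : ∫⁻ x, gst F α x = ∫⁻ x, F x := by
  have hU : MeasurableSet (⋃ k, stp F α k) := MeasurableSet.iUnion (stp_meas F α hF)
  rw [← lintegral_add_compl _ hU, ← lintegral_add_compl F hU]
  congr 1
  · rw [lintegral_iUnion (stp_meas F α hF) (stp_disj F α), lintegral_iUnion (stp_meas F α hF) (stp_disj F α)]
    congr 1; funext k; exact gst_on_int F α hF k
  · exact setLIntegral_congr_fun hU.compl fun x hx => gst_off F α hx

lemma gst_supp (hd : 1 ≤ d) (hI : ∫⁻ x, F x ≠ ⊤) (hα : α ≠ 0) (ρ : ℝ) (hρ : ∀ x, ρ < ‖x‖ → F x = 0) :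
    ∃ ρ', ∀ x, ρ' < ‖x‖ → gst F α x = 0 := by
  obtain ⟨L, hL⟩ := stp_bdd F α hd hI hα
  refine ⟨ρ + √d * 2 ^ L, fun x hx => ?_⟩
  have hp : 0 ≤ √d * (2:ℝ) ^ L := by positivity
  by_cases h : x ∈ ⋃ k, stp F α k
  · obtain ⟨k, hk⟩ := mem_iUnion.1 h
    rw [gst_on F α hk]
    apply avx_const
    intro w hw
    apply hρ
    have h1 := idx_dist hw
    have h2 : (2:ℝ) ^ k ≤ 2 ^ L := zpow_le_zpow_right₀ (by norm_num) (hL k x hk.1)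
    have h3 : √d * (2:ℝ) ^ k ≤ √d * 2 ^ L := by gcongr
    have h4 : ‖x‖ ≤ ‖w - x‖ + ‖w‖ := by
      have := norm_sub_le w (w - x)
      rw [sub_sub_cancel] at this; linarith
    linarith
  · rw [gst_off F α h]
    exact hρ x (by linarith)

lemma gst_sq (hc : ∀ x, (∀ k, avx k F x ≤ α) → F x ≤ α) (hd : 1 ≤ d) (hI : ∫⁻ x, F x ≠ ⊤) (hα : α ≠ 0) (hF : Measurable F) :
    ∫⁻ x, gst F α x ^ 2 ≤ 2 ^ d * α * ∫⁻ x, F x := by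
  rw [← gst_int F α hF, ← lintegral_const_mul _ (gst_meas F α hF)]
  refine lintegral_mono fun x => ?_
  simp only
  rw [sq]
  gcongr
  exact gst_le F α hc hd hI hα x

lemma cont_avx (f : EE d → ℝ) (hf : Continuous f) (α : ℝ≥0∞) (x : EE d)
    (h : ∀ k, avx k (fun x => ENNReal.ofReal (f x)) x ≤ α) : ENNReal.ofReal (f x) ≤ α := by
  by_contra h'
  push Not at h'
  obtain ⟨β, hβ1, hβ2⟩ := exists_between h'
  have ho : IsOpen {w | β < ENNReal.ofReal (f w)} :=
    isOpen_lt continuous_const (ENNReal.continuous_ofReal.comp hf)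
  obtain ⟨ε, hε, hb⟩ := Metric.isOpen_iff.1 ho x hβ2
  obtain ⟨n, hn⟩ := exists_pow_lt_of_lt_one (show 0 < ε / (√d + 1) by positivity) (show (1/2:ℝ) < 1 by norm_num)
  have := le_avx (-(n:ℤ)) (fun x => ENNReal.ofReal (f x)) x β fun w hw => by
    have h1 := idx_dist hw
    have h2 : (2:ℝ) ^ (-(n:ℤ)) = (1/2) ^ n := by simp
    rw [h2] at h1
    refine (hb ?_ : β < _).le
    rw [mem_ball, dist_eq_norm]
    rw [lt_div_iff₀ (by positivity)] at hn
    have : (0:ℝ) < (1/2) ^ n := by positivity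
    nlinarith [Real.sqrt_nonneg (d:ℝ)]
  exact absurd (hβ1.trans_le this) (not_lt.2 (h _))
end stopping

section czsplit

lemma enorm_setInt_iUnion {ι : Type*} [Countable ι] (s : ι → Set (EE d)) (hs : ∀ i, MeasurableSet (s i))
    (hd : Pairwise (Function.onFun Disjoint s)) (g : EE d → ℂ) (hg : Integrable g) :
    ‖∫ x in ⋃ i, s i, g x‖ₑ ≤ ∑' i, ‖∫ x in s i, g x‖ₑ := by
  have h := hasSum_integral_iUnion hs hd hg.integrableOn
  rw [← h.tsum_eq]
  exact enorm_tsum_le_tsum_enorm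

variable (f : EE d → ℝ) (hf : Continuous f) (hf0 : ∀ x, 0 ≤ f x) (ρ : ℝ) (hρ : ∀ x, ρ < ‖x‖ → f x = 0)

def Ff (f : EE d → ℝ) (x : EE d) : ℝ≥0∞ := ENNReal.ofReal (f x)

def uG (f : EE d → ℝ) (α : ℝ≥0∞) (x : EE d) : ℂ := ((gst (Ff f) α x).toReal : ℂ)

include hf in
lemma Ff_meas : Measurable (Ff f) := (ENNReal.continuous_ofReal.comp hf).measurable

include hf hρ in
lemma f_int : Integrable f := by
  apply hf.integrable_of_hasCompactSupport
  exact HasCompactSupport.of_support_subset_isCompact (isCompact_closedBall (0 : EE d) ρ) (by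
    intro x hx
    by_contra h
    exact hx (hρ x (by simpa using h)))

include hf hf0 hρ in
lemma Ff_int : ∫⁻ x, Ff f x ≠ ⊤ := by
  have := (f_int f hf ρ hρ).lintegral_lt_top
  exact this.ne

include hf hf0 in
lemma uG_enorm (α : ℝ≥0∞) (hd : 1 ≤ d) (hI : ∫⁻ x, Ff f x ≠ ⊤) (hα : α ≠ 0) (hα' : α ≠ ⊤) (x : EE d) :
    ‖uG f α x‖ₑ = gst (Ff f) α x := by
  have h : gst (Ff f) α x ≠ ⊤ := ne_top_of_le_ne_top (ENNReal.mul_ne_top (by simp) hα')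
    (gst_le (Ff f) α (fun x h => cont_avx f hf α x h) hd hI hα x)
  unfold uG
  rw [← ofReal_norm, Complex.norm_real, Real.norm_of_nonneg ENNReal.toReal_nonneg, ENNReal.ofReal_toReal h]

include hf in
lemma uG_meas (α : ℝ≥0∞) : Measurable (uG f α) :=
  Complex.measurable_ofReal.comp (gst_meas _ α (Ff_meas f hf)).ennreal_toReal

include hf hf0 in
lemma uG_int (α : ℝ≥0∞) (hd : 1 ≤ d) (hI : ∫⁻ x, Ff f x ≠ ⊤) (hα : α ≠ 0) (hα' : α ≠ ⊤) :
    Integrable (uG f α) := by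
  refine ⟨(uG_meas f hf α).aestronglyMeasurable, ?_⟩
  unfold HasFiniteIntegral
  simp_rw [uG_enorm f hf hf0 α hd hI hα hα']
  rw [gst_int _ _ (Ff_meas f hf)]
  exact hI.lt_top

include hf hf0 in
lemma uG_sq (α : ℝ≥0∞) (hd : 1 ≤ d) (hI : ∫⁻ x, Ff f x ≠ ⊤) (hα : α ≠ 0) (hα' : α ≠ ⊤) :
    ∫⁻ x, ‖uG f α x‖ₑ ^ 2 ≤ 2 ^ d * α * ∫⁻ x, Ff f x := by
  simp_rw [uG_enorm f hf hf0 α hd hI hα hα']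
  exact gst_sq (Ff f) α (fun x h => cont_avx f hf α x h) hd hI hα (Ff_meas f hf)

include hf hf0 in
lemma uG_memLp (α : ℝ≥0∞) (hd : 1 ≤ d) (hI : ∫⁻ x, Ff f x ≠ ⊤) (hα : α ≠ 0) (hα' : α ≠ ⊤) :
    MemLp (uG f α) 2 := by
  refine ⟨(uG_meas f hf α).aestronglyMeasurable, ?_⟩
  rw [eLpNorm_lt_top_iff_lintegral_rpow_enorm_lt_top (by norm_num) (by norm_num)]
  have := (uG_sq f hf hf0 α hd hI hα hα').trans_lt (ENNReal.mul_lt_top (ENNReal.mul_lt_top (by simp) hα'.lt_top) hI.lt_top)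
  simpa using this

include hf hf0 in
lemma cz_cell (α : ℝ≥0∞) (hd : 1 ≤ d) (hI : ∫⁻ x, Ff f x ≠ ⊤) (hα : α ≠ 0) (hα' : α ≠ ⊤)
    (h : EE d → ℂ) (hh : Continuous h) (B : ℝ) (hB : ∀ x, ‖h x‖ ≤ B) (hfi : Integrable f)
    (k : ℤ) (Ω : EE d → ℝ≥0∞) (hΩ : ∀ w w', idx k w = idx k w' → ‖h w - h w'‖ₑ ≤ Ω w) :
    ‖∫ w in stp (Ff f) α k, ((f w : ℂ) - uG f α w) * h w‖ₑ ≤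
      ∫⁻ w in stp (Ff f) α k, (Ff f w + gst (Ff f) α w) * Ω w := by
  have hFm := Ff_meas f hf
  have hTm := stp_meas (Ff f) α hFm k
  have hui := uG_int f hf hf0 α hd hI hα hα'
  have hgi : Integrable (fun w => ((f w : ℂ) - uG f α w)) := hfi.ofReal.sub hui
  have hghi : Integrable (fun w => ((f w : ℂ) - uG f α w) * h w) :=
    hgi.mul_bdd (c := B) hh.aestronglyMeasurable (Filter.Eventually.of_forall hB)
  let s : (Fin d → ℤ) → Set (EE d) := fun n => stp (Ff f) α k ∩ idx k ⁻¹' {n}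
  have hsm : ∀ n, MeasurableSet (s n) := fun n => hTm.inter (idx_meas k (measurableSet_singleton _))
  have hsd : Pairwise (Function.onFun Disjoint s) := by
    intro n n' hn
    rw [Function.onFun, Set.disjoint_left]
    intro x h1 h2
    exact hn (h1.2.symm.trans h2.2)
  have hsU : stp (Ff f) α k = ⋃ n, s n := by
    ext x
    simp [s]
  rw [hsU, lintegral_iUnion hsm hsd]
  refine (enorm_setInt_iUnion s hsm hsd _ hghi).trans (ENNReal.tsum_le_tsum fun n => ?_)
  rcases (s n).eq_empty_or_nonempty with he | ⟨x0, hx0, hxn⟩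
  · simp [he]
  have hsc : s n = cellx k x0 := by
    ext w
    constructor
    · rintro ⟨-, h2⟩
      exact h2.trans hxn.symm
    · intro hw
      exact ⟨stp_inv _ _ le_rfl (Eq.symm hw) hx0, (Eq.trans hw hxn : idx k w = n)⟩
  have hz : ∫ w in s n, ((f w : ℂ) - uG f α w) = 0 := by
    have hfc : Integrable (fun w => (f w : ℂ)) := hfi.ofReal
    rw [integral_sub hfc.restrict hui.restrict]
    have h1 : ∫ w in s n, (f w : ℂ) = (((∫⁻ w in s n, Ff f w).toReal : ℝ) : ℂ) := by
      rw [integral_complex_ofReal, integral_eq_lintegral_of_nonneg_ae (Filter.Eventually.of_forall hf0) hf.aestronglyMeasurable]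
      rfl
    have h2 : ∫ w in s n, uG f α w = ((((vk d k) * avx k (Ff f) x0).toReal : ℝ) : ℂ) := by
      rw [setIntegral_congr_fun (g := fun _ => (((avx k (Ff f) x0).toReal : ℝ) : ℂ)) (hsm n)]
      · rw [setIntegral_const, hsc, measureReal_def, cellx_vol, ENNReal.toReal_mul]
        simp
      · intro w hw
        unfold uG
        simp only
        rw [gst_on _ _ hw.1, avx_cell _ le_rfl ((hw.2 : idx k w = n).trans hxn.symm)]
    rw [h1, h2]
    unfold avx
    rw [← mul_assoc, ENNReal.mul_inv_cancel (vk_ne_zero k) (vk_ne_top k), one_mul, hsc, sub_self]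
  have he : ∫ w in s n, ((f w : ℂ) - uG f α w) * h w = ∫ w in s n, ((f w : ℂ) - uG f α w) * (h w - h x0) := by
    simp_rw [mul_sub]
    rw [integral_sub hghi.restrict (hgi.mul_const _).restrict, integral_mul_const, hz, zero_mul, sub_zero]
  rw [he]
  refine (enorm_integral_le_lintegral_enorm _).trans (setLIntegral_mono' (hsm n) fun w hw => ?_)
  rw [enorm_mul]
  refine mul_le_mul ?_ (hΩ _ _ ((hw.2 : idx k w = n).trans hxn.symm)) (zero_le) (zero_le)
  refine enorm_sub_le.trans ?_
  rw [uG_enorm f hf hf0 α hd hI hα hα']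
  gcongr
  rw [← ofReal_norm, Complex.norm_real, Real.norm_of_nonneg (hf0 w)]
  rfl

/-- union of stopping sets with scale at least `m` -/
def Lst (F : EE d → ℝ≥0∞) (α : ℝ≥0∞) (m : ℤ) : Set (EE d) := {x | ∃ k, m ≤ k ∧ x ∈ stp F α k}

lemma Lst_eq (F : EE d → ℝ≥0∞) (α : ℝ≥0∞) (m : ℤ) : Lst F α m = ⋃ k, ⋃ (_ : m ≤ k), stp F α k := by
  ext x; simp [Lst]

lemma Lst_meas (F : EE d → ℝ≥0∞) (hF : Measurable F) (α : ℝ≥0∞) (m : ℤ) : MeasurableSet (Lst F α m) := by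
  rw [Lst_eq]
  exact MeasurableSet.iUnion fun k => MeasurableSet.iUnion fun _ => stp_meas F α hF k

include hf hf0 in
lemma cz_split (α : ℝ≥0∞) (hd : 1 ≤ d) (hI : ∫⁻ x, Ff f x ≠ ⊤) (hα : α ≠ 0) (hα' : α ≠ ⊤)
    (h : EE d → ℂ) (hh : Continuous h) (B : ℝ) (hB : ∀ x, ‖h x‖ ≤ B) (hfi : Integrable f)
    (m : ℤ) (Ω : ℤ → EE d → ℝ≥0∞) (hΩ : ∀ k < m, ∀ w w', idx k w = idx k w' → ‖h w - h w'‖ₑ ≤ Ω k w) :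
    ‖∫ w, ((f w : ℂ) - uG f α w) * h w‖ₑ ≤
      (∫⁻ w in Lst (Ff f) α m, (Ff f w + gst (Ff f) α w) * ‖h w‖ₑ) +
      ∑' k : ℤ, if k < m then ∫⁻ w in stp (Ff f) α k, (Ff f w + gst (Ff f) α w) * Ω k w else 0 := by
  have hFm := Ff_meas f hf
  have hTm := stp_meas (Ff f) α hFm
  have hui := uG_int f hf hf0 α hd hI hα hα'
  have hgi : Integrable (fun w => ((f w : ℂ) - uG f α w)) := hfi.ofReal.sub hui
  have hghi : Integrable (fun w => ((f w : ℂ) - uG f α w) * h w) :=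
    hgi.mul_bdd (c := B) hh.aestronglyMeasurable (Filter.Eventually.of_forall hB)
  have hU : MeasurableSet (⋃ k, stp (Ff f) α k) := MeasurableSet.iUnion hTm
  have e1 : ∫ w, ((f w : ℂ) - uG f α w) * h w = ∫ w in ⋃ k, stp (Ff f) α k, ((f w : ℂ) - uG f α w) * h w := by
    symm
    apply setIntegral_eq_integral_of_forall_compl_eq_zero
    intro w hw
    unfold uG
    rw [gst_off _ _ hw]
    unfold Ff
    rw [ENNReal.toReal_ofReal (hf0 w), sub_self, zero_mul]
  rw [e1]
  refine (enorm_setInt_iUnion _ hTm (stp_disj _ _) _ hghi).trans ?_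
  have e2 : ∫⁻ w in Lst (Ff f) α m, (Ff f w + gst (Ff f) α w) * ‖h w‖ₑ =
      ∑' k : ℤ, if m ≤ k then ∫⁻ w in stp (Ff f) α k, (Ff f w + gst (Ff f) α w) * ‖h w‖ₑ else 0 := by
    rw [Lst_eq, lintegral_iUnion (fun k => MeasurableSet.iUnion fun _ => hTm k)]
    · congr 1; funext k
      by_cases hk : m ≤ k <;> simp [hk]
    · intro k l hkl
      rw [Function.onFun, Set.disjoint_left]
      intro x h1 h2
      simp only [mem_iUnion] at h1 h2
      exact hkl (stp_unique _ _ h1.2 h2.2)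
  rw [e2, ← ENNReal.tsum_add]
  refine ENNReal.tsum_le_tsum fun k => ?_
  by_cases hk : m ≤ k
  · rw [if_pos hk, if_neg (not_lt.2 hk), add_zero]
    refine (enorm_integral_le_lintegral_enorm _).trans (lintegral_mono fun w => ?_)
    rw [enorm_mul]
    gcongr
    refine enorm_sub_le.trans ?_
    rw [uG_enorm f hf hf0 α hd hI hα hα']
    gcongr
    rw [← ofReal_norm, Complex.norm_real, Real.norm_of_nonneg (hf0 w)]
    rfl
  · rw [if_neg hk, if_pos (not_le.1 hk), zero_add]
    exact cz_cell f hf hf0 α hd hI hα hα' h hh B hB hfi k (Ω k) (hΩ k (not_le.1 hk))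

/-- ball integrals are controlled by cell averages -/
lemma ball_av (hd : 1 ≤ d) (F : EE d → ℝ≥0∞) (hF : Measurable F) (A : Set (EE d)) (hA : MeasurableSet A) (m : ℤ)
    (hi : ∀ x y, idx m x = idx m y → x ∈ A → y ∈ A) (c : ℝ) (hc : 0 ≤ c) (z : EE d) (B : ℝ≥0∞)
    (hB : ∀ w ∈ A, w ∈ closedBall z ((c + √d) * (2:ℝ) ^ m) → avx m F w ≤ B) :
    ∫⁻ w in A ∩ closedBall z (c * (2:ℝ) ^ m), F w ≤
      B * (ENNReal.ofReal ((c + √d) ^ d) * volume (ball (0 : EE d) 1) * vk d m) := by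
  let A' : Set (EE d) := A ∩ idx m ⁻¹' (idx m '' closedBall z (c * (2:ℝ) ^ m))
  have hA' : MeasurableSet A' := hA.inter (idx_meas m (Set.to_countable _).measurableSet)
  have hsub : A' ⊆ A ∩ closedBall z ((c + √d) * (2:ℝ) ^ m) := by
    rintro w ⟨h1, w', h2, h3⟩
    refine ⟨h1, ?_⟩
    have := idx_dist h3
    rw [mem_closedBall, dist_eq_norm] at *
    have h4 : ‖w - z‖ ≤ ‖w' - z‖ + ‖w' - w‖ := by
      have := norm_sub_le (w' - z) (w' - w)
      rwa [sub_sub_sub_cancel_left] at this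
    linarith
  calc _ ≤ ∫⁻ w in A', F w := lintegral_mono_set fun w hw => ⟨hw.1, w, hw.2, rfl⟩
    _ = ∫⁻ w in A', avx m F w := by
        refine (avx_inv m F hF A' hA' ?_).symm
        rintro x y e ⟨h1, h2⟩
        refine ⟨hi x y e h1, ?_⟩
        rw [mem_preimage, ← e]; exact h2
    _ ≤ ∫⁻ w in A', B := setLIntegral_mono' hA' fun w hw => hB w hw.1 (hsub hw).2
    _ = B * volume A' := setLIntegral_const _ _
    _ ≤ B * volume (closedBall z ((c + √d) * (2:ℝ) ^ m)) := by
        gcongr; exact hsub.trans inter_subset_right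
    _ = _ := by rw [ball_vol z hd m _ (by positivity)]
end czsplit

section ptw

def Ust (F : EE d → ℝ≥0∞) (α : ℝ≥0∞) (k : ℤ) (K : ℝ) (z : EE d) : ℝ≥0∞ :=
  (vk d k)⁻¹ * volume (stp F α k ∩ closedBall z (K * (2:ℝ) ^ k))

lemma Ust_ge (F : EE d → ℝ≥0∞) (α : ℝ≥0∞) (k : ℤ) (c : ℝ) (z w : EE d) (hw : w ∈ stp F α k)
    (hz : w ∈ closedBall z (c * (2:ℝ) ^ k)) : 1 ≤ Ust F α k (c + √d) z := by
  unfold Ust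
  rw [← ENNReal.inv_mul_cancel (vk_ne_zero (d := d) k) (vk_ne_top k)]
  gcongr
  rw [← cellx_vol k w]
  apply measure_mono
  intro y hy
  refine ⟨stp_inv F α le_rfl (Eq.symm hy) hw, ?_⟩
  have := idx_dist (x := y) (y := w) hy
  rw [mem_closedBall, dist_eq_norm] at *
  have h4 : ‖y - z‖ ≤ ‖y - w‖ + ‖w - z‖ := norm_sub_le_norm_sub_add_norm_sub _ _ _
  linarith

def LB (F : EE d → ℝ≥0∞) (al : ℕ → ℝ≥0∞) (J : ℕ) (K : ℝ) (j : ℕ) (m : ℤ) (z : EE d) : ℝ≥0∞ :=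
  ∑ i ∈ Finset.Ico j J, al i * ∑' k : ℤ, if m ≤ k then Ust F (al i) k K z else 0

lemma LB_ge (F : EE d → ℝ≥0∞) (al : ℕ → ℝ≥0∞) (J : ℕ) (c : ℝ) (hc : 0 ≤ c) (i j : ℕ) (m : ℤ) (z w : EE d)
    (hi : i ∈ Finset.Ico j J) (hw : w ∈ Lst F (al i) m) (hz : w ∈ closedBall z (c * (2:ℝ) ^ m)) :
    al i ≤ LB F al J (c + √d) j m z := by
  obtain ⟨k, hk, hwk⟩ := hw
  have h1 : 1 ≤ Ust F (al i) k (c + √d) z := by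
    apply Ust_ge F (al i) k c z w hwk
    refine closedBall_subset_closedBall ?_ hz
    gcongr; norm_num
  have h2 : 1 ≤ ∑' k : ℤ, if m ≤ k then Ust F (al i) k (c + √d) z else 0 := by
    refine h1.trans ?_
    have := ENNReal.le_tsum (f := fun k : ℤ => if m ≤ k then Ust F (al i) k (c + √d) z else 0) k
    simpa only [if_pos hk] using this
  unfold LB
  calc al i ≤ al i * ∑' k : ℤ, if m ≤ k then Ust F (al i) k (c + √d) z else 0 := le_mul_of_one_le_right (zero_le) h2
    _ ≤ _ := Finset.single_le_sum (f := fun i => al i * ∑' k : ℤ, if m ≤ k then Ust F (al i) k (c + √d) z else 0)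
        (fun _ _ => zero_le) hi

lemma avx_level (hd : 1 ≤ d) (F : EE d → ℝ≥0∞) (hI : ∫⁻ x, F x ≠ ⊤) (hF1 : ∀ x, F x ≤ 1)
    (al : ℕ → ℝ≥0∞) (J : ℕ) (X : ℝ≥0∞) (hX : 1 ≤ X) (h0 : ∀ i, al i ≠ 0) (hX' : ∀ i, al (i + 1) ≤ X * al i)
    (hJ : ∀ i, J ≤ i → al i = 1)
    (c : ℝ) (hc : 0 ≤ c) (j : ℕ) (m : ℤ) (z w : EE d)
    (hw : w ∈ Lst F (al j) m) (hz : w ∈ closedBall z (c * (2:ℝ) ^ m)) :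
    avx m F w ≤ X * LB F al J (c + √d) j m z ∧ al j ≤ LB F al J (c + √d) j m z := by
  have hav : ∀ k x, avx k F x ≤ 1 := fun k x => avx_le k F x 1 fun w _ => hF1 w
  have hjJ : j < J := by
    by_contra h
    obtain ⟨k, _, hk⟩ := hw
    have := hk.1
    rw [hJ j (by omega)] at this
    exact absurd this (not_lt.2 (hav _ _))
  have hb := LB_ge F al J c hc j j m z w (by simp [hjJ]) hw hz
  refine ⟨?_, hb⟩
  by_cases hP : al j < avx m F w
  · have : ∃ i, j ≤ i ∧ i < J ∧ al i < avx m F w ∧ avx m F w ≤ al (i + 1) := by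
      by_contra! hcon
      have : ∀ i, j ≤ i → i ≤ J → al i < avx m F w := by
        intro i hi
        induction i, hi using Nat.le_induction with
        | base => exact fun _ => hP
        | succ n hn ih => exact fun h => hcon n hn (by omega) (ih (by omega))
      have h1 := this J hjJ.le le_rfl
      rw [hJ J le_rfl] at h1
      exact absurd h1 (not_lt.2 (hav _ _))
    obtain ⟨i, h1, h2, h3, h4⟩ := this
    refine h4.trans ((hX' i).trans ?_)
    gcongr
    apply LB_ge F al J c hc i j m z w (by simp [h1, h2]) _ hz
    exact stp_exists F (al i) hd hI (h0 i) h3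
  · calc avx m F w ≤ al j := not_lt.1 hP
      _ ≤ X * al j := le_mul_of_one_le_left (zero_le) hX
      _ ≤ _ := by gcongr

lemma scl_enorm (ψ : EE d → ℂ) (B : ℝ) (hB : ∀ x, ‖ψ x‖ ≤ B) (m : ℤ) (x : EE d) :
    ‖scl ψ ((2:ℝ) ^ m) x‖ₑ ≤ ENNReal.ofReal B * (vk d m)⁻¹ := by
  unfold scl vk
  have h2 : (0:ℝ) < 2 ^ m := by positivity
  rw [enorm_mul, mul_comm, finrank_euclideanSpace, Fintype.card_fin]
  gcongr
  · rw [← ofReal_norm]; exact ENNReal.ofReal_le_ofReal (hB _)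
  · rw [← ofReal_norm, Complex.norm_real, Real.norm_of_nonneg (by positivity), ENNReal.ofReal_inv_of_pos (by positivity), ENNReal.ofReal_pow h2.le]

lemma scl_lip (ψ : EE d → ℂ) (L : ℝ) (hL0 : 0 ≤ L) (hL : ∀ x y, ‖ψ x - ψ y‖ ≤ L * ‖x - y‖) (m k : ℤ) (x y : EE d)
    (hxy : ‖x - y‖ ≤ √d * (2:ℝ) ^ k) :
    ‖scl ψ ((2:ℝ) ^ m) x - scl ψ ((2:ℝ) ^ m) y‖ₑ ≤ ENNReal.ofReal (L * √d) * ENNReal.ofReal ((2:ℝ) ^ (k - m)) * (vk d m)⁻¹ := by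
  unfold scl vk
  have h2 : (0:ℝ) < 2 ^ m := by positivity
  rw [← mul_sub, enorm_mul, mul_comm, finrank_euclideanSpace, Fintype.card_fin, ← ENNReal.ofReal_mul (by positivity)]
  gcongr
  · rw [← ofReal_norm]
    apply ENNReal.ofReal_le_ofReal
    refine (hL _ _).trans ?_
    rw [← smul_sub, norm_smul, norm_inv, Real.norm_of_nonneg h2.le, zpow_sub₀ (by norm_num), mul_assoc]
    refine mul_le_mul_of_nonneg_left ?_ hL0
    rw [inv_mul_eq_div, mul_div_assoc']
    gcongr
  · rw [← ofReal_norm, Complex.norm_real, Real.norm_of_nonneg (by positivity), ENNReal.ofReal_inv_of_pos (by positivity), ENNReal.ofReal_pow h2.le]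

def Smf (F G : EE d → ℝ≥0∞) (α : ℝ≥0∞) (K : ℝ) (m : ℤ) (z : EE d) : ℝ≥0∞ :=
  ∑' k : ℤ, if k < m then ENNReal.ofReal ((2:ℝ) ^ (k - m)) *
    ((vk d m)⁻¹ * ∫⁻ w in stp F α k ∩ closedBall z (K * (2:ℝ) ^ m), (F w + G w)) else 0

theorem ptw_bound (hd : 1 ≤ d) (f : EE d → ℝ) (hf : Continuous f) (hf0 : ∀ x, 0 ≤ f x) (hf1 : ∀ x, f x ≤ 1)
    (hfi : Integrable f) (hI : ∫⁻ x, Ff f x ≠ ⊤)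
    (al : ℕ → ℝ≥0∞) (J : ℕ) (X : ℝ≥0∞) (hX : 1 ≤ X) (h0 : ∀ i, al i ≠ 0) (ht : ∀ i, al i ≠ ⊤)
    (hX' : ∀ i, al (i + 1) ≤ X * al i)
    (hJ : ∀ i, J ≤ i → al i = 1)
    (ψ : EE d → ℂ) (hψ : Continuous ψ) (B L c : ℝ) (hc : 0 ≤ c) (hL0 : 0 ≤ L) (hB : ∀ x, ‖ψ x‖ ≤ B)
    (hL : ∀ x y, ‖ψ x - ψ y‖ ≤ L * ‖x - y‖) (hcs : ∀ x, c < ‖x‖ → ψ x = 0)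
    (j : ℕ) (m : ℤ) (z : EE d) :
    ‖cvK ψ ((2:ℝ) ^ m) (fun x => (f x : ℂ)) z - cvK ψ ((2:ℝ) ^ m) (uG f (al j)) z‖ₑ ≤
      (ENNReal.ofReal B * (ENNReal.ofReal ((c + √d) ^ d) * volume (ball (0 : EE d) 1)) * (X + 2 ^ d) *
        LB (Ff f) al J (c + √d + √d) j m z +
      ENNReal.ofReal (L * √d) * Smf (Ff f) (gst (Ff f) (al j)) (al j) (c + √d) m z) := by
  have h2 : (0:ℝ) < 2 ^ m := by positivity
  have hFm := Ff_meas f hf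
  have hGm := gst_meas (Ff f) (al j) hFm
  have hui := uG_int f hf hf0 (al j) hd hI (h0 j) (ht j)
  have hfc : Integrable (fun w => (f w : ℂ)) := hfi.ofReal
  let h : EE d → ℂ := fun w => scl ψ ((2:ℝ) ^ m) (z - w)
  have hsc : Continuous (scl ψ ((2:ℝ) ^ m)) := by unfold scl; fun_prop
  have hh : Continuous h := hsc.comp (by fun_prop)
  have hen : ∀ w, ‖h w‖ₑ ≤ ENNReal.ofReal B * (vk d m)⁻¹ := fun w => scl_enorm ψ B hB m _
  have hbt : ENNReal.ofReal B * (vk d m)⁻¹ ≠ ⊤ := ENNReal.mul_ne_top (by simp) (by simp [vk_ne_zero])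
  have hbd : ∀ w, ‖h w‖ ≤ (ENNReal.ofReal B * (vk d m)⁻¹).toReal := by
    intro w
    rw [← toReal_enorm]
    exact ENNReal.toReal_mono hbt (hen w)
  have hm1 : ∀ u : EE d → ℂ, Integrable u → Integrable (fun w => u w * h w) := fun u hu =>
    hu.mul_bdd hh.aestronglyMeasurable (Filter.Eventually.of_forall hbd)
  have e1 : cvK ψ ((2:ℝ) ^ m) (fun x => (f x : ℂ)) z - cvK ψ ((2:ℝ) ^ m) (uG f (al j)) z = ∫ w, ((f w : ℂ) - uG f (al j) w) * h w := by
    unfold cvK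
    simp_rw [sub_mul]
    rw [integral_sub (hm1 _ hfc) (hm1 _ hui)]
  have hsupp : ∀ w, w ∉ closedBall z (c * (2:ℝ) ^ m) → h w = 0 := by
    intro w hw
    apply scl_supp ψ c hcs _ h2
    rw [mem_closedBall, dist_comm, dist_eq_norm] at hw
    exact not_le.1 hw
  rw [e1]
  let Ω : ℤ → EE d → ℝ≥0∞ := fun k => (closedBall z ((c + √d) * (2:ℝ) ^ m)).indicator
    fun _ => ENNReal.ofReal (L * √d) * ENNReal.ofReal ((2:ℝ) ^ (k - m)) * (vk d m)⁻¹
  have hΩ : ∀ k < m, ∀ w w', idx k w = idx k w' → ‖h w - h w'‖ₑ ≤ Ω k w := by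
    intro k hk w w' e
    have hdist := idx_dist e
    by_cases hw : w ∈ closedBall z ((c + √d) * (2:ℝ) ^ m)
    · simp only [Ω]
      rw [indicator_of_mem hw]
      apply scl_lip ψ L hL0 hL
      rw [sub_sub_sub_cancel_left, norm_sub_rev]
      exact hdist
    · have hw1 : w ∉ closedBall z (c * (2:ℝ) ^ m) := fun hw' => hw (closedBall_subset_closedBall (by gcongr; simp) hw')
      have hw2 : w' ∉ closedBall z (c * (2:ℝ) ^ m) := by
        intro hw'
        apply hw
        rw [mem_closedBall, dist_eq_norm] at *
        have h4 : ‖w - z‖ ≤ ‖w - w'‖ + ‖w' - z‖ := norm_sub_le_norm_sub_add_norm_sub _ _ _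
        have h5 : √d * (2:ℝ) ^ k ≤ √d * 2 ^ m := by gcongr; norm_num
        linarith
      rw [hsupp w hw1, hsupp w' hw2, sub_zero, enorm_zero]
      exact zero_le
  refine (cz_split f hf hf0 (al j) hd hI (h0 j) (ht j) h hh _ hbd hfi m Ω hΩ).trans ?_
  gcongr
  · have hLm := Lst_meas (Ff f) hFm (al j) m
    set KK := ENNReal.ofReal ((c + √d) ^ d) * volume (ball (0 : EE d) 1) with hKK
    set Q := LB (Ff f) al J (c + √d + √d) j m z with hQ
    have hlev : ∀ w ∈ Lst (Ff f) (al j) m, w ∈ closedBall z ((c + √d) * (2:ℝ) ^ m) →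
        avx m (Ff f) w ≤ X * Q ∧ al j ≤ Q := fun w hw hz =>
      avx_level hd (Ff f) hI (fun x => by unfold Ff; simpa using hf1 x) al J X hX h0 hX' hJ (c + √d) (by positivity) j m z w hw hz
    have hiv : ∀ x y, idx m x = idx m y → x ∈ Lst (Ff f) (al j) m → y ∈ Lst (Ff f) (al j) m := by
      rintro x y e ⟨k, hk, hx⟩
      exact ⟨k, hk, stp_inv _ _ hk e hx⟩
    have hs : Lst (Ff f) (al j) m ∩ closedBall z (c * (2:ℝ) ^ m) ⊆ Lst (Ff f) (al j) m ∩ closedBall z ((c + √d) * (2:ℝ) ^ m) := by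
      apply inter_subset_inter_right
      apply closedBall_subset_closedBall; gcongr; simp
    have hcm : MeasurableSet (Lst (Ff f) (al j) m ∩ closedBall z (c * (2:ℝ) ^ m)) := hLm.inter isClosed_closedBall.measurableSet
    calc _ ≤ ∫⁻ w in Lst (Ff f) (al j) m, (closedBall z (c * (2:ℝ) ^ m)).indicator
              (fun w => (Ff f w + gst (Ff f) (al j) w) * (ENNReal.ofReal B * (vk d m)⁻¹)) w := by
          refine lintegral_mono fun w => ?_
          by_cases hw : w ∈ closedBall z (c * (2:ℝ) ^ m)
          · rw [indicator_of_mem hw]; gcongr; exact hen w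
          · rw [indicator_of_notMem hw, hsupp w hw]; simp
      _ = (∫⁻ w in Lst (Ff f) (al j) m ∩ closedBall z (c * (2:ℝ) ^ m), Ff f w + gst (Ff f) (al j) w) * (ENNReal.ofReal B * (vk d m)⁻¹) := by
          rw [lintegral_indicator isClosed_closedBall.measurableSet, Measure.restrict_restrict isClosed_closedBall.measurableSet, inter_comm,
            lintegral_mul_const _ (show Measurable fun w => Ff f w + gst (Ff f) (al j) w from hFm.add hGm)]
      _ ≤ (X * Q * (KK * vk d m) + 2 ^ d * Q * (KK * vk d m)) * (ENNReal.ofReal B * (vk d m)⁻¹) := by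
          rw [lintegral_add_left hFm]
          gcongr
          · exact ball_av hd (Ff f) hFm _ hLm m hiv c hc z _ fun w hw hz => (hlev w hw hz).1
          · calc _ ≤ ∫⁻ w in Lst (Ff f) (al j) m ∩ closedBall z (c * (2:ℝ) ^ m), 2 ^ d * Q := by
                  refine setLIntegral_mono' hcm fun w hw => ?_
                  refine (gst_le (Ff f) (al j) (fun x h => cont_avx f hf (al j) x h) hd hI (h0 j) w).trans ?_
                  gcongr
                  exact (hlev w (hs hw).1 (hs hw).2).2
              _ ≤ _ := by
                  rw [setLIntegral_const, hKK, ← ball_vol z hd m _ (by positivity)]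
                  gcongr
                  exact hs.trans inter_subset_right
      _ = ENNReal.ofReal B * KK * (X + 2 ^ d) * Q * (vk d m * (vk d m)⁻¹) := by ring
      _ = _ := by rw [ENNReal.mul_inv_cancel (vk_ne_zero m) (vk_ne_top m), mul_one]
  · unfold Smf
    rw [← ENNReal.tsum_mul_left]
    refine ENNReal.tsum_le_tsum fun k => ?_
    by_cases hk : k < m
    · rw [if_pos hk, if_pos hk]
      apply le_of_eq
      have : ∀ w, (Ff f w + gst (Ff f) (al j) w) * Ω k w = (closedBall z ((c + √d) * (2:ℝ) ^ m)).indicator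
          (fun w => (Ff f w + gst (Ff f) (al j) w) * (ENNReal.ofReal (L * √d) * ENNReal.ofReal ((2:ℝ) ^ (k - m)) * (vk d m)⁻¹)) w := by
        intro w
        by_cases hw : w ∈ closedBall z ((c + √d) * (2:ℝ) ^ m) <;> simp [Ω, hw]
      simp_rw [this]
      rw [lintegral_indicator isClosed_closedBall.measurableSet, Measure.restrict_restrict isClosed_closedBall.measurableSet, inter_comm,
            lintegral_mul_const _ (show Measurable fun w => Ff f w + gst (Ff f) (al j) w from hFm.add hGm)]
      ring
    · simp [hk]
end ptw

section phi
variable (μ : Measure (EE d)) [IsFiniteMeasure μ] (R : ℝ) (hR : 0 ≤ R) (hμ : ∀ᵐ y ∂μ, ‖y‖ ≤ R)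

/-- majorant of `sup_t 1_{ball} * μ_t` over a dyadic range of `t`. -/
def Phi (K : ℝ) (k : ℤ) (s : ℕ) (x : EE d) : ℝ≥0∞ :=
  ∑ n ∈ Finset.range (2 * 2 ^ s), μ {y | ‖x - ((2:ℝ) ^ k + n * (2:ℝ) ^ (k - (s:ℤ))) • y‖ ≤ (K + R) * (2:ℝ) ^ (k - (s:ℤ))}

lemma phi_set_meas (a b : ℝ) : MeasurableSet {p : EE d × EE d | ‖p.1 - a • p.2‖ ≤ b} :=
  measurableSet_le (by fun_prop) measurable_const

lemma Phi_meas (K : ℝ) (k : ℤ) (s : ℕ) : Measurable (Phi μ R K k s) := by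
  unfold Phi
  refine Finset.measurable_fun_sum _ fun n _ => ?_
  exact measurable_measure_prodMk_left (phi_set_meas _ _)

include hR hμ in
lemma Phi_ge (K : ℝ) (k : ℤ) (s : ℕ) (t : ℝ) (ht : t ∈ Icc ((2:ℝ) ^ k) (2 * (2:ℝ) ^ k)) (x : EE d) :
    μ {y | ‖x - t • y‖ ≤ K * (2:ℝ) ^ (k - (s:ℤ))} ≤ Phi μ R K k s x := by
  set ρ := (2:ℝ) ^ (k - (s:ℤ)) with hρ
  have hρ0 : 0 < ρ := by positivity
  have hTr : (2:ℝ) ^ k = 2 ^ s * ρ := by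
    rw [hρ, ← zpow_natCast, ← zpow_add₀ (by norm_num)]; congr 1; ring
  set n := ⌊(t - 2 ^ k) / ρ⌋₊ with hn
  have h0 : 0 ≤ (t - 2 ^ k) / ρ := div_nonneg (by linarith [ht.1]) hρ0.le
  have h1 : (n:ℝ) ≤ (t - 2 ^ k) / ρ := Nat.floor_le h0
  have h2 : (t - 2 ^ k) / ρ < n + 1 := Nat.lt_floor_add_one _
  rw [le_div_iff₀ hρ0] at h1
  rw [div_lt_iff₀ hρ0] at h2
  have hnm : n ∈ Finset.range (2 * 2 ^ s) := by
    rw [Finset.mem_range]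
    have : (n:ℝ) * ρ ≤ 2 ^ s * ρ := by rw [← hTr]; linarith [ht.2]
    have : (n:ℝ) ≤ 2 ^ s := le_of_mul_le_mul_right this hρ0
    have : n ≤ 2 ^ s := by exact_mod_cast this
    have : 0 < 2 ^ s := by positivity
    omega
  unfold Phi
  refine le_trans ?_ (Finset.single_le_sum (f := fun n : ℕ => μ {y | ‖x - ((2:ℝ) ^ k + n * (2:ℝ) ^ (k - (s:ℤ))) • y‖ ≤ (K + R) * (2:ℝ) ^ (k - (s:ℤ))}) (fun _ _ => zero_le) hnm)
  refine measure_mono_ae ?_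
  filter_upwards [hμ] with y hy hxy
  rw [← hρ]
  change ‖x - ((2:ℝ) ^ k + n * ρ) • y‖ ≤ (K + R) * ρ
  have hxy' : ‖x - t • y‖ ≤ K * ρ := hxy
  have e : x - ((2:ℝ) ^ k + n * ρ) • y = (x - t • y) + (t - (2 ^ k + n * ρ)) • y := by
    rw [sub_smul]; abel
  rw [e]
  refine (norm_add_le _ _).trans ?_
  rw [norm_smul, Real.norm_of_nonneg (by linarith)]
  have : (t - (2 ^ k + n * ρ)) * ‖y‖ ≤ ρ * R := by
    apply mul_le_mul _ hy (norm_nonneg _) hρ0.le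
    linarith
  linarith

include hR in
lemma Phi_int (hd : 1 ≤ d) (K : ℝ) (hK : 0 ≤ K) (k : ℤ) (s : ℕ) :
    ∫⁻ x, Phi μ R K k s x ≤ (2 * μ univ * (ENNReal.ofReal ((K + R) ^ d) * volume (ball (0 : EE d) 1))) * (2 ^ s * vk d (k - s)) := by
  unfold Phi
  have hm : ∀ n : ℕ, Measurable fun x : EE d => μ {y | ‖x - ((2:ℝ) ^ k + n * (2:ℝ) ^ (k - (s:ℤ))) • y‖ ≤ (K + R) * (2:ℝ) ^ (k - (s:ℤ))} :=
    fun n => measurable_measure_prodMk_left (phi_set_meas _ _)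
  rw [lintegral_finsetSum _ fun n _ => hm n]
  have : ∀ n ∈ Finset.range (2 * 2 ^ s), ∫⁻ x, μ {y | ‖x - ((2:ℝ) ^ k + n * (2:ℝ) ^ (k - (s:ℤ))) • y‖ ≤ (K + R) * (2:ℝ) ^ (k - (s:ℤ))} =
      μ univ * (ENNReal.ofReal ((K + R) ^ d) * volume (ball (0 : EE d) 1) * vk d (k - s)) := by
    intro n _
    set a := ((2:ℝ) ^ k + n * (2:ℝ) ^ (k - (s:ℤ)))
    set b := (K + R) * (2:ℝ) ^ (k - (s:ℤ)) with hb
    have h1 := Measure.prod_apply (μ := (volume : Measure (EE d))) (ν := μ) (phi_set_meas (d := d) a b)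
    have h2 := Measure.prod_apply_symm (μ := (volume : Measure (EE d))) (ν := μ) (phi_set_meas (d := d) a b)
    rw [h1] at h2
    refine h2.trans ?_
    have : ∀ y : EE d, volume ((fun x => (x, y)) ⁻¹' {p : EE d × EE d | ‖p.1 - a • p.2‖ ≤ b}) = ENNReal.ofReal ((K + R) ^ d) * volume (ball (0 : EE d) 1) * vk d (k - s) := by
      intro y
      rw [← ball_vol (a • y) hd _ _ (by positivity)]
      congr 1
    simp_rw [this]
    rw [lintegral_const, mul_comm]
  rw [Finset.sum_congr rfl this, Finset.sum_const, Finset.card_range, nsmul_eq_mul]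
  push_cast
  apply le_of_eq; ring

/-- averages against the majorant -/
def cPhi (K : ℝ) (H : EE d → ℝ≥0∞) (k : ℤ) (s : ℕ) (x : EE d) : ℝ≥0∞ := ∫⁻ w, H w * Phi μ R K k s (x - w)

lemma cPhi_meas (K : ℝ) (H : EE d → ℝ≥0∞) (hH : Measurable H) (k : ℤ) (s : ℕ) : Measurable (cPhi μ R K H k s) := by
  unfold cPhi
  apply Measurable.lintegral_prod_right' (f := fun p : EE d × EE d => H p.2 * Phi μ R K k s (p.1 - p.2))
  exact (hH.comp measurable_snd).mul ((Phi_meas μ R K k s).comp (by fun_prop))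

lemma cPhi_int (K : ℝ) (H : EE d → ℝ≥0∞) (hH : Measurable H) (k : ℤ) (s : ℕ) :
    ∫⁻ x, cPhi μ R K H k s x = (∫⁻ w, H w) * ∫⁻ x, Phi μ R K k s x := by
  unfold cPhi
  rw [lintegral_lintegral_swap]
  · have : ∀ w, ∫⁻ x, H w * Phi μ R K k s (x - w) = H w * ∫⁻ x, Phi μ R K k s x := by
      intro w
      rw [lintegral_const_mul _ (show Measurable fun x => Phi μ R K k s (x - w) from (Phi_meas μ R K k s).comp (by fun_prop)), lintegral_sub_right_eq_self]
    simp_rw [this]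
    rw [lintegral_mul_const _ hH]
  · exact ((hH.comp measurable_snd).mul ((Phi_meas μ R K k s).comp (by fun_prop))).aemeasurable

def BI (H : EE d → ℝ≥0∞) (r : ℝ) (z : EE d) : ℝ≥0∞ := ∫⁻ w in closedBall z r, H w

lemma BI_eq (H : EE d → ℝ≥0∞) (r : ℝ) (z : EE d) :
    BI H r z = ∫⁻ w, ({p : EE d × EE d | ‖p.1 - p.2‖ ≤ r}.indicator (fun p => H p.2)) (z, w) := by
  unfold BI
  rw [← lintegral_indicator isClosed_closedBall.measurableSet]
  congr 1; funext w
  by_cases h : w ∈ closedBall z r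
  · rw [indicator_of_mem h, indicator_of_mem]
    rw [mem_closedBall, dist_comm, dist_eq_norm] at h; exact h
  · rw [indicator_of_notMem h, indicator_of_notMem]
    rw [mem_closedBall, dist_comm, dist_eq_norm] at h; exact h

lemma BI_fun_meas (H : EE d → ℝ≥0∞) (hH : Measurable H) (r : ℝ) :
    Measurable ({p : EE d × EE d | ‖p.1 - p.2‖ ≤ r}.indicator (fun p => H p.2)) :=
  (hH.comp measurable_snd).indicator (measurableSet_le (by fun_prop) measurable_const)

lemma BI_meas (H : EE d → ℝ≥0∞) (hH : Measurable H) (r : ℝ) : Measurable (BI H r) := by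
  have : BI H r = fun z => ∫⁻ w, ({p : EE d × EE d | ‖p.1 - p.2‖ ≤ r}.indicator (fun p => H p.2)) (z, w) :=
    funext fun z => BI_eq H r z
  rw [this]
  exact (BI_fun_meas H hH r).lintegral_prod_right'

include hR hμ in
lemma BI_avg (K : ℝ) (H : EE d → ℝ≥0∞) (hH : Measurable H) (k : ℤ) (s : ℕ) (t : ℝ)
    (ht : t ∈ Icc ((2:ℝ) ^ k) (2 * (2:ℝ) ^ k)) (x : EE d) :
    ∫⁻ y, BI H (K * (2:ℝ) ^ (k - (s:ℤ))) (x - t • y) ∂μ ≤ cPhi μ R K H k s x := by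
  simp_rw [BI_eq]
  rw [lintegral_lintegral_swap]
  · unfold cPhi
    refine lintegral_mono fun w => ?_
    calc _ = ∫⁻ y, {y | ‖(x - w) - t • y‖ ≤ K * (2:ℝ) ^ (k - (s:ℤ))}.indicator (fun _ => H w) y ∂μ := by
          congr 1; funext y
          have : x - t • y - w = x - w - t • y := by abel
          by_cases h : ‖(x - w) - t • y‖ ≤ K * (2:ℝ) ^ (k - (s:ℤ))
          · rw [indicator_of_mem (by rw [← this] at h; exact h), indicator_of_mem (by exact h)]
          · rw [indicator_of_notMem (by rw [← this] at h; exact h), indicator_of_notMem (by exact h)]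
      _ = H w * μ {y | ‖(x - w) - t • y‖ ≤ K * (2:ℝ) ^ (k - (s:ℤ))} := by
          rw [lintegral_indicator_const]
          exact measurableSet_le (by fun_prop) measurable_const
      _ ≤ _ := by
          gcongr
          exact Phi_ge μ R hR hμ K k s t ht (x - w)
  · refine Measurable.aemeasurable ?_
    exact (BI_fun_meas H hH _).comp (f := fun p : EE d × EE d => (x - t • p.1, p.2)) (by fun_prop)
end phi

section perj
variable (μ : Measure (EE d)) [IsFiniteMeasure μ] (R : ℝ) (hR : 0 ≤ R) (hμ : ∀ᵐ y ∂μ, ‖y‖ ≤ R)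

def cst (K : ℝ) : ℝ≥0∞ := 2 * μ univ * (ENNReal.ofReal ((K + R) ^ d) * volume (ball (0 : EE d) 1))

lemma cst_ne_top (K : ℝ) : cst μ R K ≠ ⊤ := by
  unfold cst
  exact ENNReal.mul_ne_top (ENNReal.mul_ne_top (by simp) (measure_ne_top _ _))
    (ENNReal.mul_ne_top (by simp) measure_ball_lt_top.ne)

include hR in
lemma vk_cPhi_int (hd : 1 ≤ d) (K : ℝ) (hK : 0 ≤ K) (H : EE d → ℝ≥0∞) (hH : Measurable H) (k : ℤ) (s : ℕ) :
    ∫⁻ x, (vk d (k - s))⁻¹ * cPhi μ R K H k s x ≤ cst μ R K * 2 ^ s * ∫⁻ w, H w := by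
  rw [lintegral_const_mul _ (cPhi_meas μ R K H hH k s), cPhi_int μ R K H hH]
  calc (vk d (k - s))⁻¹ * ((∫⁻ w, H w) * ∫⁻ x, Phi μ R K k s x)
      ≤ (vk d (k - s))⁻¹ * ((∫⁻ w, H w) * (cst μ R K * (2 ^ s * vk d (k - s)))) := by
        gcongr; exact Phi_int μ R hR hd K hK k s
    _ = ((vk d (k - s))⁻¹ * vk d (k - s)) * (cst μ R K * 2 ^ s * ∫⁻ w, H w) := by ring
    _ = _ := by rw [ENNReal.inv_mul_cancel (vk_ne_zero _) (vk_ne_top _), one_mul]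

/-- small-scale majorant -/
def SM (F G : EE d → ℝ≥0∞) (α : ℝ≥0∞) (K : ℝ) (j : ℕ) (x : EE d) : ℝ≥0∞ :=
  ∑' k : ℤ, ∑' k' : ℤ, if k' < k - j then ENNReal.ofReal ((2:ℝ) ^ (k' - (k - j))) *
    ((vk d (k - j))⁻¹ * cPhi μ R K ((stp F α k').indicator fun w => F w + G w) k j x) else 0

lemma SM_meas (F G : EE d → ℝ≥0∞) (hF : Measurable F) (hG : Measurable G) (α : ℝ≥0∞) (K : ℝ) (j : ℕ) :
    Measurable (SM μ R F G α K j) := by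
  unfold SM
  refine Measurable.tsum fun k => Measurable.tsum fun k' => ?_
  split_ifs
  · exact ((cPhi_meas μ R K _ ((show Measurable fun w => F w + G w from hF.add hG).indicator (stp_meas F α hF k')) k j).const_mul _).const_mul _
  · exact measurable_const

include hR hμ in
lemma SM_ge (F G : EE d → ℝ≥0∞) (hF : Measurable F) (hG : Measurable G) (α : ℝ≥0∞) (K : ℝ) (j : ℕ) (k : ℤ) (t : ℝ)
    (ht : t ∈ Icc ((2:ℝ) ^ k) (2 * (2:ℝ) ^ k)) (x : EE d) :
    ∫⁻ y, Smf F G α K (k - j) (x - t • y) ∂μ ≤ SM μ R F G α K j x := by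
  refine le_trans ?_ (ENNReal.le_tsum k)
  unfold Smf
  have hFG : Measurable fun w => F w + G w := hF.add hG
  have hI : ∀ k', Measurable ((stp F α k').indicator fun w => F w + G w) := fun k' => hFG.indicator (stp_meas F α hF k')
  have e : ∀ k' : ℤ, ∀ z : EE d, ∫⁻ w in stp F α k' ∩ closedBall z (K * (2:ℝ) ^ (k - (j:ℤ))), (F w + G w) =
      BI ((stp F α k').indicator fun w => F w + G w) (K * (2:ℝ) ^ (k - (j:ℤ))) z := by
    intro k' z
    unfold BI
    rw [setLIntegral_indicator (stp_meas F α hF k')]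
  simp_rw [e]
  have hm : ∀ k' : ℤ, Measurable fun y => BI ((stp F α k').indicator fun w => F w + G w) (K * (2:ℝ) ^ (k - (j:ℤ))) (x - t • y) :=
    fun k' => (BI_meas _ (hI k') _).comp (by fun_prop)
  rw [lintegral_tsum]
  · refine ENNReal.tsum_le_tsum fun k' => ?_
    split_ifs with h
    · rw [lintegral_const_mul _ ((hm k').const_mul _), lintegral_const_mul _ (hm k')]
      gcongr
      exact BI_avg μ R hR hμ K _ (hI k') k j t ht x
    · simp
  · intro k'
    split_ifs
    · exact (((hm k').const_mul _).const_mul _).aemeasurable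
    · exact aemeasurable_const

include hR in
lemma SM_int (S : ℝ≥0∞) (hS : ∀ s : ℝ, 0 < s → ∑' k : ℤ, ENNReal.ofReal (min ((2:ℝ) ^ k * s) ((2:ℝ) ^ k * s)⁻¹) ≤ S)
    (hd : 1 ≤ d) (F : EE d → ℝ≥0∞) (hF : Measurable F) (α : ℝ≥0∞) (K : ℝ) (hK : 0 ≤ K) (j : ℕ) :
    ∫⁻ x, SM μ R F (gst F α) α K j x ≤ cst μ R K * 2 ^ j * 2 * S * ∫⁻ x, F x := by
  have hG := gst_meas F α hF
  have hFG : Measurable fun w => F w + gst F α w := hF.add hG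
  have hI : ∀ k', Measurable ((stp F α k').indicator fun w => F w + gst F α w) := fun k' => hFG.indicator (stp_meas F α hF k')
  have hm : ∀ k k' : ℤ, Measurable fun x => if k' < k - j then ENNReal.ofReal ((2:ℝ) ^ (k' - (k - j))) *
    ((vk d (k - j))⁻¹ * cPhi μ R K ((stp F α k').indicator fun w => F w + gst F α w) k j x) else 0 := by
    intro k k'
    split_ifs
    · exact ((cPhi_meas μ R K _ (hI k') k j).const_mul _).const_mul _
    · exact measurable_const
  unfold SM
  rw [lintegral_tsum fun k => (Measurable.tsum (hm k)).aemeasurable]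
  have h1 : ∀ k : ℤ, ∫⁻ x, ∑' k' : ℤ, (if k' < k - j then ENNReal.ofReal ((2:ℝ) ^ (k' - (k - j))) *
    ((vk d (k - j))⁻¹ * cPhi μ R K ((stp F α k').indicator fun w => F w + gst F α w) k j x) else 0) ≤
     ∑' k' : ℤ, ENNReal.ofReal (min ((2:ℝ) ^ k * (2:ℝ) ^ (-k' - j)) ((2:ℝ) ^ k * (2:ℝ) ^ (-k' - j))⁻¹) *
       (cst μ R K * 2 ^ j * (2 * ∫⁻ w in stp F α k', F w)) := by
    intro k
    rw [lintegral_tsum fun k' => (hm k k').aemeasurable]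
    refine ENNReal.tsum_le_tsum fun k' => ?_
    split_ifs with h
    · rw [lintegral_const_mul _ ((cPhi_meas μ R K _ (hI k') k j).const_mul _)]
      refine mul_le_mul ?_ ?_ (zero_le) (zero_le)
      · apply ENNReal.ofReal_le_ofReal
        rw [← zpow_add₀ (by norm_num), ← zpow_neg]
        refine le_min ?_ ?_
        · exact zpow_le_zpow_right₀ (by norm_num) (by omega)
        · exact zpow_le_zpow_right₀ (by norm_num) (by omega)
      · refine (vk_cPhi_int μ R hR hd K hK _ (hI k') k j).trans ?_
        gcongr
        rw [lintegral_indicator (stp_meas F α hF k'), lintegral_add_left hF, gst_on_int F α hF, two_mul]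
    · simp
  refine (ENNReal.tsum_le_tsum h1).trans ?_
  rw [ENNReal.tsum_comm]
  calc _ ≤ ∑' k' : ℤ, S * (cst μ R K * 2 ^ j * (2 * ∫⁻ w in stp F α k', F w)) := by
        refine ENNReal.tsum_le_tsum fun k' => ?_
        rw [ENNReal.tsum_mul_right]
        gcongr
        exact hS _ (by positivity)
    _ = cst μ R K * 2 ^ j * 2 * S * ∑' k', ∫⁻ w in stp F α k', F w := by
        rw [← ENNReal.tsum_mul_left]
        congr 1; funext k'; ring
    _ ≤ _ := by gcongr; exact stp_sum F α hF

/-- large-scale majorant -/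
def LS (F : EE d → ℝ≥0∞) (al : ℕ → ℝ≥0∞) (J : ℕ) (K : ℝ) (j : ℕ) (x : EE d) : ℝ≥0∞ :=
  ∑ i ∈ Finset.Ico j J, al i * ∑' k : ℤ, ∑ s ∈ Finset.range (j + 1),
    (vk d (k - s))⁻¹ * cPhi μ R K ((stp F (al i) (k - s)).indicator fun _ => 1) k s x

lemma LS_meas (F : EE d → ℝ≥0∞) (hF : Measurable F) (al : ℕ → ℝ≥0∞) (J : ℕ) (K : ℝ) (j : ℕ) :
    Measurable (LS μ R F al J K j) := by
  unfold LS
  refine Finset.measurable_fun_sum _ fun i _ => Measurable.const_mul (Measurable.tsum fun k => Finset.measurable_fun_sum _ fun s _ => ?_) _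
  exact (cPhi_meas μ R K _ (measurable_const.indicator (stp_meas F _ hF _)) k s).const_mul _

lemma Ust_BI (F : EE d → ℝ≥0∞) (hF : Measurable F) (α : ℝ≥0∞) (k : ℤ) (K : ℝ) (z : EE d) :
    Ust F α k K z = (vk d k)⁻¹ * BI ((stp F α k).indicator fun _ => 1) (K * (2:ℝ) ^ k) z := by
  unfold Ust BI
  rw [setLIntegral_indicator (stp_meas F α hF k), setLIntegral_one]

include hR hμ in
lemma LS_ge (F : EE d → ℝ≥0∞) (hF : Measurable F) (al : ℕ → ℝ≥0∞) (J : ℕ) (K : ℝ) (j : ℕ) (k : ℤ) (t : ℝ)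
    (ht : t ∈ Icc ((2:ℝ) ^ k) (2 * (2:ℝ) ^ k)) (x : EE d)
    (hx : ∀ i < J, ∀ k', Ust F (al i) k' (K + R + √d) x < 1) :
    ∫⁻ y, LB F al J K j (k - j) (x - t • y) ∂μ ≤ LS μ R F al J K j x := by
  have hI : ∀ i k', Measurable ((stp F (al i) k').indicator fun _ => (1:ℝ≥0∞)) := fun i k' => measurable_const.indicator (stp_meas F _ hF _)
  have hU : ∀ i k', Measurable fun y => Ust F (al i) k' K (x - t • y) := by
    intro i k'
    simp_rw [Ust_BI F hF]
    exact Measurable.const_mul ((BI_meas _ (hI i k') _).comp (by fun_prop)) _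
  have hm : ∀ i (k' : ℤ), Measurable fun y => if k - (j:ℤ) ≤ k' then Ust F (al i) k' K (x - t • y) else 0 := by
    intro i k'
    split_ifs
    · exact hU i k'
    · exact measurable_const
  unfold LB LS
  rw [lintegral_finsetSum _ fun i _ => (Measurable.tsum (hm i)).const_mul _]
  refine Finset.sum_le_sum fun i hi => ?_
  rw [lintegral_const_mul _ (Measurable.tsum (hm i))]
  gcongr
  rw [lintegral_tsum fun k' => (hm i k').aemeasurable]
  refine le_trans ?_ (ENNReal.le_tsum k)
  calc _ ≤ ∑' k' : ℤ, ∑ s ∈ Finset.range (j + 1), if k' = k - s then (vk d (k - s))⁻¹ * cPhi μ R K ((stp F (al i) (k - s)).indicator fun _ => 1) k s x else 0 := by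
        refine ENNReal.tsum_le_tsum fun k' => ?_
        by_cases h1 : k - (j:ℤ) ≤ k'
        · simp only [if_pos h1]
          by_cases h2 : k' ≤ k
          · have hs : k' = k - ((k - k').toNat : ℤ) := by omega
            refine le_trans ?_ (Finset.single_le_sum (f := fun s : ℕ => if k' = k - s then (vk d (k - s))⁻¹ * cPhi μ R K ((stp F (al i) (k - s)).indicator fun _ => 1) k s x else 0) (fun _ _ => zero_le) (Finset.mem_range.2 (show (k - k').toNat < j + 1 by omega)))
            simp only [if_pos hs]
            rw [← hs]
            simp_rw [Ust_BI F hF]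
            rw [lintegral_const_mul _ (show Measurable fun y => BI ((stp F (al i) k').indicator fun _ => 1) (K * (2:ℝ) ^ k') (x - t • y) from (BI_meas _ (hI i k') _).comp (by fun_prop))]
            gcongr
            have := BI_avg μ R hR hμ K _ (hI i k') k (k - k').toNat t ht x
            rw [← hs] at this
            exact this
          · rw [lintegral_congr_ae (g := fun _ => 0), lintegral_zero]
            · exact zero_le
            filter_upwards [hμ] with y hy
            have h0 : stp F (al i) k' ∩ closedBall (x - t • y) (K * (2:ℝ) ^ k') = ∅ := by
              by_contra hne
              obtain ⟨w, hw1, hw2⟩ := nonempty_iff_ne_empty.2 hne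
              refine absurd (Ust_ge F (al i) k' (K + R) x w hw1 ?_) (not_le.2 (hx i (Finset.mem_Ico.1 hi).2 k'))
              rw [mem_closedBall, dist_eq_norm] at *
              have h3 : ‖w - x‖ ≤ ‖w - (x - t • y)‖ + ‖t • y‖ := by
                have : w - x = (w - (x - t • y)) - t • y := by abel
                rw [this]; exact norm_sub_le _ _
              have h2k : (0:ℝ) < 2 ^ k := by positivity
              have h4 : ‖t • y‖ ≤ 2 ^ k' * R := by
                rw [norm_smul]
                apply mul_le_mul _ hy (norm_nonneg _) (by positivity)
                rw [Real.norm_of_nonneg (by linarith [ht.1])]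
                refine ht.2.trans ?_
                rw [← zpow_one_add₀ (by norm_num)]
                exact zpow_le_zpow_right₀ (by norm_num) (by omega)
              linarith
            unfold Ust
            rw [h0]; simp
        · simp only [if_neg h1, lintegral_zero]; exact zero_le
    _ = _ := by
        rw [Summable.tsum_finsetSum fun _ _ => ENNReal.summable]
        refine Finset.sum_congr rfl fun s _ => ?_
        rw [tsum_ite_eq]

include hR in
lemma LS_int (hd : 1 ≤ d) (F : EE d → ℝ≥0∞) (hF : Measurable F) (al : ℕ → ℝ≥0∞) (J : ℕ) (K : ℝ) (hK : 0 ≤ K) (j : ℕ) :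
    ∫⁻ x, LS μ R F al J K j x ≤ cst μ R K * 2 ^ j * 2 * ((J - j : ℕ) : ℝ≥0∞) * ∫⁻ x, F x := by
  have hI : ∀ i k', Measurable ((stp F (al i) k').indicator fun _ => (1:ℝ≥0∞)) := fun i k' => measurable_const.indicator (stp_meas F _ hF _)
  have hm0 : ∀ i (k : ℤ) (s : ℕ), Measurable fun x => (vk d (k - s))⁻¹ * cPhi μ R K ((stp F (al i) (k - s)).indicator fun _ => 1) k s x :=
    fun i k s => (cPhi_meas μ R K _ (hI i _) k s).const_mul _
  have hm1 : ∀ i (k : ℤ), Measurable fun x => ∑ s ∈ Finset.range (j + 1),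
    (vk d (k - s))⁻¹ * cPhi μ R K ((stp F (al i) (k - s)).indicator fun _ => 1) k s x := fun i k => Finset.measurable_fun_sum _ fun s _ => hm0 i k s
  unfold LS
  rw [lintegral_finsetSum _ fun i _ => (Measurable.tsum (hm1 i)).const_mul _]
  have key : ∀ i ∈ Finset.Ico j J, ∫⁻ x, al i * ∑' k : ℤ, ∑ s ∈ Finset.range (j + 1),
    (vk d (k - s))⁻¹ * cPhi μ R K ((stp F (al i) (k - s)).indicator fun _ => 1) k s x ≤ cst μ R K * 2 ^ j * 2 * ∫⁻ x, F x := by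
    intro i _
    rw [lintegral_const_mul _ (Measurable.tsum (hm1 i)), lintegral_tsum fun k => (hm1 i k).aemeasurable]
    calc _ ≤ al i * ∑' k : ℤ, ∑ s ∈ Finset.range (j + 1), cst μ R K * 2 ^ s * volume (stp F (al i) (k - s)) := by
          refine mul_le_mul le_rfl (ENNReal.tsum_le_tsum fun k => ?_) (zero_le) (zero_le)
          rw [lintegral_finsetSum _ fun s _ => hm0 i k s]
          refine Finset.sum_le_sum fun s _ => ?_
          refine (vk_cPhi_int μ R hR hd K hK _ (hI i _) k s).trans ?_
          rw [lintegral_indicator (stp_meas F _ hF _), setLIntegral_one]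
      _ = ∑ s ∈ Finset.range (j + 1), cst μ R K * 2 ^ s * (al i * ∑' k : ℤ, volume (stp F (al i) k)) := by
          rw [Summable.tsum_finsetSum fun _ _ => ENNReal.summable, Finset.mul_sum]
          refine Finset.sum_congr rfl fun s _ => ?_
          have := (Equiv.subRight (s:ℤ)).tsum_eq fun k => volume (stp F (al i) k)
          simp only [Equiv.subRight_apply] at this
          rw [ENNReal.tsum_mul_left, this]
          ring
      _ ≤ ∑ s ∈ Finset.range (j + 1), cst μ R K * 2 ^ s * ∫⁻ x, F x := by
          gcongr; exact stp_vol F (al i) hF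
      _ = cst μ R K * (∑ s ∈ Finset.range (j + 1), 2 ^ s) * ∫⁻ x, F x := by
          rw [Finset.mul_sum, Finset.sum_mul]
      _ ≤ cst μ R K * (2 ^ j * 2) * ∫⁻ x, F x := by
          gcongr
          have h := Nat.geomSum_lt (m := 2) le_rfl (n := j + 1) (s := Finset.range (j + 1)) (fun k hk => Finset.mem_range.1 hk)
          rw [pow_succ] at h
          exact_mod_cast h.le
      _ = _ := by ring
  refine (Finset.sum_le_sum key).trans ?_
  rw [Finset.sum_const, Nat.card_Ico, nsmul_eq_mul]
  apply le_of_eq; ring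

end perj

section perj2
variable (μ : Measure (EE d)) [IsFiniteMeasure μ] (R : ℝ) (hR : 0 ≤ R) (hμ : ∀ᵐ y ∂μ, ‖y‖ ≤ R)

lemma Fav_intg (h : EE d → ℂ) (hc : Continuous h) (ρ : ℝ) (hρ : ∀ x, ρ < ‖x‖ → h x = 0) (t : ℝ) (x : EE d) :
    Integrable (fun y => h (x - t • y)) μ := by
  obtain ⟨B, hB⟩ := hc.bounded_above_of_compact_support (ftf_hcs h ρ hρ)
  exact Integrable.of_bound (hc.comp (by fun_prop)).aestronglyMeasurable B (Filter.Eventually.of_forall fun y => hB _)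

include hR hμ in
theorem perj (hd : 1 ≤ d) (X : ℝ≥0∞) (hX : 1 ≤ X) (hXt : X ≠ ⊤) (ψ : EE d → ℂ) (hψ : ContDiff ℝ (⊤ : ℕ∞) ψ) (B L c : ℝ) (hc : 0 ≤ c)
    (hL0 : 0 ≤ L) (hB : ∀ x, ‖ψ x‖ ≤ B)
    (hL : ∀ x y, ‖ψ x - ψ y‖ ≤ L * ‖x - y‖) (hcs : ∀ x, c < ‖x‖ → ψ x = 0) :
    ∃ Cq : ℝ≥0∞, Cq ≠ ⊤ ∧ ∀ f : EE d → ℝ, Continuous f → (∀ x, 0 ≤ f x) → (∀ x, f x ≤ 1) →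
      ∀ ρ : ℝ, (∀ x, ρ < ‖x‖ → f x = 0) →
      ∀ (al : ℕ → ℝ≥0∞) (J : ℕ), (∀ i, al i ≠ 0) → (∀ i, al i ≠ ⊤) → (∀ i, al (i + 1) ≤ X * al i) → (∀ i, J ≤ i → al i = 1) →
      ∀ j : ℕ, ∃ SL : EE d → ℝ≥0∞, Measurable SL ∧
        ∫⁻ x, SL x ≤ Cq * 2 ^ j * ((J - j : ℕ) : ℝ≥0∞) * ∫⁻ x, Ff f x ∧
        ∀ x, (∀ i < J, ∀ k', Ust (Ff f) (al i) k' (c + √d + √d + R + √d) x < 1) →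
        ∀ k : ℤ, ∀ t ∈ Icc ((2:ℝ) ^ k) (2 * (2:ℝ) ^ k),
          ‖Fav (cvK ψ ((2:ℝ) ^ (k - (j:ℤ))) (fun x => (f x : ℂ))) μ t x‖ₑ ≤
            ‖Fav (cvK ψ ((2:ℝ) ^ (k - (j:ℤ))) (uG f (al j))) μ t x‖ₑ + SL x := by
  obtain ⟨S, hSt, hS⟩ := dyad_sum
  set A1 := ENNReal.ofReal B * (ENNReal.ofReal ((c + √d) ^ d) * volume (ball (0 : EE d) 1)) * (X + 2 ^ d) with hA1
  set A2 := ENNReal.ofReal (L * √d) with hA2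
  have hA1t : A1 ≠ ⊤ := ENNReal.mul_ne_top (ENNReal.mul_ne_top (by simp) (ENNReal.mul_ne_top (by simp) measure_ball_lt_top.ne))
    (ENNReal.add_ne_top.2 ⟨hXt, by simp⟩)
  set D1 := cst μ R (c + √d + √d) with hD1
  set D2 := cst μ R (c + √d) with hD2
  have hD1t : D1 ≠ ⊤ := cst_ne_top _ _ _
  have hD2t : D2 ≠ ⊤ := cst_ne_top _ _ _
  refine ⟨A1 * (D1 * 2) + A2 * (D2 * 2 * S), ?_, ?_⟩
  · refine ENNReal.add_ne_top.2 ⟨ENNReal.mul_ne_top hA1t (ENNReal.mul_ne_top hD1t (by simp)),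
      ENNReal.mul_ne_top (by simp [hA2]) (ENNReal.mul_ne_top (ENNReal.mul_ne_top hD2t (by simp)) hSt)⟩
  intro f hf hf0 hf1 ρ hρ al J h0 ht hX' hJ j
  have hFm := Ff_meas f hf
  have hfi := f_int f hf ρ hρ
  have hI := Ff_int f hf hf0 ρ hρ
  have hGm := gst_meas (Ff f) (al j) hFm
  set SMx : EE d → ℝ≥0∞ := if j < J then SM μ R (Ff f) (gst (Ff f) (al j)) (al j) (c + √d) j else fun _ => 0 with hSMx
  have hLSm := LS_meas μ R (Ff f) hFm al J (c + √d + √d) j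
  have hSMm : Measurable SMx := by
    rw [hSMx]; split_ifs
    · exact SM_meas μ R _ _ hFm hGm _ _ _
    · exact measurable_const
  have hSMi : ∫⁻ x, SMx x ≤ D2 * 2 ^ j * 2 * S * ((J - j : ℕ) : ℝ≥0∞) * ∫⁻ x, Ff f x := by
    rw [hSMx]; split_ifs with hj
    · refine (SM_int μ R hR S hS hd (Ff f) hFm (al j) (c + √d) (by positivity) j).trans ?_
      have h1 : 1 ≤ J - j := by omega
      have h2 : (1:ℝ≥0∞) ≤ ((J - j : ℕ) : ℝ≥0∞) := by exact_mod_cast h1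
      exact mul_le_mul (le_mul_of_one_le_right (zero_le) h2) le_rfl (zero_le) (zero_le)
    · simp
  refine ⟨fun x => A1 * LS μ R (Ff f) al J (c + √d + √d) j x + A2 * SMx x, (hLSm.const_mul _).add (hSMm.const_mul _), ?_, ?_⟩
  · rw [lintegral_add_left (hLSm.const_mul _), lintegral_const_mul _ hLSm, lintegral_const_mul _ hSMm]
    calc _ ≤ A1 * (D1 * 2 ^ j * 2 * ((J - j : ℕ) : ℝ≥0∞) * ∫⁻ x, Ff f x) + A2 * (D2 * 2 ^ j * 2 * S * ((J - j : ℕ) : ℝ≥0∞) * ∫⁻ x, Ff f x) := by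
          gcongr
          exact LS_int μ R hR hd (Ff f) hFm al J _ (by positivity) j
      _ = _ := by ring
  · intro x hx k t htk
    have hr : (0:ℝ) < 2 ^ (k - (j:ℤ)) := by positivity
    have hui := uG_int f hf hf0 (al j) hd hI (h0 j) (ht j)
    have hfc : Integrable (fun w => (f w : ℂ)) := hfi.ofReal
    obtain ⟨ρ', hρ'⟩ := gst_supp (Ff f) (al j) hd hI (h0 j) ρ (fun x hx => by simp [Ff, hρ x hx])
    have hus : ∀ x, ρ' < ‖x‖ → uG f (al j) x = 0 := fun x hx => by simp [uG, hρ' x hx]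
    have hfs : ∀ x, ρ < ‖x‖ → (f x : ℂ) = 0 := fun x hx => by simp [hρ x hx]
    have i1 := Fav_intg μ _ (cvK_contDiff ψ hψ c hcs _ hr _ hfc).continuous _ (cvK_supp ψ c hcs _ hr _ ρ hfs) t x
    have i2 := Fav_intg μ _ (cvK_contDiff ψ hψ c hcs _ hr _ hui).continuous _ (cvK_supp ψ c hcs _ hr _ ρ' hus) t x
    have hpt := ptw_bound hd f hf hf0 hf1 hfi hI al J X hX h0 ht hX' hJ ψ hψ.continuous B L c hc hL0 hB hL hcs j (k - j)
    rw [← hA1, ← hA2] at hpt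
    have e : Fav (cvK ψ ((2:ℝ) ^ (k - (j:ℤ))) (fun x => (f x : ℂ))) μ t x = Fav (cvK ψ ((2:ℝ) ^ (k - (j:ℤ))) (uG f (al j))) μ t x +
        ∫ y, (cvK ψ ((2:ℝ) ^ (k - (j:ℤ))) (fun x => (f x : ℂ)) (x - t • y) - cvK ψ ((2:ℝ) ^ (k - (j:ℤ))) (uG f (al j)) (x - t • y)) ∂μ := by
      rw [integral_sub i1 i2]; unfold Fav; ring
    rw [e]
    refine (enorm_add_le _ _).trans (add_le_add le_rfl ?_)
    refine (enorm_integral_le_lintegral_enorm _).trans ?_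
    refine (lintegral_mono fun y => hpt (x - t • y)).trans ?_
    have hLBm : Measurable fun y => LB (Ff f) al J (c + √d + √d) j (k - j) (x - t • y) := by
      unfold LB
      refine Finset.measurable_fun_sum _ fun i _ => Measurable.const_mul (Measurable.tsum fun k' => ?_) _
      split_ifs
      · simp_rw [Ust_BI (Ff f) hFm]
        exact Measurable.const_mul ((BI_meas _ (measurable_const.indicator (stp_meas _ _ hFm _)) _).comp (by fun_prop)) _
      · exact measurable_const
    rw [lintegral_add_left (hLBm.const_mul _), lintegral_const_mul _ hLBm, lintegral_const_mul' _ _ (by simp [hA2])]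
    beta_reduce
    gcongr
    · exact LS_ge μ R hR hμ (Ff f) hFm al J _ j k t htk x hx
    · rw [hSMx]; split_ifs with hj
      · exact SM_ge μ R hR hμ (Ff f) _ hFm hGm (al j) _ j k t htk x
      · have : ∀ k', stp (Ff f) (al j) k' = ∅ := by
          intro k'
          ext w
          simp only [mem_empty_iff_false, iff_false]
          intro hw
          have h1 := hw.1
          rw [hJ j (by omega)] at h1
          refine absurd h1 (not_lt.2 (avx_le k' _ w 1 fun v _ => ?_))
          unfold Ff
          exact ENNReal.ofReal_le_one.2 (hf1 v)
        simp [Smf, this]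

lemma cvK_change (φ : EE d → ℂ) (r : ℝ) (hr : 0 < r) (u : EE d → ℂ) (z : EE d) :
    cvK φ r u z = ∫ v, u (z - r • v) * φ v := by
  unfold cvK
  rw [← integral_sub_left_eq_self (fun w => u w * scl φ r (z - w)) volume z]
  have := Measure.integral_comp_inv_smul_of_nonneg (volume : Measure (EE d)) (fun v => u (z - r • v) * φ v) hr.le
  have h2 : ∫ v, u (z - r • v) * φ v = ((r ^ Module.finrank ℝ (EE d))⁻¹ : ℝ) • ∫ x, u (z - r • (r⁻¹ • x)) * φ (r⁻¹ • x) := by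
    rw [this, smul_smul, inv_mul_cancel₀ (by positivity), one_smul]
  rw [h2, ← integral_smul]
  congr 1; funext w
  rw [smul_inv_smul₀ hr.ne', sub_sub_cancel, scl, Complex.real_smul]
  ring

lemma cvK_tel (φ : EE d → ℂ) (hφ : Continuous φ) (c : ℝ) (hcs : ∀ x, c < ‖x‖ → φ x = 0) (u : EE d → ℂ) (hu : Integrable u) (k : ℤ) (n : ℕ) (z : EE d) :
    cvK φ ((2:ℝ) ^ (k - (n:ℤ))) u z = cvK φ ((2:ℝ) ^ k) u z +
      ∑ j ∈ Finset.range n, cvK (psiK φ) ((2:ℝ) ^ (k - ((j + 1 : ℕ) : ℤ))) u z := by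
  induction n with
  | zero => simp
  | succ n ih =>
    rw [Finset.sum_range_succ, ← add_assoc, ← ih]
    have hI : ∀ r : ℝ, 0 < r → Integrable fun w => u w * scl φ r (z - w) := by
      intro r hr
      have hsc : Continuous (scl φ r) := by unfold scl; fun_prop
      obtain ⟨B, hB⟩ := hsc.bounded_above_of_compact_support (ftf_hcs _ _ (scl_supp φ c hcs r hr))
      exact hu.mul_bdd (hsc.comp (by fun_prop)).aestronglyMeasurable (Filter.Eventually.of_forall fun w => hB _)
    have hr : (0:ℝ) < 2 ^ (k - ((n + 1 : ℕ):ℤ)) := by positivity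
    have e2 : (2:ℝ) * 2 ^ (k - ((n + 1 : ℕ):ℤ)) = 2 ^ (k - (n:ℤ)) := by
      rw [← zpow_one_add₀ (by norm_num)]; congr 1; push_cast; ring
    have : cvK (psiK φ) ((2:ℝ) ^ (k - ((n + 1 : ℕ):ℤ))) u z = cvK φ ((2:ℝ) ^ (k - ((n + 1 : ℕ):ℤ))) u z - cvK φ ((2:ℝ) ^ (k - (n:ℤ))) u z := by
      unfold cvK
      rw [← integral_sub (hI _ hr) (hI _ (by positivity))]
      congr 1; funext w
      rw [scl_psiK φ _ hr, e2]; ring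
    rw [this]; ring

lemma Fav_lim (φ : EE d → ℂ) (hφ : Continuous φ) (c : ℝ) (hcs : ∀ x, c < ‖x‖ → φ x = 0) (h1 : ∫ x, φ x = 1)
    (u : EE d → ℂ) (hu : Continuous u) (ρ : ℝ) (hρ : ∀ x, ρ < ‖x‖ → u x = 0) (k : ℤ) (t : ℝ) (x : EE d) :
    Filter.Tendsto (fun n : ℕ => Fav (cvK φ ((2:ℝ) ^ (k - (n:ℤ))) u) μ t x) Filter.atTop (nhds (Fav u μ t x)) := by
  obtain ⟨B, hB⟩ := hu.bounded_above_of_compact_support (ftf_hcs u ρ hρ)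
  have hB0 : 0 ≤ B := (norm_nonneg _).trans (hB 0)
  have hφi : Integrable φ := hφ.integrable_of_hasCompactSupport (ftf_hcs φ c hcs)
  have hr : ∀ n : ℕ, (0:ℝ) < 2 ^ (k - (n:ℤ)) := fun n => by positivity
  have hr0 : Filter.Tendsto (fun n : ℕ => (2:ℝ) ^ (k - (n:ℤ))) Filter.atTop (nhds 0) := by
    have : (fun n : ℕ => (2:ℝ) ^ (k - (n:ℤ))) = fun n : ℕ => (2:ℝ) ^ k * (1 / 2) ^ n := by
      funext n
      rw [zpow_sub₀ (by norm_num), zpow_natCast]; simp [div_eq_mul_inv]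
    rw [this]
    simpa using (tendsto_pow_atTop_nhds_zero_of_lt_one (by norm_num) (by norm_num : (1/2:ℝ) < 1)).const_mul ((2:ℝ) ^ k)
  have hzc : ∀ r : ℝ, Continuous fun z : EE d => ∫ v, u (z - r • v) * φ v := by
    intro r
    refine continuous_of_dominated (bound := fun v => B * ‖φ v‖) (fun z => ?_) (fun z => ?_) (hφi.norm.const_mul B) ?_
    · exact ((hu.comp (by fun_prop)).mul hφ).aestronglyMeasurable
    · exact Filter.Eventually.of_forall fun v => by rw [norm_mul]; gcongr; exact hB _
    · exact Filter.Eventually.of_forall fun v => (hu.comp (by fun_prop)).mul continuous_const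
  unfold Fav
  simp_rw [cvK_change φ _ (hr _) u]
  refine tendsto_integral_of_dominated_convergence (fun _ => B * ∫ v, ‖φ v‖) (fun n => ?_) (integrable_const _) (fun n => ?_) ?_
  · exact ((hzc _).comp (by fun_prop)).aestronglyMeasurable
  · refine Filter.Eventually.of_forall fun y => ?_
    refine (norm_integral_le_integral_norm _).trans ?_
    rw [← integral_const_mul]
    refine integral_mono_of_nonneg (Filter.Eventually.of_forall fun v => norm_nonneg _) (hφi.norm.const_mul B) (Filter.Eventually.of_forall fun v => ?_)
    simp only [norm_mul]; gcongr; exact hB _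
  · refine Filter.Eventually.of_forall fun y => ?_
    have e : u (x - t • y) = ∫ v, u (x - t • y) * φ v := by rw [integral_const_mul, h1, mul_one]
    rw [e]
    refine tendsto_integral_of_dominated_convergence (fun v => B * ‖φ v‖) (fun n => ?_) (hφi.norm.const_mul B) (fun n => ?_) ?_
    · exact ((hu.comp (by fun_prop)).mul hφ).aestronglyMeasurable
    · exact Filter.Eventually.of_forall fun v => by rw [norm_mul]; gcongr; exact hB _
    · refine Filter.Eventually.of_forall fun v => ?_
      refine Filter.Tendsto.mul_const _ ?_
      have : Filter.Tendsto (fun n : ℕ => x - t • y - (2:ℝ) ^ (k - (n:ℤ)) • v) Filter.atTop (nhds (x - t • y - (0:ℝ) • v)) :=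
        tendsto_const_nhds.sub (hr0.smul_const v)
      rw [zero_smul, sub_zero] at this
      exact (hu.tendsto _).comp this

lemma BI_int (H : EE d → ℝ≥0∞) (hH : Measurable H) (hd : 1 ≤ d) (k : ℤ) (K : ℝ) (hK : 0 ≤ K) :
    ∫⁻ z, BI H (K * (2:ℝ) ^ k) z = (∫⁻ w, H w) * (ENNReal.ofReal (K ^ d) * volume (ball (0 : EE d) 1) * vk d k) := by
  simp_rw [BI_eq]
  rw [lintegral_lintegral_swap (f := fun z w => ({p : EE d × EE d | ‖p.1 - p.2‖ ≤ K * (2:ℝ) ^ k}.indicator (fun p => H p.2)) (z, w)) (BI_fun_meas H hH _).aemeasurable, ← lintegral_mul_const _ hH]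
  congr 1; funext w
  rw [← ball_vol w hd k K hK, ← lintegral_indicator_const isClosed_closedBall.measurableSet]
  congr 1

lemma O_vol (hd : 1 ≤ d) (F : EE d → ℝ≥0∞) (hF : Measurable F) (α : ℝ≥0∞) (h0 : α ≠ 0) (ht : α ≠ ⊤) (K : ℝ) (hK : 0 ≤ K) :
    volume {x | ∃ k, 1 ≤ Ust F α k K x} ≤ ENNReal.ofReal (K ^ d) * volume (ball (0 : EE d) 1) * (α⁻¹ * ∫⁻ x, F x) := by
  have hI : ∀ k', Measurable ((stp F α k').indicator fun _ => (1:ℝ≥0∞)) := fun k' => measurable_const.indicator (stp_meas F _ hF _)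
  have e : {x | ∃ k, 1 ≤ Ust F α k K x} = ⋃ k, {x | 1 ≤ Ust F α k K x} := by ext x; simp
  rw [e]
  calc _ ≤ ∑' k : ℤ, volume {x | 1 ≤ Ust F α k K x} := measure_iUnion_le _
    _ ≤ ∑' k : ℤ, ENNReal.ofReal (K ^ d) * volume (ball (0 : EE d) 1) * volume (stp F α k) := by
        refine ENNReal.tsum_le_tsum fun k => ?_
        have hm : Measurable fun x => (vk d k)⁻¹ * BI ((stp F α k).indicator fun _ => 1) (K * (2:ℝ) ^ k) x :=
          (BI_meas _ (hI k) _).const_mul _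
        simp_rw [Ust_BI F hF]
        have := mul_meas_ge_le_lintegral (μ := (volume : Measure (EE d))) hm 1
        rw [one_mul, lintegral_const_mul _ (BI_meas _ (hI k) _), BI_int _ (hI k) hd k K hK, lintegral_indicator (stp_meas F _ hF _), setLIntegral_one] at this
        refine this.trans (le_of_eq ?_)
        calc _ = ((vk d k)⁻¹ * vk d k) * (ENNReal.ofReal (K ^ d) * volume (ball (0 : EE d) 1) * volume (stp F α k)) := by ring
          _ = _ := by rw [ENNReal.inv_mul_cancel (vk_ne_zero _) (vk_ne_top _), one_mul]
    _ = ENNReal.ofReal (K ^ d) * volume (ball (0 : EE d) 1) * ∑' k : ℤ, volume (stp F α k) := ENNReal.tsum_mul_left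
    _ ≤ _ := by
        gcongr
        rw [mul_comm, ← div_eq_mul_inv, ENNReal.le_div_iff_mul_le (Or.inl h0) (Or.inl ht), mul_comm]
        exact stp_vol F α hF

include hR hμ in
lemma low_part (hd : 1 ≤ d) (φ : EE d → ℂ) (hφ : Continuous φ) (B c : ℝ) (hc : 0 ≤ c) (hB : ∀ x, ‖φ x‖ ≤ B) (hcs : ∀ x, c < ‖x‖ → φ x = 0)
    (f : EE d → ℝ) (hf : Continuous f) (hf0 : ∀ x, 0 ≤ f x) (hI : ∫⁻ x, Ff f x ≠ ⊤) (α : ℝ≥0∞) (h0 : α ≠ 0) (x : EE d)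
    (hx : ∀ k', Ust (Ff f) α k' (c + √d + 2 * R + √d) x < 1) (k : ℤ) (t : ℝ) (ht : t ∈ Icc ((2:ℝ) ^ k) (2 * (2:ℝ) ^ k)) :
    ‖Fav (cvK φ ((2:ℝ) ^ k) (fun x => (f x : ℂ))) μ t x‖ₑ ≤
      (ENNReal.ofReal B * (ENNReal.ofReal ((c + √d) ^ d) * volume (ball (0 : EE d) 1))) * α * μ univ := by
  have hFm := Ff_meas f hf
  have h2 : (0:ℝ) < 2 ^ k := by positivity
  unfold Fav
  refine (enorm_integral_le_lintegral_enorm _).trans ?_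
  rw [← lintegral_const]
  refine lintegral_mono_ae ?_
  filter_upwards [hμ] with y hy
  set z := x - t • y with hz
  unfold cvK
  refine (enorm_integral_le_lintegral_enorm _).trans ?_
  have hav : ∀ w ∈ univ, w ∈ closedBall z ((c + √d) * (2:ℝ) ^ k) → avx k (Ff f) w ≤ α := by
    intro w _ hw
    by_contra hcon
    obtain ⟨k', hk', hw'⟩ := stp_exists (Ff f) α hd hI h0 (not_le.1 hcon)
    refine absurd (Ust_ge (Ff f) α k' (c + √d + 2 * R) x w hw' ?_) (not_le.2 (hx k'))
    rw [mem_closedBall, dist_eq_norm] at *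
    have h3 : ‖w - x‖ ≤ ‖w - z‖ + ‖t • y‖ := by
      have : w - x = (w - z) - t • y := by rw [hz]; abel
      rw [this]; exact norm_sub_le _ _
    have h4 : ‖t • y‖ ≤ (2 * 2 ^ k) * R := by
      rw [norm_smul]
      apply mul_le_mul _ hy (norm_nonneg _) (by positivity)
      rw [Real.norm_of_nonneg (by linarith [ht.1])]
      exact ht.2
    have h5 : (2:ℝ) ^ k ≤ 2 ^ k' := zpow_le_zpow_right₀ (by norm_num) hk'
    have h6 : (c + √d + 2 * R) * 2 ^ k ≤ (c + √d + 2 * R) * 2 ^ k' := by gcongr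
    linarith
  have hb := ball_av hd (Ff f) hFm univ MeasurableSet.univ k (fun _ _ _ _ => mem_univ _) c hc z α hav
  rw [univ_inter] at hb
  calc _ ≤ ∫⁻ w, (ENNReal.ofReal B * (vk d k)⁻¹) * (closedBall z (c * (2:ℝ) ^ k)).indicator (Ff f) w := by
        refine lintegral_mono fun w => ?_
        by_cases hw : w ∈ closedBall z (c * (2:ℝ) ^ k)
        · rw [indicator_of_mem hw, enorm_mul, mul_comm]
          have hfe : ‖(f w : ℂ)‖ₑ = Ff f w := by
            rw [← ofReal_norm, Complex.norm_real, Real.norm_of_nonneg (hf0 w)]; rfl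
          rw [hfe]
          gcongr
          exact scl_enorm φ B hB k _
        · rw [scl_supp φ c hcs _ h2 (z - w), mul_zero, enorm_zero]
          · exact zero_le
          · rw [mem_closedBall, dist_comm, dist_eq_norm] at hw
            exact not_le.1 hw
    _ = (ENNReal.ofReal B * (vk d k)⁻¹) * ∫⁻ w in closedBall z (c * (2:ℝ) ^ k), Ff f w := by
        rw [lintegral_const_mul _ (hFm.indicator isClosed_closedBall.measurableSet), lintegral_indicator isClosed_closedBall.measurableSet]
    _ ≤ (ENNReal.ofReal B * (vk d k)⁻¹) * (α * (ENNReal.ofReal ((c + √d) ^ d) * volume (ball (0 : EE d) 1) * vk d k)) := by gcongr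
    _ = ((vk d k)⁻¹ * vk d k) * ((ENNReal.ofReal B * (ENNReal.ofReal ((c + √d) ^ d) * volume (ball (0 : EE d) 1))) * α) := by ring
    _ = _ := by rw [ENNReal.inv_mul_cancel (vk_ne_zero _) (vk_ne_top _), one_mul]

end perj2

section propA

lemma tsum_abs (g : ℕ → ℝ≥0∞) (J : ℕ) : ∑' j : ℕ, g ((j - J) + (J - j)) ≤ 2 * ∑' n, g n := by
  rw [← Summable.sum_add_tsum_nat_add' (k := J) ENNReal.summable, two_mul]
  refine add_le_add ?_ ?_
  · have h1 : ∑ j ∈ Finset.range J, g ((j - J) + (J - j)) = ∑ j ∈ Finset.range J, g (j + 1) := by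
      rw [← Finset.sum_range_reflect]
      refine Finset.sum_congr rfl fun j hj => ?_
      have := Finset.mem_range.1 hj
      congr 1; omega
    rw [h1]
    refine (ENNReal.sum_le_tsum _).trans ?_
    exact ENNReal.tsum_comp_le_tsum_of_injective (add_left_injective 1) g
  · refine le_of_eq ?_
    congr 1; funext j
    congr 1; omega

lemma num1 (x θ c l : ℝ) (hx : 2 < x) (hθ0 : 0 < θ) (h1 : 1 / 2 ≤ θ ^ 4) (h2 : 2 / x ≤ θ ^ 4) (hc : 0 < c)
    (J j : ℕ) (hl : (x ^ (J + 1))⁻¹ ≤ l) :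
    2 ^ j * (x ^ j)⁻¹ * (x ^ (J - j))⁻¹ / (c * θ ^ ((j - J) + (J - j)) * l) ^ 2 ≤
      ((c ^ 2)⁻¹ * x ^ 2) * (2 * x) ^ J * (θ ^ 2) ^ ((j - J) + (J - j)) := by
  have hx0 : 0 < x := by linarith
  have hl0 : 0 < l := lt_of_lt_of_le (by positivity) hl
  have hl2 : ((x ^ (J + 1))⁻¹) ^ 2 ≤ l ^ 2 := by gcongr
  rw [div_le_iff₀ (by positivity)]
  have key : 2 ^ j * (x ^ j)⁻¹ * (x ^ (J - j))⁻¹ ≤ 2 ^ J * (x ^ J)⁻¹ * (θ ^ 4) ^ ((j - J) + (J - j)) := by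
    rcases le_total j J with h | h
    · obtain ⟨n, rfl⟩ := Nat.exists_eq_add_of_le h
      have e1 : j - (j + n) + (j + n - j) = n := by omega
      have e2 : j + n - j = n := by omega
      rw [e1, e2]
      have h3 : 1 ≤ (2 * θ ^ 4) ^ n := one_le_pow₀ (by linarith)
      calc 2 ^ j * (x ^ j)⁻¹ * (x ^ n)⁻¹ = 2 ^ j * (x ^ j)⁻¹ * (x ^ n)⁻¹ * 1 := by ring
        _ ≤ 2 ^ j * (x ^ j)⁻¹ * (x ^ n)⁻¹ * (2 * θ ^ 4) ^ n := by gcongr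
        _ = _ := by rw [mul_pow 2, pow_add, pow_add, mul_inv]; ring
    · obtain ⟨n, rfl⟩ := Nat.exists_eq_add_of_le h
      have e1 : J + n - J + (J - (J + n)) = n := by omega
      have e2 : J - (J + n) = 0 := by omega
      rw [e1, e2]
      calc 2 ^ (J + n) * (x ^ (J + n))⁻¹ * (x ^ 0)⁻¹ = 2 ^ J * (x ^ J)⁻¹ * (2 / x) ^ n := by
            rw [pow_add, pow_add, mul_inv, div_pow, div_eq_mul_inv]; ring
        _ ≤ _ := by gcongr
  refine key.trans ?_
  set n := (j - J) + (J - j)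
  calc 2 ^ J * (x ^ J)⁻¹ * (θ ^ 4) ^ n = ((c ^ 2)⁻¹ * x ^ 2) * (2 * x) ^ J * (θ ^ 2) ^ n * ((c ^ 2) * (θ ^ n) ^ 2 * ((x ^ (J + 1))⁻¹) ^ 2) := by
        have e : (θ ^ 4) ^ n = (θ ^ 2) ^ n * (θ ^ n) ^ 2 := by rw [← pow_mul, ← pow_mul, ← pow_mul, ← pow_add]; congr 1; ring
        rw [e, mul_pow 2 x, pow_succ x]
        field_simp
        ring
    _ ≤ ((c ^ 2)⁻¹ * x ^ 2) * (2 * x) ^ J * (θ ^ 2) ^ n * ((c ^ 2) * (θ ^ n) ^ 2 * l ^ 2) := by gcongr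
    _ = _ := by ring

lemma num2 (x θ c l : ℝ) (hx : 2 < x) (hθ0 : 0 < θ) (hθ1 : θ ≤ 1) (h1 : 1 / 2 ≤ θ ^ 4) (hc : 0 < c)
    (J j : ℕ) (hl : (x ^ (J + 1))⁻¹ ≤ l) :
    2 ^ j * ((J - j : ℕ) : ℝ) / (c * θ ^ ((j - J) + (J - j)) * l) ≤
      (c⁻¹ * x) * (2 * x) ^ J * ((((j - J) + (J - j) : ℕ) : ℝ) * (θ ^ 2) ^ ((j - J) + (J - j))) := by
  have hx0 : 0 < x := by linarith
  have hl0 : 0 < l := lt_of_lt_of_le (by positivity) hl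
  rw [div_le_iff₀ (by positivity)]
  rcases le_total j J with h | h
  · obtain ⟨n, rfl⟩ := Nat.exists_eq_add_of_le h
    have e1 : j - (j + n) + (j + n - j) = n := by omega
    have e2 : j + n - j = n := by omega
    rw [e1, e2]
    have h3 : 1 ≤ (2 * θ ^ 3) ^ n := by
      apply one_le_pow₀
      have : θ ^ 4 ≤ θ ^ 3 := pow_le_pow_of_le_one hθ0.le hθ1 (by norm_num)
      linarith
    calc (2:ℝ) ^ j * n = 2 ^ j * n * 1 := by ring
      _ ≤ 2 ^ j * n * (2 * θ ^ 3) ^ n := by gcongr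
      _ = (c⁻¹ * x) * (2 * x) ^ (j + n) * (n * (θ ^ 2) ^ n) * (c * θ ^ n * (x ^ (j + n + 1))⁻¹) := by
        have e : (2 * θ ^ 3) ^ n = 2 ^ n * ((θ ^ 2) ^ n * θ ^ n) := by rw [mul_pow, ← pow_mul, ← pow_mul, ← pow_add]; congr 2; ring
        rw [e, mul_pow 2 x, pow_succ x, pow_add 2]
        field_simp
      _ ≤ _ := by gcongr
  · have e2 : J - j = 0 := by omega
    rw [e2]
    simp only [Nat.cast_zero, mul_zero]
    positivity

variable (μ : Measure (EE d)) [IsFiniteMeasure μ] (R : ℝ) (hR : 0 ≤ R) (hμ : ∀ᵐ y ∂μ, ‖y‖ ≤ R)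

lemma tel_bound (φ : EE d → ℂ) (hφ : ContDiff ℝ (⊤ : ℕ∞) φ) (c : ℝ) (hc : 0 ≤ c) (hcs : ∀ x, c < ‖x‖ → φ x = 0) (h1 : ∫ x, φ x = 1)
    (u : EE d → ℂ) (hu : Continuous u) (ρ : ℝ) (hρ : ∀ x, ρ < ‖x‖ → u x = 0) (k : ℤ) (t : ℝ) (x : EE d)
    (L0 : ℝ≥0∞) (T : ℕ → ℝ≥0∞) (hlow : ‖Fav (cvK φ ((2:ℝ) ^ k) u) μ t x‖ₑ ≤ L0)
    (hT : ∀ j : ℕ, ‖Fav (cvK (psiK φ) ((2:ℝ) ^ (k - (j:ℤ))) u) μ t x‖ₑ ≤ T j) :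
    ‖Fav u μ t x‖ₑ ≤ L0 + ∑' j, T j := by
  have hui : Integrable u := hu.integrable_of_hasCompactSupport (ftf_hcs u ρ hρ)
  have hlim := (Fav_lim μ φ hφ.continuous c hcs h1 u hu ρ hρ k t x).enorm
  refine le_of_tendsto hlim (Filter.Eventually.of_forall fun n => ?_)
  have hψc := psiK_contDiff φ hφ
  have hψs := psiK_supp φ c hc hcs
  have i1 := Fav_intg μ _ (cvK_contDiff φ hφ c hcs ((2:ℝ) ^ k) (by positivity) _ hui).continuous _ (cvK_supp φ c hcs _ (by positivity) _ ρ hρ) t x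
  have i2 : ∀ j : ℕ, Integrable (fun y => cvK (psiK φ) ((2:ℝ) ^ (k - (j:ℤ))) u (x - t • y)) μ := fun j =>
    Fav_intg μ _ (cvK_contDiff _ hψc (2 * c) hψs _ (by positivity) _ hui).continuous _ (cvK_supp _ (2 * c) hψs _ (by positivity) _ ρ hρ) t x
  have e : Fav (cvK φ ((2:ℝ) ^ (k - (n:ℤ))) u) μ t x = Fav (cvK φ ((2:ℝ) ^ k) u) μ t x +
      ∑ j ∈ Finset.range n, Fav (cvK (psiK φ) ((2:ℝ) ^ (k - ((j + 1 : ℕ) : ℤ))) u) μ t x := by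
    unfold Fav
    rw [← integral_finsetSum _ fun j _ => i2 (j + 1), ← integral_add i1 (integrable_finsetSum _ fun j _ => i2 (j + 1))]
    congr 1; funext y
    exact cvK_tel φ hφ.continuous c hcs u hui k n _
  rw [e]
  refine (enorm_add_le _ _).trans (add_le_add hlow ?_)
  refine (enorm_sum_le _ _).trans ?_
  calc _ ≤ ∑ j ∈ Finset.range n, T (j + 1) := Finset.sum_le_sum fun j _ => hT (j + 1)
    _ ≤ ∑' j, T (j + 1) := ENNReal.sum_le_tsum _
    _ ≤ _ := ENNReal.tsum_comp_le_tsum_of_injective (add_left_injective 1) T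

end propA

section propA2
variable (μ : Measure (EE d)) [IsFiniteMeasure μ] (R : ℝ) (hR : 0 ≤ R) (hμ : ∀ᵐ y ∂μ, ‖y‖ ≤ R)

include hR hμ in
theorem pre (hd : 1 ≤ d) (a C : ℝ) (ha : 1 / 2 < a) (hC : 0 ≤ C) (hdec : ∀ ξ : EE d, ξ ≠ 0 → ‖mV μ ξ‖ ≤ C * ‖ξ‖ ^ (-a))
    (x : ℝ) (hx : x = (2:ℝ) ^ (2 * a)) (hx2 : 2 < x) :
    ∃ Ca : ℝ≥0∞, Ca ≠ ⊤ ∧ ∀ f : EE d → ℝ, Continuous f → (∀ z, 0 ≤ f z) → (∀ z, f z ≤ 1) →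
      ∀ ρ : ℝ, (∀ z, ρ < ‖z‖ → f z = 0) → ∀ l : ℝ, 0 < l → ∀ J : ℕ,
      ∃ (O : ℕ → Set (EE d)) (O' : Set (EE d)) (Bd SL : ℕ → EE d → ℝ≥0∞), (∀ j, Measurable (Bd j)) ∧ (∀ j, Measurable (SL j)) ∧
        (∀ j, ∫⁻ z, Bd j z ≤ Ca * ENNReal.ofReal (2 ^ j * (x ^ j)⁻¹ * (x ^ (J - j))⁻¹) * ∫⁻ z, Ff f z) ∧
        (∀ j, ∫⁻ z, SL j z ≤ Ca * ENNReal.ofReal (2 ^ j * ((J - j : ℕ) : ℝ)) * ∫⁻ z, Ff f z) ∧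
        (∀ i, volume (O i) ≤ Ca * ENNReal.ofReal (x ^ (J - i)) * ∫⁻ z, Ff f z) ∧
        volume O' ≤ Ca * ENNReal.ofReal l⁻¹ * ∫⁻ z, Ff f z ∧
        ∀ z, (∀ i < J, z ∉ O i) → z ∉ O' → ∀ lj : ℕ → ℝ≥0∞, (∀ j, Bd j z ≤ lj j ^ 2) → (∀ j, SL j z ≤ lj j) →
          ∀ t : ℝ, 0 < t → ‖Fav (fun z => (f z : ℂ)) μ t z‖ₑ ≤ ENNReal.ofReal (l / 2) + ∑' j, 2 * lj j := by
  have hx0 : 0 < x := by linarith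
  set N := ⌈a + 1 / 2⌉₊ with hN
  have hN' : a + 1 / 2 ≤ N := Nat.le_ceil _
  have hN1 : N ≠ 0 := by
    intro h
    rw [h] at hN'; norm_num at hN'; linarith
  obtain ⟨φ, hφ, hφs, Cφ, hCφ, hφF⟩ := kern_exists (V := EE d) N
  have hφ1 : ∫ z, φ z = 1 := by
    have := hφF 0
    rw [norm_zero, zero_pow hN1, mul_zero, norm_le_zero_iff, sub_eq_zero] at this
    rw [this, Real.fourier_eq']
    simp
  obtain ⟨c, hc, hcs⟩ : ∃ c : ℝ, 0 ≤ c ∧ ∀ z, c < ‖z‖ → φ z = 0 := by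
    obtain ⟨c, hc⟩ := hφs.isBounded.subset_closedBall (0 : EE d)
    refine ⟨max c 0, le_max_right _ _, fun z hz => ?_⟩
    by_contra h
    have h1 := hc (subset_tsupport φ h)
    rw [mem_closedBall_zero_iff] at h1
    exact absurd (le_max_left c 0) (by linarith)
  have hψ := psiK_contDiff φ hφ
  have hψs := psiK_supp φ c hc hcs
  have hψcs : HasCompactSupport (psiK φ) := ftf_hcs _ _ hψs
  obtain ⟨C3, hC3, hC3'⟩ := psiK_fourier φ hφ hφs N Cφ hφF hCφ
  obtain ⟨Bφ, hBφ⟩ := hφ.continuous.bounded_above_of_compact_support hφs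
  obtain ⟨Bψ, hBψ⟩ := hψ.continuous.bounded_above_of_compact_support hψcs
  obtain ⟨L, hL⟩ := ContDiff.lipschitzWith_of_hasCompactSupport hψcs hψ (by simp)
  obtain ⟨Cc, hCc, hL2⟩ := L2max μ R hμ a C ha hC hdec N hN' (psiK φ) hψ (2 * c) hψs C3 hC3 hC3'
  obtain ⟨Cq, hCq, hpj⟩ := perj μ R hR hμ hd (ENNReal.ofReal x) (by rw [ENNReal.one_le_ofReal]; linarith) (by simp) (psiK φ) hψ Bψ L (2 * c)
    (by positivity) L.2 hBψ (fun u v => hL.norm_sub_le u v) hψs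
  set K1 := 2 * c + √d + √d + R + √d with hK1
  set K2 := c + √d + 2 * R + √d with hK2
  have hK1p : 0 ≤ K1 := by positivity
  have hK2p : 0 ≤ K2 := by positivity
  set Kl := ENNReal.ofReal Bφ * (ENNReal.ofReal ((c + √d) ^ d) * volume (ball (0 : EE d) 1)) * μ univ with hKl
  have hKlt : Kl ≠ ⊤ := ENNReal.mul_ne_top (ENNReal.mul_ne_top (by simp) (ENNReal.mul_ne_top (by simp) measure_ball_lt_top.ne)) (measure_ne_top _ _)
  set M := Kl.toReal with hM
  have hM0 : 0 ≤ M := ENNReal.toReal_nonneg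
  set V1 := ENNReal.ofReal (K1 ^ d) * volume (ball (0 : EE d) 1) with hV1
  set V2 := ENNReal.ofReal (K2 ^ d) * volume (ball (0 : EE d) 1) with hV2
  have hV1t : V1 ≠ ⊤ := ENNReal.mul_ne_top (by simp) measure_ball_lt_top.ne
  have hV2t : V2 ≠ ⊤ := ENNReal.mul_ne_top (by simp) measure_ball_lt_top.ne
  set D2 := V2 * ENNReal.ofReal (2 * (M + 1)) with hD2
  have hD2t : D2 ≠ ⊤ := ENNReal.mul_ne_top hV2t ENNReal.ofReal_ne_top
  refine ⟨Cc * 2 ^ d + Cq + V1 + D2, ?_, ?_⟩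
  · have : Cc * 2 ^ d ≠ ⊤ := ENNReal.mul_ne_top hCc (by simp)
    simp [this, hCq, hV1t, hD2t]
  intro f hf hf0 hf1 ρ hρ l hl J
  have hFm := Ff_meas f hf
  have hI := Ff_int f hf hf0 ρ hρ
  set I := ∫⁻ z, Ff f z with hIdef
  set al : ℕ → ℝ≥0∞ := fun i => ENNReal.ofReal ((x ^ (J - i))⁻¹) with hal
  have hal0 : ∀ i, al i ≠ 0 := fun i => by
    simp only [hal, ne_eq, ENNReal.ofReal_eq_zero, not_le]; positivity
  have halt : ∀ i, al i ≠ ⊤ := fun i => by simp [hal]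
  have halX : ∀ i, al (i + 1) ≤ ENNReal.ofReal x * al i := by
    intro i
    simp only [hal]
    rw [← ENNReal.ofReal_mul hx0.le]
    apply ENNReal.ofReal_le_ofReal
    rcases Nat.lt_or_ge i J with h | h
    · have e : J - i = (J - (i + 1)) + 1 := by omega
      rw [e, pow_succ, mul_inv]
      apply le_of_eq; field_simp
    · have e : J - i = 0 := by omega
      have e' : J - (i + 1) = 0 := by omega
      rw [e, e']; simp; linarith
  have halJ : ∀ i, J ≤ i → al i = 1 := by
    intro i hi
    have e : J - i = 0 := by omega
    simp [hal, e]
  choose SL hSLm hSLi hSLx using hpj f hf hf0 hf1 ρ hρ al J hal0 halt halX halJ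
  have hB' : ∀ j : ℕ, ∃ Bd : EE d → ℝ≥0∞, Measurable Bd ∧
        (∀ k : ℤ, ∀ t ∈ Icc ((2:ℝ) ^ k) (2 * (2:ℝ) ^ k), ∀ z,
          ‖Fav (cvK (psiK φ) ((2:ℝ) ^ (k - (j:ℤ))) (uG f (al j))) μ t z‖ₑ ^ 2 ≤ Bd z) ∧
        ∫⁻ z, Bd z ≤ Cc * ENNReal.ofReal ((2:ℝ) ^ j * (((2:ℝ) ^ j) ^ (-a)) ^ 2) * ∫⁻ z, ‖uG f (al j) z‖ₑ ^ 2 := by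
    intro j
    obtain ⟨ρ', hρ'⟩ := gst_supp (Ff f) (al j) hd hI (hal0 j) ρ (fun z hz => by simp [Ff, hρ z hz])
    exact hL2 (uG f (al j)) (uG_int f hf hf0 _ hd hI (hal0 j) (halt j)) (uG_memLp f hf hf0 _ hd hI (hal0 j) (halt j)) ρ'
      (fun z hz => by simp [uG, hρ' z hz]) j
  choose Bd hBdm hBdx hBdi using hB'
  set al' : ℝ≥0∞ := ENNReal.ofReal (l / (2 * (M + 1))) with hal'
  have hal'0 : al' ≠ 0 := by simp only [hal', ne_eq, ENNReal.ofReal_eq_zero, not_le]; positivity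
  refine ⟨fun i => {z | ∃ k, 1 ≤ Ust (Ff f) (al i) k K1 z}, {z | ∃ k, 1 ≤ Ust (Ff f) al' k K2 z}, Bd, SL, hBdm, hSLm, ?_, ?_, ?_, ?_, ?_⟩
  · intro j
    refine (hBdi j).trans ?_
    have e : ((((2:ℝ) ^ j) ^ (-a)) ^ 2) = (x ^ j)⁻¹ := by
      rw [hx, ← Real.rpow_natCast 2 j, ← Real.rpow_mul (by norm_num), ← Real.rpow_natCast, ← Real.rpow_mul (by norm_num),
        ← Real.rpow_natCast, ← Real.rpow_mul (by norm_num), ← Real.rpow_neg (by norm_num)]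
      congr 1; push_cast; ring
    rw [e]
    calc _ ≤ Cc * ENNReal.ofReal (2 ^ j * (x ^ j)⁻¹) * (2 ^ d * al j * I) :=
          mul_le_mul le_rfl (uG_sq f hf hf0 _ hd hI (hal0 j) (halt j)) (zero_le) (zero_le)
      _ = (Cc * 2 ^ d) * ENNReal.ofReal (2 ^ j * (x ^ j)⁻¹ * (x ^ (J - j))⁻¹) * I := by
          rw [ENNReal.ofReal_mul (p := 2 ^ j * (x ^ j)⁻¹) (by positivity)]; simp only [hal]; ring
      _ ≤ _ := by
          refine mul_le_mul (mul_le_mul ?_ le_rfl (zero_le) (zero_le)) le_rfl (zero_le) (zero_le)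
          rw [add_assoc, add_assoc]; exact le_self_add
  · intro j
    refine (hSLi j).trans ?_
    rw [ENNReal.ofReal_mul (by positivity), ENNReal.ofReal_natCast, ENNReal.ofReal_pow (by norm_num), ENNReal.ofReal_ofNat, ← mul_assoc]
    refine mul_le_mul (mul_le_mul (mul_le_mul ?_ le_rfl (zero_le) (zero_le)) le_rfl (zero_le) (zero_le)) le_rfl (zero_le) (zero_le)
    rw [add_assoc, add_assoc, add_left_comm]; exact le_self_add
  · intro i
    refine (O_vol hd (Ff f) hFm (al i) (hal0 i) (halt i) K1 hK1p).trans ?_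
    have e : (al i)⁻¹ = ENNReal.ofReal (x ^ (J - i)) := by
      simp only [hal]
      rw [ENNReal.ofReal_inv_of_pos (by positivity), inv_inv]
    rw [e, ← mul_assoc]
    refine mul_le_mul (mul_le_mul ?_ le_rfl (zero_le) (zero_le)) le_rfl (zero_le) (zero_le)
    rw [add_right_comm]; exact le_add_self
  · refine (O_vol hd (Ff f) hFm al' hal'0 (by simp [hal']) K2 hK2p).trans ?_
    have e : al'⁻¹ = ENNReal.ofReal (2 * (M + 1)) * ENNReal.ofReal l⁻¹ := by
      rw [hal', ← ENNReal.ofReal_inv_of_pos (by positivity), ← ENNReal.ofReal_mul (by positivity)]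
      congr 1; rw [inv_div]; rfl
    rw [e, ← mul_assoc, ← mul_assoc]
    refine mul_le_mul (mul_le_mul ?_ le_rfl (zero_le) (zero_le)) le_rfl (zero_le) (zero_le)
    exact le_add_self
  · intro z hO hO' lj hBl hSl t ht
    simp only [mem_ofPred_eq, not_exists, not_le] at hO hO'
    obtain ⟨k, hk⟩ := exists_mem_Ico_zpow ht one_lt_two
    have ht' : t ∈ Icc ((2:ℝ) ^ k) (2 * (2:ℝ) ^ k) := ⟨hk.1, by
      have := hk.2.le; rw [zpow_add_one₀ (by norm_num)] at this; linarith⟩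
    refine tel_bound μ φ hφ c hc hcs hφ1 (fun z => (f z : ℂ)) (Complex.continuous_ofReal.comp hf) ρ (fun z hz => by simp [hρ z hz]) k t z _ _ ?_ ?_
    · refine (low_part μ R hR hμ hd φ hφ.continuous Bφ c hc hBφ hcs f hf hf0 hI al' hal'0 z hO' k t ht').trans ?_
      rw [mul_right_comm, ← hKl, ← ENNReal.ofReal_toReal hKlt, ← hM, hal', ← ENNReal.ofReal_mul hM0]
      apply ENNReal.ofReal_le_ofReal
      rw [mul_div_assoc', div_le_div_iff₀ (by positivity) (by norm_num)]
      nlinarith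
    · intro j
      refine (hSLx j z hO k t ht').trans ?_
      rw [two_mul]
      refine add_le_add ?_ (hSl j)
      have := (hBdx j k t ht' z).trans (hBl j)
      exact (ENNReal.pow_le_pow_left_iff (by norm_num)).1 this

include hR hμ in
theorem propA (hd : 1 ≤ d) (a C : ℝ) (ha : 1 / 2 < a) (hC : 0 ≤ C) (hdec : ∀ ξ : EE d, ξ ≠ 0 → ‖mV μ ξ‖ ≤ C * ‖ξ‖ ^ (-a)) :
    ∃ Cf : ℝ≥0∞, Cf ≠ ⊤ ∧ ∀ f : EE d → ℝ, Continuous f → (∀ z, 0 ≤ f z) → (∀ z, f z ≤ 1) →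
      ∀ ρ : ℝ, (∀ z, ρ < ‖z‖ → f z = 0) → ∀ l : ℝ, 0 < l → l ≤ 1 →
      volume {z | ∃ t : ℝ, 0 < t ∧ ENNReal.ofReal l < ‖Fav (fun z => (f z : ℂ)) μ t z‖ₑ} ≤
        Cf * ENNReal.ofReal (l ^ (-((2 * a + 1) / (2 * a)))) * ∫⁻ z, Ff f z := by
  set x : ℝ := (2:ℝ) ^ (2 * a) with hx
  have hx2 : 2 < x := by
    calc (2:ℝ) = 2 ^ (1:ℝ) := by simp
      _ < x := Real.rpow_lt_rpow_of_exponent_lt (by norm_num) (by linarith)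
  have hx0 : 0 < x := by linarith
  obtain ⟨Ca, hCa, hpre⟩ := pre μ R hR hμ hd a C ha hC hdec x hx hx2
  set m := max (2 / x) (1 / 2) with hm
  have hm0 : 0 < m := lt_max_of_lt_right (by norm_num)
  have hm1 : m < 1 := max_lt (by rw [div_lt_one hx0]; exact hx2) (by norm_num)
  set θ := m ^ (1 / 4 : ℝ) with hθ
  have hθ0 : 0 < θ := Real.rpow_pos_of_pos hm0 _
  have hθ1 : θ < 1 := Real.rpow_lt_one hm0.le hm1 (by norm_num)
  have hθ4 : θ ^ 4 = m := by
    rw [hθ, ← Real.rpow_natCast, ← Real.rpow_mul hm0.le]; norm_num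
  have h1 : 1 / 2 ≤ θ ^ 4 := by rw [hθ4]; exact le_max_right _ _
  have h2 : 2 / x ≤ θ ^ 4 := by rw [hθ4]; exact le_max_left _ _
  have hθ2 : θ ^ 2 < 1 := by nlinarith
  have hθ24 : θ ^ 4 ≤ θ ^ 2 := pow_le_pow_of_le_one hθ0.le hθ1.le (by norm_num)
  set c := (1 - θ) / 8 with hc
  have hc0 : 0 < c := by rw [hc]; linarith
  set S1 := ∑' n : ℕ, ENNReal.ofReal ((θ ^ 2) ^ n) with hS1
  set S2 := ∑' n : ℕ, ENNReal.ofReal ((n : ℝ) * (θ ^ 2) ^ n) with hS2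
  have hS1t : S1 ≠ ⊤ := (summable_geometric_of_lt_one (by positivity) hθ2).tsum_ofReal_ne_top
  have hS2t : S2 ≠ ⊤ := by
    have : Summable fun n : ℕ => (n : ℝ) * (θ ^ 2) ^ n := by
      have := summable_pow_mul_geometric_of_norm_lt_one 1 (r := θ ^ 2) (by rw [Real.norm_of_nonneg (by positivity)]; exact hθ2)
      simpa using this
    exact this.tsum_ofReal_ne_top
  set A1 := ENNReal.ofReal ((c ^ 2)⁻¹ * x ^ 2) with hA1
  set A2 := ENNReal.ofReal (c⁻¹ * x) with hA2
  refine ⟨Ca * (S1 + ENNReal.ofReal x + A1 * (2 * S1) + A2 * (2 * S2)), ?_, ?_⟩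
  · refine ENNReal.mul_ne_top hCa ?_
    have q1 : A1 * (2 * S1) ≠ ⊤ := ENNReal.mul_ne_top (by simp [hA1]) (ENNReal.mul_ne_top (by simp) hS1t)
    have q2 : A2 * (2 * S2) ≠ ⊤ := ENNReal.mul_ne_top (by simp [hA2]) (ENNReal.mul_ne_top (by simp) hS2t)
    simp [q1, q2, hS1t]
  intro f hf hf0 hf1 ρ hρ l hl hl1
  obtain ⟨J, hJ1, hJ2⟩ := exists_nat_pow_near (x := l⁻¹) (y := x) (one_le_inv_iff₀.2 ⟨hl, hl1⟩) (by linarith)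
  have hlJ : (x ^ (J + 1))⁻¹ ≤ l := by rw [inv_le_comm₀ (by positivity) hl]; exact hJ2.le
  obtain ⟨O, O', Bd, SL, hBdm, hSLm, hBdi, hSLi, hO, hO', hmain⟩ := hpre f hf hf0 hf1 ρ hρ l hl J
  set I := ∫⁻ z, Ff f z with hI
  set P := ENNReal.ofReal ((2 * x) ^ J) with hP
  have hPl : P ≤ ENNReal.ofReal (l ^ (-((2 * a + 1) / (2 * a)))) := by
    apply ENNReal.ofReal_le_ofReal
    have e : 2 * x = x ^ ((2 * a + 1) / (2 * a)) := by
      rw [hx, ← Real.rpow_mul (by norm_num), mul_div_cancel₀ _ (by linarith), Real.rpow_add (by norm_num), Real.rpow_one, mul_comm]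
    rw [e, ← Real.rpow_natCast, ← Real.rpow_mul hx0.le, mul_comm, Real.rpow_mul hx0.le, Real.rpow_natCast, Real.rpow_neg hl.le, ← Real.inv_rpow hl.le]
    apply Real.rpow_le_rpow (by positivity) hJ1 (by positivity)
  set lr : ℕ → ℝ := fun j => c * θ ^ ((j - J) + (J - j)) * l with hlr
  have hlr0 : ∀ j, 0 < lr j := fun j => by simp only [hlr]; positivity
  set lj : ℕ → ℝ≥0∞ := fun j => ENNReal.ofReal (lr j) with hlj
  have hlj0 : ∀ j, lj j ≠ 0 := fun j => by simp only [hlj, ne_eq, ENNReal.ofReal_eq_zero, not_le]; exact hlr0 j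
  have hljt : ∀ j, lj j ≠ ⊤ := fun j => by simp [hlj]
  have hsum : ∑' j, 2 * lj j ≤ ENNReal.ofReal (l / 2) := by
    have q := tsum_abs (fun n => ENNReal.ofReal (c * θ ^ n * l)) J
    have q2 : ∑' n : ℕ, ENNReal.ofReal (c * θ ^ n * l) = ENNReal.ofReal (l / 8) := by
      have hs : HasSum (fun n : ℕ => c * θ ^ n * l) (c * (1 - θ)⁻¹ * l) :=
        ((hasSum_geometric_of_lt_one hθ0.le hθ1).mul_left c).mul_right l
      rw [← ENNReal.ofReal_tsum_of_nonneg (fun n => by positivity) hs.summable, hs.tsum_eq]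
      congr 1
      have : 1 - θ ≠ 0 := by linarith
      rw [hc]; field_simp
    rw [ENNReal.tsum_mul_left]
    calc 2 * ∑' j, lj j ≤ 2 * (2 * ENNReal.ofReal (l / 8)) := by rw [← q2]; exact mul_le_mul le_rfl q (zero_le) (zero_le)
      _ = ENNReal.ofReal (l / 2) := by
        rw [← ENNReal.ofReal_ofNat 2, ← ENNReal.ofReal_mul (by norm_num), ← ENNReal.ofReal_mul (by norm_num)]
        congr 1; ring
  have hsub : {z | ∃ t : ℝ, 0 < t ∧ ENNReal.ofReal l < ‖Fav (fun z => (f z : ℂ)) μ t z‖ₑ} ⊆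
      (⋃ i, (if i < J then O i else ∅)) ∪ O' ∪ (⋃ j, {z | lj j ^ 2 ≤ Bd j z}) ∪ (⋃ j, {z | lj j ≤ SL j z}) := by
    rintro z ⟨t, ht, hlt⟩
    by_contra hcon
    simp only [mem_union, mem_iUnion, mem_ofPred_eq, not_or, not_exists, not_le] at hcon
    obtain ⟨⟨⟨b1, b2⟩, b3⟩, b4⟩ := hcon
    have b1' : ∀ i < J, z ∉ O i := fun i hi => by have := b1 i; rwa [if_pos hi] at this
    have := (hmain z b1' b2 lj (fun j => (b3 j).le) (fun j => (b4 j).le) t ht).trans (add_le_add le_rfl hsum)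
    rw [← ENNReal.ofReal_add (by positivity) (by positivity), add_halves] at this
    exact absurd hlt (not_lt.2 this)
  have e1 : volume (⋃ i, (if i < J then O i else ∅)) ≤ Ca * S1 * P * I := by
    refine (measure_iUnion_le _).trans ?_
    calc _ ≤ ∑' i : ℕ, Ca * P * I * ENNReal.ofReal ((θ ^ 2) ^ i) := by
          refine ENNReal.tsum_le_tsum fun i => ?_
          split_ifs with h
          · refine (hO i).trans ?_
            have : ENNReal.ofReal (x ^ (J - i)) ≤ P * ENNReal.ofReal ((θ ^ 2) ^ i) := by
              rw [hP, ← ENNReal.ofReal_mul (by positivity)]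
              apply ENNReal.ofReal_le_ofReal
              obtain ⟨n, rfl⟩ := Nat.exists_eq_add_of_le h.le
              have e2 : i + n - i = n := by omega
              rw [e2]
              have hxt : 1 ≤ x * θ ^ 2 := by
                have : 2 ≤ x * θ ^ 4 := by rw [div_le_iff₀ hx0] at h2; linarith
                nlinarith
              calc x ^ n = 1 * 1 * x ^ n := by ring
                _ ≤ 2 ^ (i + n) * (x * θ ^ 2) ^ i * x ^ n := by
                    gcongr
                    · exact one_le_pow₀ (by norm_num)
                    · exact one_le_pow₀ hxt
                _ = _ := by rw [mul_pow, mul_pow, pow_add x]; ring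
            calc _ ≤ Ca * (P * ENNReal.ofReal ((θ ^ 2) ^ i)) * I := mul_le_mul (mul_le_mul le_rfl this (zero_le) (zero_le)) le_rfl (zero_le) (zero_le)
              _ = _ := by ring
          · simp
      _ = _ := by rw [ENNReal.tsum_mul_left]; ring
  have e2 : volume O' ≤ Ca * ENNReal.ofReal x * P * I := by
    refine hO'.trans ?_
    rw [mul_assoc Ca (ENNReal.ofReal x)]
    refine mul_le_mul (mul_le_mul le_rfl ?_ (zero_le) (zero_le)) le_rfl (zero_le) (zero_le)
    rw [hP, ← ENNReal.ofReal_mul hx0.le]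
    apply ENNReal.ofReal_le_ofReal
    refine hJ2.le.trans ?_
    rw [pow_succ, mul_comm x]
    gcongr
    linarith
  have e3 : volume (⋃ j, {z | lj j ^ 2 ≤ Bd j z}) ≤ Ca * (A1 * (2 * S1)) * P * I := by
    refine (measure_iUnion_le _).trans ?_
    calc _ ≤ ∑' j : ℕ, Ca * A1 * P * I * ENNReal.ofReal ((θ ^ 2) ^ ((j - J) + (J - j))) := by
          refine ENNReal.tsum_le_tsum fun j => ?_
          refine (meas_ge_le_lintegral_div (hBdm j).aemeasurable (pow_ne_zero 2 (hlj0 j)) (ENNReal.pow_ne_top (hljt j))).trans ?_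
          refine (ENNReal.div_le_div_right (hBdi j) _).trans ?_
          have q := num1 x θ c l hx2 hθ0 h1 h2 hc0 J j hlJ
          have q' := ENNReal.ofReal_le_ofReal q
          rw [ENNReal.ofReal_div_of_pos (by have := hlr0 j; positivity), ENNReal.ofReal_pow (hlr0 j).le, ENNReal.ofReal_mul (p := (c ^ 2)⁻¹ * x ^ 2 * (2 * x) ^ J) (by positivity),
            ENNReal.ofReal_mul (p := (c ^ 2)⁻¹ * x ^ 2) (by positivity)] at q'
          calc _ = Ca * I * (ENNReal.ofReal (2 ^ j * (x ^ j)⁻¹ * (x ^ (J - j))⁻¹) / ENNReal.ofReal (lr j) ^ 2) := by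
                simp only [hlj, div_eq_mul_inv]; ring
            _ ≤ Ca * I * _ := mul_le_mul le_rfl q' (zero_le) (zero_le)
            _ = _ := by rw [hA1, hP]; ring
      _ ≤ Ca * A1 * P * I * (2 * S1) := by
          rw [ENNReal.tsum_mul_left]
          exact mul_le_mul le_rfl (tsum_abs (fun n => ENNReal.ofReal ((θ ^ 2) ^ n)) J) (zero_le) (zero_le)
      _ = _ := by ring
  have e4 : volume (⋃ j, {z | lj j ≤ SL j z}) ≤ Ca * (A2 * (2 * S2)) * P * I := by
    refine (measure_iUnion_le _).trans ?_
    calc _ ≤ ∑' j : ℕ, Ca * A2 * P * I * ENNReal.ofReal ((((j - J) + (J - j) : ℕ) : ℝ) * (θ ^ 2) ^ ((j - J) + (J - j))) := by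
          refine ENNReal.tsum_le_tsum fun j => ?_
          refine (meas_ge_le_lintegral_div (hSLm j).aemeasurable (hlj0 j) (hljt j)).trans ?_
          refine (ENNReal.div_le_div_right (hSLi j) _).trans ?_
          have q := num2 x θ c l hx2 hθ0 hθ1.le h1 hc0 J j hlJ
          have q' := ENNReal.ofReal_le_ofReal q
          rw [ENNReal.ofReal_div_of_pos (hlr0 j), ENNReal.ofReal_mul (p := c⁻¹ * x * (2 * x) ^ J) (by positivity),
            ENNReal.ofReal_mul (p := c⁻¹ * x) (by positivity)] at q'
          calc _ = Ca * I * (ENNReal.ofReal (2 ^ j * ((J - j : ℕ) : ℝ)) / ENNReal.ofReal (lr j)) := by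
                simp only [hlj, div_eq_mul_inv]; ring
            _ ≤ Ca * I * _ := mul_le_mul le_rfl q' (zero_le) (zero_le)
            _ = _ := by rw [hA2, hP]; ring
      _ ≤ Ca * A2 * P * I * (2 * S2) := by
          rw [ENNReal.tsum_mul_left]
          exact mul_le_mul le_rfl (tsum_abs (fun n => ENNReal.ofReal ((n : ℝ) * (θ ^ 2) ^ n)) J) (zero_le) (zero_le)
      _ = _ := by ring
  calc _ ≤ _ := measure_mono hsub
    _ ≤ _ := (measure_union_le _ _).trans (add_le_add ((measure_union_le _ _).trans (add_le_add ((measure_union_le _ _).trans (add_le_add e1 e2)) e3)) e4)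
    _ = Ca * (S1 + ENNReal.ofReal x + A1 * (2 * S1) + A2 * (2 * S2)) * P * I := by ring
    _ ≤ _ := mul_le_mul (mul_le_mul le_rfl hPl (zero_le) (zero_le)) le_rfl (zero_le) (zero_le)

end propA2

section final
variable (μ : Measure (EE d)) [IsFiniteMeasure μ] (R : ℝ) (hR : 0 ≤ R) (hμ : ∀ᵐ y ∂μ, ‖y‖ ≤ R)

/-- positive maximal function. -/
def MP (μ : Measure (EE d)) (f : EE d → ℝ) (z : EE d) : ℝ≥0∞ := ⨆ t : {t : ℝ // 0 < t}, convNN f μ t z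

lemma Fav_convNN (f : EE d → ℝ) (hf : Continuous f) (hf0 : ∀ z, 0 ≤ f z) (ρ : ℝ) (hρ : ∀ z, ρ < ‖z‖ → f z = 0) (t : ℝ) (z : EE d) :
    ‖Fav (fun z => (f z : ℂ)) μ t z‖ₑ = convNN f μ t z := by
  have hi := Fav_intg μ (fun z => (f z : ℂ)) (Complex.continuous_ofReal.comp hf) ρ (fun z hz => by simp [hρ z hz]) t z
  have hi' : Integrable (fun y => f (z - t • y)) μ := by simpa using hi.re
  unfold Fav convNN
  rw [← ofReal_integral_eq_lintegral_ofReal hi' (Filter.Eventually.of_forall fun y => hf0 _), integral_complex_ofReal, ← ofReal_norm, Complex.norm_real,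
    Real.norm_of_nonneg (integral_nonneg fun y => hf0 _)]

lemma MP_meas (f : EE d → ℝ) (hf : Continuous f) (hf0 : ∀ z, 0 ≤ f z) (ρ : ℝ) (hρ : ∀ z, ρ < ‖z‖ → f z = 0) :
    Measurable (MP μ f) := by
  apply LowerSemicontinuous.measurable
  unfold MP
  refine lowerSemicontinuous_iSup fun t => Continuous.lowerSemicontinuous ?_
  have e : (fun z => convNN f μ t z) = fun z => ‖Fav (fun z => (f z : ℂ)) μ t z‖ₑ := by
    funext z; exact (Fav_convNN μ f hf hf0 ρ hρ t z).symm
  change Continuous (fun z => convNN f μ t z)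
  rw [e]
  refine Continuous.enorm ?_
  have hc : Continuous fun z => (f z : ℂ) := Complex.continuous_ofReal.comp hf
  obtain ⟨B, hB⟩ := hc.bounded_above_of_compact_support (ftf_hcs _ ρ (fun z hz => by simp [hρ z hz]))
  unfold Fav
  refine continuous_of_dominated (bound := fun _ => B) (fun z => ?_) (fun z => Filter.Eventually.of_forall fun y => hB _) (integrable_const B)
    (Filter.Eventually.of_forall fun y => hc.comp (by fun_prop))
  exact (hc.comp (by fun_prop)).aestronglyMeasurable

lemma MP_set (f : EE d → ℝ) (hf : Continuous f) (hf0 : ∀ z, 0 ≤ f z) (ρ : ℝ) (hρ : ∀ z, ρ < ‖z‖ → f z = 0) (l : ℝ≥0∞) :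
    {z | l < MP μ f z} = {z | ∃ t : ℝ, 0 < t ∧ l < ‖Fav (fun z => (f z : ℂ)) μ t z‖ₑ} := by
  ext z
  simp only [mem_ofPred_eq, MP, lt_iSup_iff, Subtype.exists, Fav_convNN μ f hf hf0 ρ hρ, exists_prop]

include hR hμ in
theorem propB (hd : 1 ≤ d) (a C : ℝ) (ha : 1 / 2 < a) (hC : 0 ≤ C) (hdec : ∀ ξ : EE d, ξ ≠ 0 → ‖mV μ ξ‖ ≤ C * ‖ξ‖ ^ (-a)) :
    ∃ D : ℝ, 0 < D ∧ ∀ f : EE d → ℝ, Continuous f → (∀ z, 0 ≤ f z) → ∀ A : ℝ, 0 < A → (∀ z, f z ≤ A) →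
      ∀ ρ : ℝ, (∀ z, ρ < ‖z‖ → f z = 0) → ∀ l : ℝ, 0 < l →
      volume {z | ENNReal.ofReal l < MP μ f z} ≤
        ENNReal.ofReal (D * (l / A) ^ (-((2 * a + 1) / (2 * a)))) * volume {z | f z ≠ 0} := by
  obtain ⟨Cf, hCf, hA⟩ := propA μ R hR hμ hd a C ha hC hdec
  set p := (2 * a + 1) / (2 * a) with hp
  have hp0 : 0 < p := by rw [hp]; positivity
  set m := max 1 (μ univ).toReal with hm
  have hm1 : 1 ≤ m := le_max_left _ _
  have hm' : μ univ ≤ ENNReal.ofReal m := by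
    rw [← ENNReal.ofReal_toReal (measure_ne_top μ univ)]
    exact ENNReal.ofReal_le_ofReal (le_max_right _ _)
  -- the case of values in `[0,1]`
  have key : ∀ f : EE d → ℝ, Continuous f → (∀ z, 0 ≤ f z) → (∀ z, f z ≤ 1) →
      ∀ ρ : ℝ, (∀ z, ρ < ‖z‖ → f z = 0) → ∀ l : ℝ, 0 < l →
      volume {z | ENNReal.ofReal l < MP μ f z} ≤ ENNReal.ofReal ((Cf.toReal + 1) * m ^ p * l ^ (-p)) * ∫⁻ z, Ff f z := by
    intro f hf hf0 hf1 ρ hρ l hl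
    have c1 : Cf ≤ ENNReal.ofReal (Cf.toReal + 1) := by
      conv_lhs => rw [← ENNReal.ofReal_toReal hCf]
      exact ENNReal.ofReal_le_ofReal (by linarith)
    have hCf0 : 0 ≤ Cf.toReal := ENNReal.toReal_nonneg
    have hmp : 1 ≤ m ^ p := Real.one_le_rpow hm1 hp0.le
    rcases le_or_gt l 1 with h1 | h1
    · rw [MP_set μ f hf hf0 ρ hρ]
      refine (hA f hf hf0 hf1 ρ hρ l hl h1).trans ?_
      refine mul_le_mul ?_ le_rfl (zero_le) (zero_le)
      refine (mul_le_mul c1 le_rfl (zero_le) (zero_le)).trans ?_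
      rw [← ENNReal.ofReal_mul (by positivity)]
      apply ENNReal.ofReal_le_ofReal
      gcongr
      nlinarith
    rcases le_or_gt m l with h2 | h2
    · have : {z | ENNReal.ofReal l < MP μ f z} = ∅ := by
        rw [Set.eq_empty_iff_forall_notMem]
        intro z hz
        simp only [mem_ofPred_eq] at hz
        refine absurd hz (not_lt.2 ?_)
        refine le_trans ?_ (hm'.trans (ENNReal.ofReal_le_ofReal h2))
        unfold MP
        refine iSup_le fun t => ?_
        unfold convNN
        calc _ ≤ ∫⁻ y, 1 ∂μ := lintegral_mono fun y => by simpa using hf1 _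
          _ = _ := by simp
      rw [this]; simp
    · calc volume {z | ENNReal.ofReal l < MP μ f z} ≤ volume {z | ENNReal.ofReal 1 < MP μ f z} :=
            measure_mono fun z hz => lt_of_le_of_lt (ENNReal.ofReal_le_ofReal h1.le) hz
        _ ≤ Cf * ENNReal.ofReal ((1:ℝ) ^ (-p)) * ∫⁻ z, Ff f z := by
          rw [MP_set μ f hf hf0 ρ hρ]
          exact (hA f hf hf0 hf1 ρ hρ 1 one_pos le_rfl)
        _ ≤ _ := by
          rw [Real.one_rpow, ENNReal.ofReal_one, mul_one]
          refine mul_le_mul (c1.trans ?_) le_rfl (zero_le) (zero_le)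
          apply ENNReal.ofReal_le_ofReal
          rw [mul_assoc]
          refine le_mul_of_one_le_right (by positivity) ?_
          rw [Real.rpow_neg hl.le, ← div_eq_mul_inv, one_le_div (by positivity)]
          exact Real.rpow_le_rpow hl.le h2.le hp0.le
  have hCf0 : 0 ≤ Cf.toReal := ENNReal.toReal_nonneg
  refine ⟨(Cf.toReal + 1) * m ^ p, by positivity, ?_⟩
  intro f hf hf0 A hA0 hfA ρ hρ l hl
  have q := key (fun z => f z / A) (hf.div_const A) (fun z => div_nonneg (hf0 z) hA0.le) (fun z => (div_le_one hA0).2 (hfA z)) ρ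
    (fun z hz => by simp [hρ z hz]) (l / A) (by positivity)
  have eM : ∀ z, MP μ (fun z => f z / A) z = (ENNReal.ofReal A)⁻¹ * MP μ f z := by
    intro z
    unfold MP
    rw [ENNReal.mul_iSup]
    congr 1; funext t
    unfold convNN
    rw [← lintegral_const_mul _ (show Measurable fun y => ENNReal.ofReal (f (z - (t:ℝ) • y)) from
      (ENNReal.continuous_ofReal.comp (hf.comp (by fun_prop))).measurable)]
    congr 1; funext y
    rw [ENNReal.ofReal_div_of_pos hA0, div_eq_mul_inv, mul_comm]
  have hAe : ENNReal.ofReal A ≠ 0 := by simpa using hA0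
  have es : {z | ENNReal.ofReal l < MP μ f z} ⊆ {z | ENNReal.ofReal (l / A) < MP μ (fun z => f z / A) z} := by
    intro z hz
    simp only [mem_ofPred_eq] at hz ⊢
    rw [eM, ENNReal.ofReal_div_of_pos hA0, div_eq_mul_inv, mul_comm]
    exact (ENNReal.mul_lt_mul_iff_right (by simp) (by simpa using hAe)).2 hz
  refine (measure_mono es).trans (q.trans ?_)
  refine mul_le_mul le_rfl ?_ (zero_le) (zero_le)
  have hms : MeasurableSet {z | f z ≠ 0} := (isOpen_ne_fun hf continuous_const).measurableSet
  rw [← lintegral_indicator_one hms]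
  refine lintegral_mono fun z => ?_
  by_cases hz : f z = 0
  · simp [Ff, hz]
  · rw [Set.indicator_of_mem (by simpa using hz)]
    simp only [Ff, Pi.one_apply]
    rw [ENNReal.ofReal_le_one]
    exact (div_le_one hA0).2 (hfA z)

lemma lemW (p : ℝ) (hp : 1 < p) : ∃ K : ℝ, 0 < K ∧ ∀ g : EE d → ℝ≥0∞, Measurable g → ∀ A : ℝ, 0 < A →
    (∀ l : ℝ, 0 < l → volume {z | ENNReal.ofReal l < g z} ≤ ENNReal.ofReal (A ^ p * l ^ (-p))) →
    ∀ S : Set (EE d), ∀ s : ℝ, 0 < s → volume S = ENNReal.ofReal s →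
      ∫⁻ z in S, g z ≤ ENNReal.ofReal (K * A * s ^ (1 - 1 / p)) := by
  set r : ℝ := 2 ^ (1 - p) with hr
  have hr0 : 0 < r := by positivity
  have hr1 : r < 1 := Real.rpow_lt_one_of_one_lt_of_neg one_lt_two (by linarith)
  have hr1' : 0 < 1 - r := by linarith
  refine ⟨1 + 2 * (1 - r)⁻¹, by positivity, ?_⟩
  intro g hg A hA hgA S s hs hS
  set δ := A * s ^ (-(1 / p)) with hδ
  have hδ0 : 0 < δ := by positivity
  set Q := A * s ^ (1 - 1 / p) with hQ
  have e1 : δ * s = Q := by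
    rw [hδ, hQ, mul_assoc, sub_eq_add_neg, Real.rpow_add hs, Real.rpow_one]; ring
  have e2 : ∀ n : ℕ, δ * 2 ^ (n + 1) * (A ^ p * (δ * 2 ^ n) ^ (-p)) = 2 * Q * r ^ n := by
    intro n
    have q1 : (δ * 2 ^ n) ^ (-p) = A ^ (-p) * s * ((2:ℝ) ^ n) ^ (-p) := by
      rw [Real.mul_rpow (by positivity) (by positivity), hδ, Real.mul_rpow (by positivity) (by positivity), ← Real.rpow_mul hs.le]
      have : -(1 / p) * -p = 1 := by field_simp
      rw [this, Real.rpow_one]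
    have q2 : r ^ n = 2 ^ n * ((2:ℝ) ^ n) ^ (-p) := by
      rw [hr, ← Real.rpow_natCast, ← Real.rpow_mul (by norm_num), ← Real.rpow_natCast, ← Real.rpow_mul (by norm_num), ← Real.rpow_add (by norm_num)]
      congr 1; ring
    have q3 : A ^ p * A ^ (-p) = 1 := by rw [← Real.rpow_add hA]; simp
    rw [q1, q2, ← e1, pow_succ]
    linear_combination (δ * 2 ^ n * 2 * s * ((2:ℝ) ^ n) ^ (-p)) * q3
  have ptw : ∀ z, g z ≤ ENNReal.ofReal δ + ∑' n : ℕ, {z | ENNReal.ofReal (δ * 2 ^ n) < g z}.indicator (fun _ => ENNReal.ofReal (δ * 2 ^ (n + 1))) z := by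
    intro z
    rcases le_or_gt (g z) (ENNReal.ofReal δ) with h | h
    · exact h.trans le_self_add
    · refine le_trans ?_ le_add_self
      have hone : ∀ n : ℕ, ENNReal.ofReal (δ * 2 ^ n) < g z → ENNReal.ofReal (δ * 2 ^ (n + 1)) ≤
          ∑' n : ℕ, {z | ENNReal.ofReal (δ * 2 ^ n) < g z}.indicator (fun _ => ENNReal.ofReal (δ * 2 ^ (n + 1))) z := by
        intro n hn
        refine le_trans ?_ (ENNReal.le_tsum n)
        rw [Set.indicator_of_mem (by simpa using hn)]
      by_cases ht : g z = ⊤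
      · have : Filter.Tendsto (fun n : ℕ => ENNReal.ofReal (δ * 2 ^ (n + 1))) Filter.atTop (nhds ⊤) := by
          refine ENNReal.tendsto_ofReal_atTop.comp ?_
          exact ((tendsto_pow_atTop_atTop_of_one_lt one_lt_two).comp (Filter.tendsto_add_atTop_nat 1)).const_mul_atTop hδ0
        rw [ht]
        exact le_of_tendsto this (Filter.Eventually.of_forall fun n => hone n (by rw [ht]; exact ENNReal.ofReal_lt_top))
      · set w := (g z).toReal with hw
        have hwz : g z = ENNReal.ofReal w := (ENNReal.ofReal_toReal ht).symm
        have hwδ : δ < w := by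
          rw [hwz] at h
          exact (ENNReal.ofReal_lt_ofReal_iff_of_nonneg hδ0.le).1 h
        have hex : ∃ n : ℕ, w ≤ δ * 2 ^ (n + 1) := by
          obtain ⟨n, hn⟩ := pow_unbounded_of_one_lt (w / δ) one_lt_two
          refine ⟨n, ?_⟩
          rw [div_lt_iff₀ hδ0] at hn
          rw [pow_succ]; nlinarith [pow_pos (two_pos (α := ℝ)) n]
        classical
        have hf1 := Nat.find_spec hex
        have hf2 : δ * 2 ^ (Nat.find hex) < w := by
          rcases Nat.eq_zero_or_pos (Nat.find hex) with h0 | h0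
          · rw [h0]; simpa using hwδ
          · have := Nat.find_min hex (Nat.sub_lt h0 one_pos)
            rw [show Nat.find hex - 1 + 1 = Nat.find hex by omega] at this
            exact not_le.1 this
        refine le_trans ?_ (hone (Nat.find hex) ?_)
        · rw [hwz]; exact ENNReal.ofReal_le_ofReal hf1
        · rw [hwz]; exact (ENNReal.ofReal_lt_ofReal_iff_of_nonneg (by positivity)).2 hf2
  have hms : ∀ n : ℕ, MeasurableSet {z | ENNReal.ofReal (δ * 2 ^ n) < g z} := fun n => measurableSet_lt measurable_const hg
  calc ∫⁻ z in S, g z ≤ ∫⁻ z in S, (ENNReal.ofReal δ + ∑' n : ℕ, {z | ENNReal.ofReal (δ * 2 ^ n) < g z}.indicator (fun _ => ENNReal.ofReal (δ * 2 ^ (n + 1))) z) :=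
        lintegral_mono ptw
    _ = ENNReal.ofReal δ * volume S + ∑' n : ℕ, ∫⁻ z in S, {z | ENNReal.ofReal (δ * 2 ^ n) < g z}.indicator (fun _ => ENNReal.ofReal (δ * 2 ^ (n + 1))) z := by
        rw [lintegral_add_left measurable_const, setLIntegral_const, lintegral_tsum fun n => (measurable_const.indicator (hms n)).aemeasurable]
    _ ≤ ENNReal.ofReal Q + ∑' n : ℕ, ENNReal.ofReal (2 * Q * r ^ n) := by
        refine add_le_add ?_ (ENNReal.tsum_le_tsum fun n => ?_)
        · rw [hS, ← ENNReal.ofReal_mul hδ0.le, e1]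
        · refine (setLIntegral_le_lintegral _ _).trans ?_
          rw [lintegral_indicator_const (hms n)]
          refine (mul_le_mul le_rfl (hgA _ (by positivity)) (zero_le) (zero_le)).trans ?_
          rw [← ENNReal.ofReal_mul (by positivity), e2]
    _ = ENNReal.ofReal Q + ENNReal.ofReal (2 * Q * (1 - r)⁻¹) := by
        have hs' := (hasSum_geometric_of_lt_one hr0.le hr1).mul_left (2 * Q)
        rw [← ENNReal.ofReal_tsum_of_nonneg (fun n => by positivity) hs'.summable, hs'.tsum_eq]
    _ = _ := by
        rw [← ENNReal.ofReal_add (by positivity) (by positivity)]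
        congr 1; rw [hQ]; ring

end final

section finish

/-- dyadic layers of `|f|`. -/
def lay (f : EE d → ℂ) (n : ℤ) (z : EE d) : ℝ := min (max (‖f z‖ - (2:ℝ) ^ n) 0) ((2:ℝ) ^ n)

lemma lay_cont (f : EE d → ℂ) (hf : Continuous f) (n : ℤ) : Continuous (lay f n) := by
  unfold lay; fun_prop

lemma lay_nonneg (f : EE d → ℂ) (n : ℤ) (z : EE d) : 0 ≤ lay f n z := le_min (le_max_right _ _) (by positivity)

lemma lay_le (f : EE d → ℂ) (n : ℤ) (z : EE d) : lay f n z ≤ (2:ℝ) ^ n := min_le_right _ _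

lemma lay_zero (f : EE d → ℂ) (n : ℤ) (z : EE d) (h : ‖f z‖ ≤ (2:ℝ) ^ n) : lay f n z = 0 := by
  unfold lay
  rw [max_eq_right (by linarith), min_eq_left (by positivity)]

lemma lay_sum (f : EE d → ℂ) (z : EE d) : ‖f z‖ₑ ≤ 4 * ∑' n : ℤ, Ff (lay f n) z := by
  by_cases h : f z = 0
  · simp [h]
  have hp : 0 < ‖f z‖ := norm_pos_iff.2 h
  obtain ⟨n, hn⟩ := exists_mem_Ico_zpow hp one_lt_two
  refine le_trans ?_ (mul_le_mul le_rfl (ENNReal.le_tsum (n - 1)) (zero_le) (zero_le))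
  have e2 : (2:ℝ) ^ n = 2 * 2 ^ (n - 1) := by
    rw [← zpow_one_add₀ (by norm_num)]; congr 1; ring
  have e3 : (2:ℝ) ^ (n + 1) = 4 * 2 ^ (n - 1) := by rw [zpow_add_one₀ (by norm_num), e2]; ring
  have h1 := hn.1
  have h2 := hn.2
  rw [e2] at h1
  rw [e3] at h2
  have hq : (0:ℝ) < 2 ^ (n - 1) := by positivity
  have e : lay f (n - 1) z = 2 ^ (n - 1) := by
    unfold lay
    rw [max_eq_left (by linarith), min_eq_right (by linarith)]
  rw [Ff, e, ← ofReal_norm, ← ENNReal.ofReal_ofNat 4, ← ENNReal.ofReal_mul (by norm_num)]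
  exact ENNReal.ofReal_le_ofReal h2.le

lemma Mmax_le (μ : Measure (EE d)) (f : EE d → ℂ) (hf : Continuous f) (z : EE d) :
    Mmax μ f z ≤ 4 * ∑' n : ℤ, MP μ (lay f n) z := by
  unfold Mmax
  refine iSup_le fun t => ?_
  change ‖convM f μ t z‖ₑ ≤ _
  unfold convM
  refine (enorm_integral_le_lintegral_enorm _).trans ?_
  have hm : ∀ n : ℤ, Measurable fun y => Ff (lay f n) (z - (t:ℝ) • y) := fun n =>
    (ENNReal.continuous_ofReal.comp ((lay_cont f hf n).comp (by fun_prop))).measurable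
  calc _ ≤ ∫⁻ y, 4 * ∑' n : ℤ, Ff (lay f n) (z - (t:ℝ) • y) ∂μ := lintegral_mono fun y => lay_sum f _
    _ = 4 * ∑' n : ℤ, convNN (lay f n) μ t z := by
      rw [lintegral_const_mul _ (show Measurable fun y => ∑' n : ℤ, Ff (lay f n) (z - (t:ℝ) • y) from Measurable.tsum hm),
        lintegral_tsum fun n => (hm n).aemeasurable]
      rfl
    _ ≤ _ := by
      refine mul_le_mul le_rfl (ENNReal.tsum_le_tsum fun n => ?_) (zero_le) (zero_le)
      exact le_iSup (fun t : {t : ℝ // 0 < t} => convNN (lay f n) μ t z) t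

lemma lor_sum (f : EE d → ℂ) (q : ℝ) (hq : 0 ≤ q) :
    ∑' n : ℤ, ENNReal.ofReal ((2:ℝ) ^ n) * volume {z | (2:ℝ) ^ n < ‖f z‖} ^ q ≤
      2 * ∫⁻ l in Ioi (0:ℝ), volume {z | l < ‖f z‖} ^ q := by
  have hdis : Pairwise (Function.onFun Disjoint fun n : ℤ => Ioc ((2:ℝ) ^ (n - 1)) ((2:ℝ) ^ n)) := by
    intro i j hij
    rw [Function.onFun, Set.disjoint_left]
    rintro l ⟨h1, h2⟩ ⟨h3, h4⟩
    have a1 := h1.trans_le h4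
    have a2 := h3.trans_le h2
    rw [zpow_lt_zpow_iff_right₀ one_lt_two] at a1 a2
    omega
  have hsub : (⋃ n : ℤ, Ioc ((2:ℝ) ^ (n - 1)) ((2:ℝ) ^ n)) ⊆ Ioi (0:ℝ) := by
    refine Set.iUnion_subset fun n l hl => ?_
    exact lt_trans (by positivity : (0:ℝ) < 2 ^ (n - 1)) hl.1
  calc _ ≤ ∑' n : ℤ, 2 * ∫⁻ l in Ioc ((2:ℝ) ^ (n - 1)) ((2:ℝ) ^ n), volume {z | l < ‖f z‖} ^ q := by
        refine ENNReal.tsum_le_tsum fun n => ?_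
        have e2 : (2:ℝ) ^ n = 2 * 2 ^ (n - 1) := by
          rw [← zpow_one_add₀ (by norm_num)]; congr 1; ring
        calc ENNReal.ofReal ((2:ℝ) ^ n) * volume {z | (2:ℝ) ^ n < ‖f z‖} ^ q
            = 2 * ∫⁻ l in Ioc ((2:ℝ) ^ (n - 1)) ((2:ℝ) ^ n), volume {z | (2:ℝ) ^ n < ‖f z‖} ^ q := by
              rw [setLIntegral_const, Real.volume_Ioc]
              have : ENNReal.ofReal ((2:ℝ) ^ n) = 2 * ENNReal.ofReal ((2:ℝ) ^ n - 2 ^ (n - 1)) := by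
                rw [← ENNReal.ofReal_ofNat 2, ← ENNReal.ofReal_mul (by norm_num)]
                congr 1; rw [e2]; ring
              rw [this]; ring
          _ ≤ _ := by
              refine mul_le_mul le_rfl ?_ (zero_le) (zero_le)
              refine setLIntegral_mono' measurableSet_Ioc fun l hl => ?_
              refine ENNReal.rpow_le_rpow (measure_mono fun z hz => ?_) hq
              exact lt_of_le_of_lt hl.2 hz
    _ = 2 * ∫⁻ l in ⋃ n : ℤ, Ioc ((2:ℝ) ^ (n - 1)) ((2:ℝ) ^ n), volume {z | l < ‖f z‖} ^ q := by
        rw [ENNReal.tsum_mul_left, lintegral_iUnion (fun n => measurableSet_Ioc) hdis]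
    _ ≤ _ := mul_le_mul le_rfl (lintegral_mono_set hsub) (zero_le) (zero_le)

lemma weak_sum (p : ℝ) (hp : 1 < p) (K : ℝ) (hK : 0 < K) (G : EE d → ℝ≥0∞) (hG : Measurable G) (B : ℝ≥0∞)
    (h : ∀ S : Set (EE d), MeasurableSet S → ∀ s : ℝ, 0 < s → volume S = ENNReal.ofReal s → ∫⁻ z in S, G z ≤ B * ENNReal.ofReal (s ^ (1 - 1 / p)))
    (l : ℝ≥0) : (l : ℝ≥0∞) * volume {z | (l : ℝ≥0∞) < G z} ^ (1 / p) ≤ B := by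
  have hp0 : 0 < p := by linarith
  by_cases hl : l = 0
  · simp [hl]
  have hl0 : (l : ℝ≥0∞) ≠ 0 := by simpa using hl
  by_cases hB : B = ⊤
  · simp [hB]
  have hm : MeasurableSet {z | (l : ℝ≥0∞) < G z} := measurableSet_lt measurable_const hG
  rw [mul_comm, ← ENNReal.le_div_iff_mul_le (Or.inl hl0) (Or.inl (by simp))]
  by_contra hcon
  rw [not_le] at hcon
  have hcon' : (B / l) ^ p < volume {z | (l : ℝ≥0∞) < G z} := by
    have := ENNReal.rpow_lt_rpow hcon hp0
    rwa [← ENNReal.rpow_mul, one_div_mul_cancel hp0.ne', ENNReal.rpow_one] at this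
  obtain ⟨S, hS, hSs, hS1, hS2⟩ := Measure.exists_subset_measure_lt_top hm hcon'
  set s := (volume S).toReal with hs
  have hs0 : 0 < s := ENNReal.toReal_pos (ne_bot_of_gt hS1) hS2.ne
  have hsv : volume S = ENNReal.ofReal s := (ENNReal.ofReal_toReal hS2.ne).symm
  have q := h S hS s hs0 hsv
  have q2 : (l : ℝ≥0∞) * ENNReal.ofReal s ≤ B * ENNReal.ofReal (s ^ (1 - 1 / p)) := by
    refine le_trans ?_ q
    rw [← hsv, ← setLIntegral_const]
    exact setLIntegral_mono' hS fun z hz => (hSs hz).le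
  have q3 : ENNReal.ofReal s = ENNReal.ofReal (s ^ (1 / p)) * ENNReal.ofReal (s ^ (1 - 1 / p)) := by
    rw [← ENNReal.ofReal_mul (by positivity), ← Real.rpow_add hs0]; simp
  have hne : ENNReal.ofReal (s ^ (1 - 1 / p)) ≠ 0 := by
    simp only [ne_eq, ENNReal.ofReal_eq_zero, not_le]; positivity
  rw [q3, ← mul_assoc, ENNReal.mul_le_mul_iff_left hne (by simp), mul_comm, ← ENNReal.le_div_iff_mul_le (Or.inl hl0) (Or.inl (by simp)),
    ← ENNReal.ofReal_rpow_of_pos hs0, ← hsv] at q2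
  have : volume S ≤ (B / l) ^ p := by
    have := ENNReal.rpow_le_rpow q2 hp0.le
    rwa [← ENNReal.rpow_mul, one_div_mul_cancel hp0.ne', ENNReal.rpow_one] at this
  exact absurd hS1 (not_lt.2 this)

theorem stmt1_aux (d : ℕ) (hd : 1 ≤ d) (μ : Measure (EuclideanSpace ℝ (Fin d)))
    [IsFiniteMeasure μ] (hcomp : ∃ K : Set (EuclideanSpace ℝ (Fin d)), IsCompact K ∧ μ Kᶜ = 0)
    (a C : ℝ) (ha : 1/2 < a)
    (hdecay : ∀ ξ : EuclideanSpace ℝ (Fin d), ξ ≠ 0 → ‖mFT μ ξ‖ ≤ C * ‖ξ‖ ^ (-a)) :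
    ∃ C' : ℝ, 0 < C' ∧ ∀ f : SchwartzMap (EuclideanSpace ℝ (Fin d)) ℂ,
      wlpE (Mmax μ ⇑f) ((2*a+1)/(2*a)) ≤
        ENNReal.ofReal C' * lorentz1 (⇑f) ((2*a+1)/(2*a)) := by
  obtain ⟨K0, hK0, hK0'⟩ := hcomp
  obtain ⟨R0, hR0⟩ := hK0.isBounded.subset_closedBall (0 : EE d)
  have hμ : ∀ᵐ y ∂μ, ‖y‖ ≤ max R0 0 := by
    have : ∀ᵐ y ∂μ, y ∈ K0 := by rw [ae_iff]; exact hK0'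
    filter_upwards [this] with y hy
    have := hR0 hy
    rw [mem_closedBall_zero_iff] at this
    exact this.trans (le_max_left _ _)
  have hmV : ∀ ξ, mV μ ξ = mFT μ ξ := by
    intro ξ
    unfold mV mFT
    congr 1; funext y
    congr 1; push_cast; ring
  have hdec : ∀ ξ : EE d, ξ ≠ 0 → ‖mV μ ξ‖ ≤ |C| * ‖ξ‖ ^ (-a) := by
    intro ξ hξ
    rw [hmV]
    refine (hdecay ξ hξ).trans ?_
    gcongr
    exact le_abs_self C
  obtain ⟨D, hD, hB⟩ := propB μ (max R0 0) (le_max_right _ _) hμ hd a |C| ha (abs_nonneg C) hdec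
  set p := (2 * a + 1) / (2 * a) with hp
  have hp1 : 1 < p := by rw [hp, one_lt_div (by linarith)]; linarith
  have hp0 : 0 < p := by linarith
  obtain ⟨K, hK, hW⟩ := lemW (d := d) p hp1
  set E := K * D ^ (1 / p) with hE
  have hE0 : 0 < E := by positivity
  refine ⟨4 * E * 2, by positivity, fun f => ?_⟩
  have hfc : Continuous (f : EE d → ℂ) := f.continuous
  have hsupp : ∀ n : ℤ, ∃ ρ : ℝ, ∀ z, ρ < ‖z‖ → lay f n z = 0 := by
    intro n
    obtain ⟨Cd, hCd, hdd⟩ := f.decay 1 0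
    refine ⟨Cd / 2 ^ n, fun z hz => lay_zero f n z ?_⟩
    have h1 := hdd z
    rw [pow_one, norm_iteratedFDeriv_zero] at h1
    have h2n : (0:ℝ) < 2 ^ n := by positivity
    have hz0 : 0 < ‖z‖ := lt_trans (by positivity) hz
    rw [div_lt_iff₀ h2n] at hz
    by_contra hcon
    rw [not_le] at hcon
    nlinarith
  choose ρ hρ using hsupp
  set v : ℤ → ℝ≥0∞ := fun n => volume {z | lay f n z ≠ 0} with hv
  have hvt : ∀ n, v n ≠ ⊤ := by
    intro n
    refine ne_top_of_le_ne_top (measure_closedBall_lt_top (x := (0 : EE d)) (r := ρ n)).ne (measure_mono fun z hz => ?_)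
    rw [mem_closedBall_zero_iff]
    by_contra h
    exact hz (hρ n z (not_le.1 h))
  have hvle : ∀ n, v n ≤ volume {z | (2:ℝ) ^ n < ‖f z‖} := by
    intro n
    refine measure_mono fun z hz => ?_
    simp only [mem_ofPred_eq] at hz ⊢
    by_contra h
    exact hz (lay_zero f n z (not_lt.1 h))
  -- estimate for one layer
  have hone : ∀ n : ℤ, ∀ S : Set (EE d), ∀ s : ℝ, 0 < s → volume S = ENNReal.ofReal s →
      ∫⁻ z in S, MP μ (lay f n) z ≤ ENNReal.ofReal E * (ENNReal.ofReal ((2:ℝ) ^ n) * v n ^ (1 / p)) * ENNReal.ofReal (s ^ (1 - 1 / p)) := by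
    intro n S s hs hS
    have h2n : (0:ℝ) < 2 ^ n := by positivity
    by_cases hv0 : v n = 0
    · have hop : IsOpen {z | lay f n z ≠ 0} := isOpen_ne_fun (lay_cont f hfc n) continuous_const
      have hem := hop.eq_empty_of_measure_zero hv0
      have hz : ∀ z, lay f n z = 0 := by
        intro z
        by_contra h
        have : z ∈ {z | lay f n z ≠ 0} := h
        rw [hem] at this
        exact this
      have : ∀ z, MP μ (lay f n) z = 0 := by
        intro z; simp [MP, convNN, hz]
      simp [this]
    · set w := (v n).toReal with hw
      have hw0 : 0 < w := ENNReal.toReal_pos hv0 (hvt n)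
      have hwv : v n = ENNReal.ofReal w := (ENNReal.ofReal_toReal (hvt n)).symm
      set A := D ^ (1 / p) * 2 ^ n * w ^ (1 / p) with hA
      have hA0 : 0 < A := by positivity
      have hAp : A ^ p = D * (2 ^ n) ^ p * w := by
        rw [hA, Real.mul_rpow (by positivity) (by positivity), Real.mul_rpow (by positivity) (by positivity), ← Real.rpow_mul hD.le, ← Real.rpow_mul hw0.le,
          one_div_mul_cancel hp0.ne', Real.rpow_one, Real.rpow_one]
      refine (hW (MP μ (lay f n)) (MP_meas μ _ (lay_cont f hfc n) (lay_nonneg f n) (ρ n) (hρ n)) A hA0 ?_ S s hs hS).trans (le_of_eq ?_)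
      · intro l hl
        refine (hB (lay f n) (lay_cont f hfc n) (lay_nonneg f n) (2 ^ n) h2n (lay_le f n) (ρ n) (hρ n) l hl).trans (le_of_eq ?_)
        change _ * v n = _
        rw [hwv, ← ENNReal.ofReal_mul (by positivity)]
        congr 1
        rw [hAp, Real.div_rpow hl.le h2n.le, Real.rpow_neg h2n.le, div_inv_eq_mul]
        ring
      · rw [hwv, ENNReal.ofReal_rpow_of_pos hw0, ← ENNReal.ofReal_mul (by positivity), ← ENNReal.ofReal_mul (by positivity), ← ENNReal.ofReal_mul (by positivity)]
        congr 1
        rw [hA, hE]; ring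
  have hGm : ∀ n : ℤ, Measurable (MP μ (lay f n)) := fun n => MP_meas μ _ (lay_cont f hfc n) (lay_nonneg f n) (ρ n) (hρ n)
  set B := 4 * (ENNReal.ofReal E * ∑' n : ℤ, ENNReal.ofReal ((2:ℝ) ^ n) * v n ^ (1 / p)) with hBdef
  have hGM : Measurable fun z => ∑' n : ℤ, MP μ (lay f n) z := Measurable.tsum hGm
  have hws := weak_sum p hp1 K hK (fun z => 4 * ∑' n : ℤ, MP μ (lay f n) z) (hGM.const_mul 4) B (by
    intro S hSm s hs hS
    rw [lintegral_const_mul _ hGM, lintegral_tsum fun n => (hGm n).aemeasurable, hBdef, mul_assoc]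
    refine mul_le_mul le_rfl ?_ (zero_le) (zero_le)
    refine (ENNReal.tsum_le_tsum fun n => hone n S s hs hS).trans (le_of_eq ?_)
    rw [ENNReal.tsum_mul_right, ENNReal.tsum_mul_left])
  have hBle : B ≤ ENNReal.ofReal (4 * E * 2) * lorentz1 (⇑f) p := by
    have q := lor_sum (f : EE d → ℂ) (1 / p) (by positivity)
    have q2 : ∑' n : ℤ, ENNReal.ofReal ((2:ℝ) ^ n) * v n ^ (1 / p) ≤ 2 * lorentz1 (⇑f) p := by
      refine le_trans (ENNReal.tsum_le_tsum fun n => ?_) q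
      exact mul_le_mul le_rfl (ENNReal.rpow_le_rpow (hvle n) (by positivity)) (zero_le) (zero_le)
    calc B ≤ 4 * (ENNReal.ofReal E * (2 * lorentz1 (⇑f) p)) :=
          mul_le_mul le_rfl (mul_le_mul le_rfl q2 (zero_le) (zero_le)) (zero_le) (zero_le)
      _ = _ := by
        rw [ENNReal.ofReal_mul (p := 4 * E) (by positivity), ENNReal.ofReal_mul (p := 4) (by positivity), ENNReal.ofReal_ofNat, ENNReal.ofReal_ofNat]; ring
  unfold wlpE
  refine iSup_le fun l => ?_
  refine le_trans ?_ ((hws l).trans hBle)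
  refine mul_le_mul le_rfl (ENNReal.rpow_le_rpow (measure_mono fun z hz => ?_) (by positivity)) (zero_le) (zero_le)
  exact lt_of_lt_of_le hz (Mmax_le μ f hfc z)

end finish

/-- Endpoint restricted weak-type estimate: ‖M_μ f‖_{L^{p_a,∞}} ≤ C'‖f‖_{L^{p_a,1}},
where p_a = (2a+1)/(2a). -/
theorem stmt1 (d : ℕ) (hd : 1 ≤ d) (μ : Measure (EuclideanSpace ℝ (Fin d)))
    [IsFiniteMeasure μ] (hcomp : ∃ K : Set (EuclideanSpace ℝ (Fin d)), IsCompact K ∧ μ Kᶜ = 0)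
    (a C : ℝ) (ha : 1/2 < a)
    (hdecay : ∀ ξ : EuclideanSpace ℝ (Fin d), ξ ≠ 0 → ‖mFT μ ξ‖ ≤ C * ‖ξ‖ ^ (-a)) :
    ∃ C' : ℝ, 0 < C' ∧ ∀ f : SchwartzMap (EuclideanSpace ℝ (Fin d)) ℂ,
      wlpE (Mmax μ ⇑f) ((2*a+1)/(2*a)) ≤
        ENNReal.ofReal C' * lorentz1 (⇑f) ((2*a+1)/(2*a)) := by
  exact stmt1_aux d hd μ hcomp a C ha hdecay
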